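/- arXiv:2505.09797 — 2 statements merged into one kernel-verified Lean document; each statement's English description precedes it below -/
import Mathlib

section
/- Let q be an odd prime power, F = 𝔽_q or 𝔽_{q²}, and let σ be an involutive automorphism of G = GL_n(F) of the form σ(X) = B·τ(X)·B⁻¹ or σ(X) = B·τ((X⁻¹)ᵀ)·B⁻¹, where τ is a field automorphism of F with τ∘τ = id applied entrywise and B ∈ GL_n(F); let H = {g ∈ G : σ(g) = g}. Let (n_1, …, n_m) be a composition of n, L = GL_{n_1}(F) × ⋯ × GL_{n_m}(F) the block diagonal Levi subgroup, and π a complex representation of L. If the parabolic induction of π to G has a nonzero H-fixed vector, then there exist: a refinement of the composition (obtained by replacing each n_i with a composition of n_i), with associated block diagonal Levi L' ⊆ L and the group U' := L ∩ U(refined composition) of block upper unitriangular matrices of the refinement lying in L, and an element A ∈ G, such that the map θ(X) := A·σ(X)·A⁻¹ satisfies θ∘θ = id and θ(L') = L', and the subspace π^{U'} of U'-fixed vectors of π contains a nonzero vector fixed by every g ∈ L' with θ(g) = g. -/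
open Matrix

/-- For a composition `(n 0, …, n (m-1))` we index `GL_N(F)` (`N = Σ nᵢ`) by the sigma
type `Σ i, Fin (n i)`, so that position `⟨i, a⟩` is the `a`-th spot of the `i`-th
block.  `M` is block upper triangular (lies in the standard parabolic `P`) if all
entries below the block diagonal vanish. -/
def IsParabC {m : ℕ} {n : Fin m → ℕ} {F : Type*} [Field F]
    (M : Matrix ((i : Fin m) × Fin (n i)) ((i : Fin m) × Fin (n i)) F) : Prop :=
  ∀ x y : (i : Fin m) × Fin (n i), y.1 < x.1 → M x y = 0

/-- `M` is block diagonal (lies in the standard Levi `L`) for the composition. -/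
def IsLeviC {m : ℕ} {n : Fin m → ℕ} {F : Type*} [Field F]
    (M : Matrix ((i : Fin m) × Fin (n i)) ((i : Fin m) × Fin (n i)) F) : Prop :=
  ∀ x y : (i : Fin m) × Fin (n i), x.1 ≠ y.1 → M x y = 0

/-- `M` (a single block) is block diagonal for the sub-composition encoded by the
monotone surjection `c`. -/
def IsBlockDiagWrt {nn t : ℕ} {F : Type*} [Field F] (c : Fin nn → Fin t)
    (M : Matrix (Fin nn) (Fin nn) F) : Prop :=
  ∀ a b : Fin nn, c a ≠ c b → M a b = 0

/-- `M` (a single block) is block upper unitriangular for the sub-composition encoded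
by the monotone surjection `c`. -/
def IsBlockUnitriWrt {nn t : ℕ} {F : Type*} [Field F] (c : Fin nn → Fin t)
    (M : Matrix (Fin nn) (Fin nn) F) : Prop :=
  ∀ a b : Fin nn, c b ≤ c a → M a b = if a = b then 1 else 0

section TriangularMatrices

variable {ι F α : Type*}

/-- `X` is triangular with respect to the preorder pulled back along `β`. -/
def Tri [Zero F] [Preorder α] (β : ι → α) (X : Matrix ι ι F) : Prop :=
  ∀ x y, ¬ β x ≤ β y → X x y = 0

/-- `X` is strictly triangular with respect to the preorder pulled back along `β`. -/
def STri [Zero F] [Preorder α] (β : ι → α) (X : Matrix ι ι F) : Prop :=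
  ∀ x y, ¬ β x < β y → X x y = 0

variable [Field F] [PartialOrder α] {β : ι → α} {X Y : Matrix ι ι F}

lemma STri.tri (h : STri β X) : Tri β X := fun x y hxy => h x y fun h' => hxy h'.le

lemma Tri.add (hX : Tri β X) (hY : Tri β Y) : Tri β (X + Y) := fun x y h => by
  simp [hX x y h, hY x y h]

lemma Tri.sub (hX : Tri β X) (hY : Tri β Y) : Tri β (X - Y) := fun x y h => by
  simp [hX x y h, hY x y h]

lemma STri.add (hX : STri β X) (hY : STri β Y) : STri β (X + Y) := fun x y h => by
  simp [hX x y h, hY x y h]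

lemma STri.neg (hX : STri β X) : STri β (-X) := fun x y h => by
  simp [hX x y h]

lemma stri_sum {κ : Type*} (s : Finset κ) (X : κ → Matrix ι ι F) (h : ∀ k ∈ s, STri β (X k)) :
    STri β (∑ k ∈ s, X k) := fun x y hxy => by
  rw [Matrix.sum_apply]
  exact Finset.sum_eq_zero fun k hk => h k hk x y hxy

lemma tri_diagonal [DecidableEq ι] (v : ι → F) : Tri β (diagonal v) := fun x y h => by
  rw [diagonal_apply_ne]
  rintro rfl
  exact h le_rfl

lemma tri_one [DecidableEq ι] : Tri β (1 : Matrix ι ι F) := tri_diagonal _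

lemma Tri.mul [Fintype ι] (hX : Tri β X) (hY : Tri β Y) : Tri β (X * Y) := fun x y h => by
  rw [mul_apply]
  refine Finset.sum_eq_zero fun z _ => ?_
  by_cases h1 : β x ≤ β z
  · rw [hY z y fun h2 => h (h1.trans h2), mul_zero]
  · rw [hX x z h1, zero_mul]

lemma Tri.mul_stri [Fintype ι] (hX : Tri β X) (hY : STri β Y) : STri β (X * Y) := fun x y h => by
  rw [mul_apply]
  refine Finset.sum_eq_zero fun z _ => ?_
  by_cases h1 : β x ≤ β z
  · rw [hY z y fun h2 => h (h1.trans_lt h2), mul_zero]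
  · rw [hX x z h1, zero_mul]

lemma STri.mul_tri [Fintype ι] (hX : STri β X) (hY : Tri β Y) : STri β (X * Y) := fun x y h => by
  rw [mul_apply]
  refine Finset.sum_eq_zero fun z _ => ?_
  by_cases h1 : β x < β z
  · rw [hY z y fun h2 => h (h1.trans_le h2), mul_zero]
  · rw [hX x z h1, zero_mul]

lemma STri.isUnit_add [Fintype ι] [DecidableEq ι] (hX : STri β X) {a : F} (ha : a ≠ 0) :
    IsUnit (a • (1 : Matrix ι ι F) + X) := by
  rw [← Matrix.mulVec_injective_iff_isUnit]
  classical
  refine (injective_iff_map_eq_zero (Matrix.mulVecLin (a • (1 : Matrix ι ι F) + X))).2 ?_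
  intro v hv
  by_contra hne
  have hs : (Finset.univ.filter fun x => v x ≠ 0).Nonempty := by
    obtain ⟨x, hx⟩ := Function.ne_iff.1 hne
    exact ⟨x, by simpa using hx⟩
  obtain ⟨x, hx, hmax⟩ := Finset.exists_maximalFor β _ hs
  have hvx : v x ≠ 0 := by simpa using hx
  have hXv : (X *ᵥ v) x = 0 := by
    refine Finset.sum_eq_zero fun y _ => ?_
    by_cases hxy : β x < β y
    · have : v y = 0 := by
        by_contra hy
        exact (hxy.trans_le (hmax (by simpa using hy) hxy.le)).false
      simp [this]
    · simp [hX x y hxy]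
  have := congrFun hv x
  simp only [mulVecLin_apply, add_mulVec, smul_mulVec, one_mulVec, Pi.add_apply, Pi.smul_apply,
    smul_eq_mul, hXv, add_zero, Pi.zero_apply, mul_eq_zero] at this
  exact this.elim ha hvx

lemma inv_mem_of_finite {G : Type*} [Group G] [Finite G] (S : Submonoid G) {g : G} (hg : g ∈ S) :
    g⁻¹ ∈ S := by
  have h : g⁻¹ ∈ Submonoid.powers g :=
    mem_powers_iff_mem_zpowers.2 (inv_mem (Subgroup.mem_zpowers g))
  exact (Submonoid.powers_le.2 hg) h

variable [Fintype ι] [DecidableEq ι] [Finite F]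

variable (F) in
/-- The group of invertible triangular matrices. -/
def triSubgroup (β : ι → α) : Subgroup (GL ι F) :=
  let S : Submonoid (GL ι F) :=
    { carrier := {g | Tri β (g : Matrix ι ι F)}
      mul_mem' := fun {a b} ha hb => by
        simpa only [Set.mem_ofPred_eq, Units.val_mul] using Tri.mul ha hb
      one_mem' := tri_one }
  { S with inv_mem' := fun {_} hg => inv_mem_of_finite S hg }

variable (F) in
/-- The group of unitriangular matrices. -/
def uniSubgroup (β : ι → α) : Subgroup (GL ι F) :=
  let S : Submonoid (GL ι F) :=
    { carrier := {g | STri β ((g : Matrix ι ι F) - 1)}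
      mul_mem' := fun {a b} ha hb => by
        have h : (↑(a * b) : Matrix ι ι F) - 1 = (a - 1) * (b - 1) + (a - 1) + (b - 1) := by
          rw [Units.val_mul]; noncomm_ring
        rw [Set.mem_ofPred_eq, h]
        exact ((ha.mul_tri hb.tri).add ha).add hb
      one_mem' := by intro x y _; simp }
  { S with inv_mem' := fun {_} hg => inv_mem_of_finite S hg }

lemma mem_triSubgroup {g : GL ι F} : g ∈ triSubgroup F β ↔ Tri β (g : Matrix ι ι F) := Iff.rfl

lemma mem_uniSubgroup {g : GL ι F} :
    g ∈ uniSubgroup F β ↔ STri β ((g : Matrix ι ι F) - 1) := Iff.rfl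

lemma uniSubgroup_le_triSubgroup : uniSubgroup F β ≤ triSubgroup F β := fun g hg => by
  have := (STri.tri (mem_uniSubgroup.1 hg)).add tri_one
  rwa [sub_add_cancel] at this

lemma conj_mem_uniSubgroup {g u : GL ι F} (hg : g ∈ triSubgroup F β) (hu : u ∈ uniSubgroup F β) :
    g * u * g⁻¹ ∈ uniSubgroup F β := by
  have h : (↑(g * u * g⁻¹) : Matrix ι ι F) - 1 =
      (g : Matrix ι ι F) * (u - 1) * (↑g⁻¹ : Matrix ι ι F) := by
    rw [mul_sub, sub_mul, mul_one, Units.mul_inv, Units.val_mul, Units.val_mul]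
  rw [mem_uniSubgroup, h]
  exact (Tri.mul_stri hg hu).mul_tri (mem_triSubgroup.1 (inv_mem hg))

lemma odd_card_uniSubgroup (h2 : (2 : F) ≠ 0) (β : ι → α) : Odd (Nat.card (uniSubgroup F β)) := by
  rw [← Nat.not_even_iff_odd, even_iff_two_dvd]
  intro h
  obtain ⟨⟨g, hg⟩, hgo⟩ := exists_prime_orderOf_dvd_card' 2 h
  rw [Subgroup.orderOf_mk] at hgo
  have hg2 : (g : Matrix ι ι F) * g = 1 := by
    have := pow_orderOf_eq_one g
    rw [hgo, pow_two] at this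
    rw [← Units.val_mul, this, Units.val_one]
  have hu : IsUnit ((2 : F) • (1 : Matrix ι ι F) + (g - 1)) := STri.isUnit_add hg h2
  have h0 : ((2 : F) • (1 : Matrix ι ι F) + (g - 1)) * (g - 1) = 0 := by
    rw [two_smul]
    have : (1 + 1 + ((g : Matrix ι ι F) - 1)) * (g - 1) = g * g - 1 := by noncomm_ring
    rw [this, hg2, sub_self]
  have h1 : (g : Matrix ι ι F) - 1 = 0 := hu.mul_right_eq_zero.1 h0
  have : g = 1 := Units.ext (sub_eq_zero.1 h1)
  rw [this, orderOf_one] at hgo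
  omega

end TriangularMatrices

/-- An involution preserving an orbit of a finite group of odd order has a fixed point there. -/
lemma exists_fixed_mem_orbit {H X : Type*} [Group H] [Finite H] (hH : Odd (Nat.card H))
    (act : H → X → X) (one_act : ∀ x, act 1 x = x)
    (mul_act : ∀ h h' x, act (h * h') x = act h (act h' x))
    (Φ : X → X) (hΦ : ∀ x, Φ (Φ x) = x) (x₀ : X)
    (hst : ∀ h : H, ∃ h', act h' x₀ = Φ (act h x₀)) : ∃ h : H, Φ (act h x₀) = act h x₀ := by
  classical
  let : MulAction H X := { smul := act, one_smul := one_act, mul_smul := mul_act }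
  have hfin : Finite (MulAction.orbit H x₀) := Set.finite_range _
  have := Fintype.ofFinite (MulAction.orbit H x₀)
  have hmem : ∀ x ∈ MulAction.orbit H x₀, Φ x ∈ MulAction.orbit H x₀ := by
    rintro _ ⟨h, rfl⟩
    exact hst h
  let s : Equiv.Perm (MulAction.orbit H x₀) :=
    Function.Involutive.toPerm (fun x => ⟨Φ x, hmem x x.2⟩) fun x => Subtype.ext (hΦ x)
  have hodd : ¬ 2 ∣ Fintype.card (MulAction.orbit H x₀) := by
    rw [← even_iff_two_dvd, Nat.not_even_iff_odd, ← Nat.card_eq_fintype_card]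
    have h1 : Nat.card (MulAction.orbit H x₀) ∣ Nat.card H := by
      rw [Nat.card_congr (MulAction.orbitEquivQuotientStabilizer H x₀)]
      exact Subgroup.card_quotient_dvd_card _
    exact hH.of_dvd_nat h1
  have hs : s ^ 2 ^ 1 = 1 := by
    rw [pow_one, pow_two]
    exact Equiv.ext fun x => Subtype.ext (hΦ x)
  obtain ⟨⟨_, h, rfl⟩, hx⟩ := Equiv.Perm.exists_fixed_point_of_prime hodd hs
  exact ⟨h, congrArg Subtype.val hx⟩

section ProductOrder

variable {ι F α α' : Type*} [Field F] [LinearOrder α] [LinearOrder α'] {b : ι → α} {d : ι → α'}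
  {X : Matrix ι ι F}

lemma tri_prod_iff : Tri (fun x => (b x, d x)) X ↔ Tri b X ∧ Tri d X := by
  simp only [Tri, Prod.mk_le_mk, not_and_or]
  exact ⟨fun h => ⟨fun x y hxy => h x y (Or.inl hxy), fun x y hxy => h x y (Or.inr hxy)⟩,
    fun h x y hxy => hxy.elim (h.1 x y) (h.2 x y)⟩

lemma stri_prod_of_left (hb : STri b X) (hd : Tri d X) : STri (fun x => (b x, d x)) X := by
  intro x y h
  by_contra hne
  exact h (Prod.mk_lt_mk.2 (Or.inl ⟨not_not.1 fun h' => hne (hb x y h'),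
    not_not.1 fun h' => hne (hd x y h')⟩))

lemma stri_prod_of_right (hb : Tri b X) (hd : STri d X) : STri (fun x => (b x, d x)) X := by
  intro x y h
  by_contra hne
  exact h (Prod.mk_lt_mk.2 (Or.inr ⟨not_not.1 fun h' => hne (hb x y h'),
    not_not.1 fun h' => hne (hd x y h')⟩))

lemma STri.exists_add_of_prod (hX : STri (fun x => (b x, d x)) X) :
    ∃ Y Z, X = Y + Z ∧ STri b Y ∧ Tri d Y ∧ Tri b Z ∧ STri d Z := by
  obtain ⟨hXb, hXd⟩ := tri_prod_iff.1 hX.tri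
  refine ⟨Matrix.of fun x y => if b x < b y then X x y else 0,
    Matrix.of fun x y => if b x < b y then 0 else X x y, ?_, ?_, ?_, ?_, ?_⟩
  · ext x y; simp only [Matrix.add_apply, of_apply]; split_ifs <;> simp
  · intro x y h; simp [h]
  · intro x y h; simp [hXd x y h]
  · intro x y h; simp [hXb x y h]
  · intro x y h
    simp only [of_apply]
    split_ifs with h'
    · rfl
    · refine hX x y fun hlt => ?_
      rcases Prod.mk_lt_mk.1 hlt with h1 | h1
      · exact h' h1.1
      · exact h h1.2

end ProductOrder

section Involution

variable {ι F α : Type*} [DecidableEq ι] [Field F]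

/-- The diagonal idempotent of the coordinates on which `β` takes the value `i`. -/
def blockIdem (F : Type*) [Field F] [DecidableEq α] (β : ι → α) (i : α) : Matrix ι ι F :=
  diagonal fun x => if β x = i then 1 else 0

lemma sum_blockIdem [DecidableEq α] [Fintype α] (β : ι → α) : ∑ k, blockIdem F β k = 1 := by
  ext x y
  rw [Matrix.sum_apply]
  by_cases hxy : x = y
  · subst hxy
    simp [blockIdem]
  · simp [blockIdem, hxy]

variable [Fintype ι]

lemma commute_blockIdem_iff [DecidableEq α] {β : ι → α} {X : Matrix ι ι F} :
    (∀ k, Commute X (blockIdem F β k)) ↔ ∀ x y, β x ≠ β y → X x y = 0 := by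
  simp only [commute_iff_eq, blockIdem, ← Matrix.ext_iff, mul_diagonal, diagonal_mul]
  constructor
  · intro h x y hxy
    have := h (β x) x y
    rw [if_neg (Ne.symm hxy), if_pos rfl] at this
    simpa using this.symm
  · intro h k x y
    by_cases hxy : β x = β y
    · rw [hxy, mul_comm]
    · rw [h x y hxy, mul_zero, zero_mul]

lemma blockIdem_mul [DecidableEq α] (β : ι → α) (i j : α) :
    blockIdem F β i * blockIdem F β j = if i = j then blockIdem F β i else 0 := by
  rw [blockIdem, blockIdem, diagonal_mul_diagonal]
  split_ifs with h
  · subst h; congr 1; ext x; simp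
  · ext x y
    by_cases hxy : x = y
    · subst hxy
      simp only [diagonal_apply_eq, Matrix.zero_apply]
      split_ifs with h1 h2
      · exact absurd (h1.symm.trans h2) h
      all_goals simp
    · simp [hxy]

lemma blockIdem_prod {α' : Type*} [DecidableEq α] [DecidableEq α'] (b : ι → α) (d : ι → α')
    (i : α) (j : α') :
    blockIdem F (fun x => (b x, d x)) (i, j) = blockIdem F b i * blockIdem F d j := by
  rw [blockIdem, blockIdem, blockIdem, diagonal_mul_diagonal]
  congr 1
  ext x
  simp only [Prod.mk.injEq, ite_and, mul_ite, mul_one, mul_zero]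
  split_ifs <;> rfl

/-- Complete systems of orthogonal idempotents congruent to the standard one modulo the strictly
triangular matrices are unipotently conjugate to the standard one. -/
lemma exists_conj_blockIdem [Finite F] [PartialOrder α] [Fintype α] [DecidableEq α] (β : ι → α)
    (E : α → Matrix ι ι F) (hE : ∀ k l, E k * E l = if k = l then E k else 0)
    (hES : ∀ k, STri β (E k - blockIdem F β k)) :
    ∃ u ∈ uniSubgroup F β, ∀ k, E k = u * blockIdem F β k * (↑u⁻¹ : Matrix ι ι F) := by
  have hs : STri β (∑ k, E k * blockIdem F β k - 1) := by
    rw [← sum_blockIdem (F := F) β, ← Finset.sum_sub_distrib]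
    refine stri_sum _ _ fun k _ => ?_
    have h : E k * blockIdem F β k - blockIdem F β k =
        (E k - blockIdem F β k) * blockIdem F β k := by
      rw [sub_mul, blockIdem_mul, if_pos rfl]
    rw [h]
    exact (hES k).mul_tri (tri_diagonal _)
  have hu := hs.isUnit_add (one_ne_zero (α := F))
  rw [one_smul, add_sub_cancel] at hu
  obtain ⟨u, hu⟩ := hu
  refine ⟨u, by rw [mem_uniSubgroup, hu]; exact hs, fun k => ?_⟩
  rw [Units.eq_mul_inv_iff_mul_eq, hu, Finset.mul_sum, Finset.sum_mul]
  refine Finset.sum_congr rfl fun l _ => ?_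
  rw [← mul_assoc, hE, mul_assoc, blockIdem_mul]
  by_cases h : k = l
  · subst h; simp
  · simp [h, Ne.symm h]

/-- An additive involution which is multiplicative or antimultiplicative and which interchanges the
triangular structures of `b` and `d` fixes a unipotent conjugate of the common block idempotents. -/
lemma exists_fixed_blockIdem [Finite F] (h2 : (2 : F) ≠ 0) [LinearOrder α] [Fintype α]
    (b d : ι → α) (s : α → α) (hs : ∀ i, s (s i) = i)
    (Θ : Matrix ι ι F →+ Matrix ι ι F) (hΘ : ∀ X, Θ (Θ X) = X)
    (hmul : (∀ X Y, Θ (X * Y) = Θ X * Θ Y) ∨ ∀ X Y, Θ (X * Y) = Θ Y * Θ X)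
    (hT : ∀ X, Tri b X ↔ Tri d (Θ X)) (hS : ∀ X, STri b X ↔ STri d (Θ X))
    (hI : ∀ i, STri d (Θ (blockIdem F b i) - blockIdem F d (s i))) :
    ∃ n ∈ uniSubgroup F (fun x => (b x, d x)), ∀ i j,
      Θ (n * blockIdem F (fun x => (b x, d x)) (s j, s i) * (↑n⁻¹ : Matrix ι ι F)) =
        n * blockIdem F (fun x => (b x, d x)) (i, j) * (↑n⁻¹ : Matrix ι ι F) := by
  set κ : ι → α × α := fun x => (b x, d x) with hκ
  have hT' : ∀ X, Tri d X ↔ Tri b (Θ X) := fun X => by rw [hT, hΘ]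
  have hS' : ∀ X, STri d X ↔ STri b (Θ X) := fun X => by rw [hS, hΘ]
  have hJ : ∀ X, STri κ X → STri κ (Θ X) := by
    intro X hX
    obtain ⟨Y, Z, rfl, hY1, hY2, hZ1, hZ2⟩ := hX.exists_add_of_prod
    rw [map_add]
    exact (stri_prod_of_right ((hT' Y).1 hY2) ((hS Y).1 hY1)).add
      (stri_prod_of_left ((hS' Z).1 hZ2) ((hT Z).1 hZ1))
  have hI' : ∀ j, STri b (Θ (blockIdem F d j) - blockIdem F b (s j)) := by
    intro j
    have := (hI (s j)).neg
    rw [hS', hs, map_neg, map_sub, hΘ, neg_sub] at this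
    exact this
  have hd : ∀ (β : ι → α) i, Tri κ (blockIdem F β i) := fun β i => tri_diagonal _
  have hΘT : ∀ X, Tri κ X → Tri κ (Θ X) := fun X hX => by
    obtain ⟨h1, h2⟩ := tri_prod_iff.1 hX
    exact tri_prod_iff.2 ⟨(hT' X).1 h2, (hT X).1 h1⟩
  have hIκ : ∀ i, STri κ (Θ (blockIdem F b i) - blockIdem F d (s i)) := fun i =>
    stri_prod_of_right (tri_prod_iff.1 ((hΘT _ (hd b i)).sub (hd d _))).1 (hI i)
  have hIκ' : ∀ j, STri κ (Θ (blockIdem F d j) - blockIdem F b (s j)) := fun j =>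
    stri_prod_of_left (hI' j) (tri_prod_iff.1 ((hΘT _ (hd d j)).sub (hd b _))).2
  have hprod : ∀ (A A' B B' : Matrix ι ι F), STri κ (A - A') → STri κ (B - B') →
      Tri κ A' → Tri κ B → STri κ (A * B - A' * B') := by
    intro A A' B B' hA hB hA' hB'
    have : A * B - A' * B' = (A - A') * B + A' * (B - B') := by noncomm_ring
    rw [this]
    exact (hA.mul_tri hB').add (hA'.mul_stri hB)
  have hbd : ∀ i j, blockIdem F κ (i, j) = blockIdem F b i * blockIdem F d j :=
    fun i j => blockIdem_prod b d i j
  have hbd' : ∀ i j, blockIdem F κ (i, j) = blockIdem F d j * blockIdem F b i := fun i j => by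
    rw [hbd, blockIdem, blockIdem, diagonal_mul_diagonal, diagonal_mul_diagonal]
    simp only [mul_comm]
  have he : ∀ i j, STri κ (Θ (blockIdem F κ (s j, s i)) - blockIdem F κ (i, j)) := by
    intro i j
    have h1 := hIκ (s j)
    have h2 := hIκ' (s i)
    rw [hs] at h1 h2
    rcases hmul with hm | hm
    · rw [hbd, hm, hbd']
      exact hprod _ _ _ _ h1 h2 (hd _ _) (hΘT _ (hd _ _))
    · rw [hbd, hm, hbd]
      exact hprod _ _ _ _ h2 h1 (hd _ _) (hΘT _ (hd _ _))
  let H := uniSubgroup F κ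
  let act : H → (α × α → Matrix ι ι F) → α × α → Matrix ι ι F :=
    fun n E k => (n : GL ι F) * E k * (↑(n : GL ι F)⁻¹ : Matrix ι ι F)
  have hact : ∀ (n : H) (E : α × α → Matrix ι ι F) k,
      act n E k = (n : GL ι F) * E k * (↑(n : GL ι F)⁻¹ : Matrix ι ι F) := fun _ _ _ => rfl
  obtain ⟨⟨n, hn⟩, hfix⟩ := exists_fixed_mem_orbit (odd_card_uniSubgroup h2 κ) act
    (fun E => funext fun k => by simp [hact])
    (fun n n' E => funext fun k => by
      simp only [hact, Subgroup.coe_mul, _root_.mul_inv_rev, Units.val_mul, mul_assoc])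
    (fun E k => Θ (E (s k.2, s k.1))) (fun E => by simp only [hs, hΘ]) (blockIdem F κ) (by
      intro n
      obtain ⟨u, hu, hconj⟩ := exists_conj_blockIdem κ
        (fun k => Θ (act n (blockIdem F κ) (s k.2, s k.1))) (by
          intro k l
          have hk : ∀ k l : α × α, act n (blockIdem F κ) k * act n (blockIdem F κ) l =
              if k = l then act n (blockIdem F κ) k else 0 := by
            intro k l
            have : act n (blockIdem F κ) k * act n (blockIdem F κ) l =
                (n : GL ι F) * (blockIdem F κ k * blockIdem F κ l) *
                  (↑(n : GL ι F)⁻¹ : Matrix ι ι F) := by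
              rw [hact, hact]
              simp only [mul_assoc, Units.inv_mul_cancel_left]
            rw [this, blockIdem_mul]
            split_ifs with h
            · rw [hact]
            · simp
          have hinj : ∀ k l : α × α, (s k.2, s k.1) = (s l.2, s l.1) ↔ k = l := by
            intro k l
            have hsi : Function.Injective s := (show Function.Involutive s from hs).injective
            rw [Prod.mk.injEq, hsi.eq_iff, hsi.eq_iff, Prod.ext_iff, and_comm]
          rcases hmul with hm | hm
          · rw [← hm, hk, apply_ite Θ, map_zero]
            simp only [hinj]
          · rw [← hm, hk, apply_ite Θ, map_zero]
            simp only [hinj]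
            by_cases h : k = l
            · subst h; rfl
            · rw [if_neg h, if_neg (Ne.symm h)])
        (by
          intro k
          have h1 : STri κ (act n (blockIdem F κ) (s k.2, s k.1) - blockIdem F κ (s k.2, s k.1)) := by
            have : act n (blockIdem F κ) (s k.2, s k.1) - blockIdem F κ (s k.2, s k.1) =
                (((n : GL ι F) - 1 : Matrix ι ι F) * blockIdem F κ (s k.2, s k.1) +
                  blockIdem F κ (s k.2, s k.1) * -((n : GL ι F) - 1 : Matrix ι ι F)) *
                    (↑(n : GL ι F)⁻¹ : Matrix ι ι F) := by
              have h3 : (((n : GL ι F) - 1 : Matrix ι ι F) * blockIdem F κ (s k.2, s k.1) +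
                  blockIdem F κ (s k.2, s k.1) * -((n : GL ι F) - 1 : Matrix ι ι F)) =
                  (n : GL ι F) * blockIdem F κ (s k.2, s k.1) -
                    blockIdem F κ (s k.2, s k.1) * (n : GL ι F) := by noncomm_ring
              rw [h3, sub_mul, Units.mul_inv_cancel_right, hact]
            rw [this]
            have hn1 := mem_uniSubgroup.1 n.2
            exact ((hn1.mul_tri (tri_diagonal _)).add
              (Tri.mul_stri (tri_diagonal _) hn1.neg)).mul_tri
                (mem_triSubgroup.1 (uniSubgroup_le_triSubgroup (inv_mem n.2)))
          have h3 := (hJ _ h1).add (he k.1 k.2)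
          rw [map_sub, sub_add_sub_cancel] at h3
          exact h3)
      exact ⟨⟨u, hu⟩, funext fun k => (hconj k).symm⟩)
  exact ⟨n, hn, fun i j => congrFun hfix (i, j)⟩

/-- An involution of the group carrying `uniSubgroup F d` into `uniSubgroup F b` has a fixed point
in each coset `U_b u` with `u ∈ uniSubgroup F d` triangular for `b`. -/
lemma exists_fixed_mul_inv_mem_uniSubgroup [Finite F] (h2 : (2 : F) ≠ 0) [PartialOrder α]
    (b d : ι → α) (θ : GL ι F →* GL ι F) (hθ : ∀ g, θ (θ g) = g)
    (hU : ∀ u ∈ uniSubgroup F d, θ u ∈ uniSubgroup F b)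
    {u : GL ι F} (hu : u ∈ uniSubgroup F d) (hub : u ∈ triSubgroup F b) :
    ∃ y, θ y = y ∧ y * u⁻¹ ∈ uniSubgroup F b := by
  let Z : Subgroup (GL ι F) := uniSubgroup F b ⊓ (uniSubgroup F b).comap θ
  have hZ : Odd (Nat.card Z) :=
    (odd_card_uniSubgroup h2 b).of_dvd_nat (Subgroup.card_dvd_of_le inf_le_left)
  have hθu := hU u hu
  have hc : u * θ u * u⁻¹ * (θ u)⁻¹ ∈ Z := by
    have h1 : u * θ u * u⁻¹ * (θ u)⁻¹ ∈ uniSubgroup F b :=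
      mul_mem (conj_mem_uniSubgroup hub hθu) (inv_mem hθu)
    refine ⟨h1, ?_⟩
    have h3 : θ (u * θ u * u⁻¹ * (θ u)⁻¹) = (u * θ u * u⁻¹ * (θ u)⁻¹)⁻¹ := by
      simp only [map_mul, map_inv, hθ]
      group
    change θ _ ∈ uniSubgroup F b
    rw [h3]
    exact inv_mem h1
  obtain ⟨⟨z, hz⟩, hfix⟩ := exists_fixed_mem_orbit hZ (fun z g => (z : GL ι F) * g)
    (fun g => one_mul g) (fun z z' g => mul_assoc _ _ g) θ hθ (θ u * u) (by
    rintro ⟨z, hz⟩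
    have hθz : θ z ∈ Z := ⟨hz.2, by change θ _ ∈ uniSubgroup F b; rw [hθ]; exact hz.1⟩
    refine ⟨⟨_, mul_mem hθz hc⟩, ?_⟩
    change θ z * (u * θ u * u⁻¹ * (θ u)⁻¹) * (θ u * u) = θ (z * (θ u * u))
    simp only [map_mul, hθ]
    group)
  refine ⟨z * (θ u * u), hfix, ?_⟩
  have : z * (θ u * u) * u⁻¹ = z * θ u := by group
  rw [this]
  exact mul_mem hz.1 hθu

lemma additive_involution_of_units (h2 : (2 : F) ≠ 0) (Θ : Matrix ι ι F →+ Matrix ι ι F)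
    (h : ∀ g : GL ι F, Θ (Θ g) = g) (X : Matrix ι ι F) : Θ (Θ X) = X := by
  have key : ∀ X : Matrix ι ι F, IsUnit X → Θ (Θ X) = X := by
    rintro _ ⟨g, rfl⟩
    exact h g
  rw [matrix_eq_sum_single X]
  simp only [map_sum]
  refine Finset.sum_congr rfl fun i _ => Finset.sum_congr rfl fun j _ => ?_
  generalize X i j = c
  by_cases hij : i = j
  · subst hij
    by_cases hc : c = 0
    · simp [hc]
    have hc2 : c / 2 ≠ 0 := div_ne_zero hc h2
    have h1 : single i i c = diagonal (fun _ => c / 2) -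
        diagonal (fun x => if x = i then - (c / 2) else c / 2) := by
      rw [diagonal_sub, ← diagonal_single]
      congr 1
      ext x
      by_cases hx : x = i
      · subst hx
        simp [← two_mul]
        field_simp
      · simp [hx]
    rw [h1]
    simp only [map_sub]
    rw [key, key]
    · rw [isUnit_diagonal, Pi.isUnit_iff]
      intro x
      split_ifs
      · exact (neg_ne_zero.2 hc2).isUnit
      · exact hc2.isUnit
    · rw [isUnit_diagonal, Pi.isUnit_iff]
      exact fun x => hc2.isUnit
  · have h1 : single i j c = transvection i j c - 1 := by simp [transvection]
    rw [h1]
    simp only [map_sub]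
    rw [key _ isUnit_one, key]
    rw [isUnit_iff_isUnit_det, det_transvection_of_ne _ _ hij]
    exact isUnit_one

end Involution

section Bruhat

variable {ι F α α' : Type*} [Fintype ι]

lemma exists_equiv_fin_monotone [LinearOrder α'] (β : ι → α') :
    ∃ γ : ι ≃ Fin (Fintype.card ι), ∀ x y, γ x ≤ γ y → β x ≤ β y := by
  let f : Fin (Fintype.card ι) → α' := β ∘ (Fintype.equivFin ι).symm
  refine ⟨(Fintype.equivFin ι).trans (Tuple.sort f).symm, fun x y h => ?_⟩
  simpa [f] using Tuple.monotone_sort f h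

variable [DecidableEq ι] [Field F]

/-- A weak form of the Bruhat decomposition: up to multiplication by a triangular matrix on the
left, the support of an invertible matrix is a row permutation of a triangular one. -/
lemma exists_tri_mul_support [Finite F] [LinearOrder α] [LinearOrder α'] (b : ι → α) (β : ι → α')
    (C : GL ι F) : ∃ p ∈ triSubgroup F b, ∃ e : Equiv.Perm ι, ∀ x y, ¬ β (e x) ≤ β y →
      (↑(p * C) : Matrix ι ι F) x y = 0 := by
  obtain ⟨γ, hγ⟩ := exists_equiv_fin_monotone β
  let piv : GL ι F → ι → ℕ := fun M x => sInf {k | ∃ y, (γ y : ℕ) = k ∧ M x y ≠ 0}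
  have hpiv : ∀ (M : GL ι F) x, ∃ y, M x y ≠ 0 ∧ (γ y : ℕ) = piv M x := by
    intro M x
    have hne : {k | ∃ y, (γ y : ℕ) = k ∧ M x y ≠ 0}.Nonempty := by
      by_contra hemp
      have h0 : ∀ y, M x y = 0 := fun y => by
        by_contra hy
        exact hemp ⟨_, y, rfl, hy⟩
      have h1 : ((M : Matrix ι ι F) * (↑M⁻¹ : Matrix ι ι F)) x x = 1 := by
        rw [Units.mul_inv, one_apply_eq]
      rw [mul_apply, Finset.sum_eq_zero fun y _ => by rw [h0, zero_mul]] at h1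
      exact zero_ne_one h1
    obtain ⟨y, hy1, hy2⟩ := Nat.sInf_mem hne
    exact ⟨y, hy2, hy1⟩
  have hle : ∀ (M : GL ι F) x y, M x y ≠ 0 → piv M x ≤ γ y := fun M x y h =>
    Nat.sInf_le ⟨y, rfl, h⟩
  obtain ⟨⟨p, hp⟩, hmax⟩ := Finite.exists_max
    fun p : triSubgroup F b => ∑ x, piv ((p : GL ι F) * C) x
  choose e he1 he2 using hpiv (p * C)
  have hne : ∀ x x', x ≠ x' → b x ≤ b x' → e x ≠ e x' := by
    intro x x' hxx hb hee
    have hM' : (p * C) x' (e x) ≠ 0 := hee ▸ he1 x'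
    let c := - ((p * C) x (e x) / (p * C) x' (e x))
    have hq : IsUnit (transvection x x' c) := by
      rw [isUnit_iff_isUnit_det, det_transvection_of_ne _ _ hxx]
      exact isUnit_one
    obtain ⟨q, hq⟩ := hq
    have hqt : q ∈ triSubgroup F b := by
      rw [mem_triSubgroup, hq]
      refine tri_one.add fun z w hzw => ?_
      rw [single_apply_of_ne]
      rintro ⟨rfl, rfl⟩
      exact hzw hb
    have hrow : ∀ z, (q * p * C) x z = (p * C) x z + c * (p * C) x' z := fun z => by
      rw [mul_assoc, Units.val_mul, hq, transvection_mul_apply_same]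
    have hrow' : ∀ y z, y ≠ x → (q * p * C) y z = (p * C) y z := fun y z hy => by
      rw [mul_assoc, Units.val_mul, hq, transvection_mul_apply_of_ne _ _ _ _ hy]
    have hlt : piv (p * C) x < piv (q * p * C) x := by
      obtain ⟨y, hy1, hy2⟩ := hpiv (q * p * C) x
      rw [← hy2]
      refine lt_of_le_of_ne ?_ fun heq => hy1 ?_
      · rw [hrow] at hy1
        by_cases h : (p * C) x y = 0
        · have h' : (p * C) x' y ≠ 0 := fun h' => hy1 (by rw [h, h', mul_zero, add_zero])
          rw [← he2, hee, he2]
          exact hle _ _ _ h'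
        · exact hle _ _ _ h
      · rw [← he2] at heq
        have hey : e x = y := γ.injective (Fin.ext heq)
        rw [← hey, hrow, neg_mul, div_mul_cancel₀ _ hM', add_neg_cancel]
    have hsum : ∑ y, piv (p * C) y < ∑ y, piv (q * p * C) y := by
      refine Finset.sum_lt_sum (fun y _ => ?_) ⟨x, Finset.mem_univ _, hlt⟩
      by_cases hy : y = x
      · rw [hy]; exact hlt.le
      · simp only [piv, hrow' y _ hy, le_refl]
    exact absurd (hmax ⟨q * p, mul_mem hqt hp⟩) (not_le.2 hsum)
  have hinj : Function.Injective e := by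
    intro x x' hee
    by_contra hxx
    rcases le_total (b x) (b x') with h | h
    · exact hne x x' hxx h hee
    · exact hne x' x (Ne.symm hxx) h hee.symm
  refine ⟨p, hp, Equiv.ofBijective e (Finite.injective_iff_bijective.1 hinj), fun x y h => ?_⟩
  by_contra h0
  refine h (hγ _ _ ?_)
  rw [Equiv.ofBijective_apply, Fin.le_def, he2]
  exact hle _ _ _ h0

variable (F) in
/-- The permutation matrix of `e` as an invertible matrix. -/
def permGL (e : Equiv.Perm ι) : GL ι F where
  val := e.toPEquiv.toMatrix
  inv := e.symm.toPEquiv.toMatrix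
  val_inv := by
    rw [PEquiv.toMatrix_toPEquiv_mul]
    ext x y
    simp [PEquiv.toMatrix_apply, one_apply]
  inv_val := by
    rw [PEquiv.toMatrix_toPEquiv_mul]
    ext x y
    simp [PEquiv.toMatrix_apply, one_apply]

lemma permGL_mul (e : Equiv.Perm ι) (Y : Matrix ι ι F) :
    (permGL F e : Matrix ι ι F) * Y = Y.submatrix e id :=
  PEquiv.toMatrix_toPEquiv_mul e Y

lemma permGL_conj (e : Equiv.Perm ι) (Y : Matrix ι ι F) :
    (permGL F e : Matrix ι ι F) * Y * (↑(permGL F e)⁻¹ : Matrix ι ι F) = Y.submatrix e e := by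
  rw [permGL_mul]
  exact PEquiv.mul_toMatrix_toPEquiv _ e.symm

lemma permGL_inv_mul (e : Equiv.Perm ι) (Y : Matrix ι ι F) :
    (↑(permGL F e)⁻¹ : Matrix ι ι F) * Y = Y.submatrix e.symm id :=
  PEquiv.toMatrix_toPEquiv_mul e.symm Y

lemma permGL_mul_conj (e : Equiv.Perm ι) (t : GL ι F) (Y : Matrix ι ι F) :
    (↑(permGL F e * t) : Matrix ι ι F) * Y * (↑(permGL F e * t)⁻¹ : Matrix ι ι F) =
      ((t : Matrix ι ι F) * Y * (↑t⁻¹ : Matrix ι ι F)).submatrix e e := by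
  rw [← permGL_conj, _root_.mul_inv_rev, Units.val_mul, Units.val_mul]
  simp only [mul_assoc]

lemma inv_conj_conj (t : GL ι F) (Y : Matrix ι ι F) :
    (↑t⁻¹ : Matrix ι ι F) * ((t : Matrix ι ι F) * Y * (↑t⁻¹ : Matrix ι ι F)) *
      (t : Matrix ι ι F) = Y := by
  simp only [mul_assoc, Units.inv_mul_cancel_left, Units.inv_mul, mul_one]

section Conjugation

variable [Finite F] [PartialOrder α] {β : ι → α} {e : Equiv.Perm ι} {C : GL ι F}

lemma exists_eq_permGL_mul (hC : ∀ x y, ¬ β (e x) ≤ β y → C x y = 0) :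
    ∃ t ∈ triSubgroup F β, C = permGL F e * t := by
  refine ⟨(permGL F e)⁻¹ * C, ?_, by rw [mul_inv_cancel_left]⟩
  intro x y h
  rw [Units.val_mul, permGL_inv_mul, submatrix_apply]
  exact hC _ _ (by simpa using h)

lemma tri_conj_iff (hC : ∀ x y, ¬ β (e x) ≤ β y → C x y = 0) (Y : Matrix ι ι F) :
    Tri β Y ↔ Tri (β ∘ e) ((C : Matrix ι ι F) * Y * (↑C⁻¹ : Matrix ι ι F)) := by
  obtain ⟨t, ht, rfl⟩ := exists_eq_permGL_mul hC
  have ht' := mem_triSubgroup.1 (inv_mem ht)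
  rw [permGL_mul_conj]
  constructor
  · exact fun hY x y h => ((mem_triSubgroup.1 ht).mul hY).mul ht' _ _ h
  · intro h
    have h1 : Tri β ((t : Matrix ι ι F) * Y * (↑t⁻¹ : Matrix ι ι F)) := fun x y hxy => by
      simpa using h (e.symm x) (e.symm y) (by simpa using hxy)
    rw [← inv_conj_conj t Y]
    exact (ht'.mul h1).mul ht

lemma stri_conj_iff (hC : ∀ x y, ¬ β (e x) ≤ β y → C x y = 0) (Y : Matrix ι ι F) :
    STri β Y ↔ STri (β ∘ e) ((C : Matrix ι ι F) * Y * (↑C⁻¹ : Matrix ι ι F)) := by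
  obtain ⟨t, ht, rfl⟩ := exists_eq_permGL_mul hC
  have ht' := mem_triSubgroup.1 (inv_mem ht)
  rw [permGL_mul_conj]
  constructor
  · exact fun hY x y h => ((mem_triSubgroup.1 ht).mul_stri hY).mul_tri ht' _ _ h
  · intro h
    have h1 : STri β ((t : Matrix ι ι F) * Y * (↑t⁻¹ : Matrix ι ι F)) := fun x y hxy => by
      simpa using h (e.symm x) (e.symm y) (by simpa using hxy)
    rw [← inv_conj_conj t Y]
    exact (ht'.mul_stri h1).mul_tri ht

lemma stri_conj_blockIdem_sub [DecidableEq α] (hC : ∀ x y, ¬ β (e x) ≤ β y → C x y = 0) (j : α) :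
    STri (β ∘ e) ((C : Matrix ι ι F) * blockIdem F β j * (↑C⁻¹ : Matrix ι ι F) -
      blockIdem F (β ∘ e) j) := by
  obtain ⟨t, ht, rfl⟩ := exists_eq_permGL_mul hC
  have h1 : blockIdem F (β ∘ e) j = (blockIdem F β j).submatrix e e := by
    rw [blockIdem, blockIdem, submatrix_diagonal_equiv]
    rfl
  have h2 : (t : Matrix ι ι F) * blockIdem F β j * (↑t⁻¹ : Matrix ι ι F) - blockIdem F β j =
      ((t : Matrix ι ι F) * blockIdem F β j - blockIdem F β j * (t : Matrix ι ι F)) *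
        (↑t⁻¹ : Matrix ι ι F) := by
    rw [sub_mul, Units.mul_inv_cancel_right]
  have h3 : STri β ((t : Matrix ι ι F) * blockIdem F β j - blockIdem F β j * (t : Matrix ι ι F)) := by
    intro x y hxy
    rw [Matrix.sub_apply, blockIdem, mul_diagonal, diagonal_mul]
    by_cases h : β x = β y
    · rw [h, mul_comm, sub_self]
    · rw [mem_triSubgroup.1 ht x y fun h' => hxy (lt_of_le_of_ne h' h), zero_mul, mul_zero,
        sub_self]
  rw [permGL_mul_conj, h1]
  intro x y hxy
  rw [Matrix.sub_apply, submatrix_apply, submatrix_apply, ← Matrix.sub_apply, h2]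
  exact h3.mul_tri (mem_triSubgroup.1 (inv_mem ht)) _ _ hxy

end Conjugation

end Bruhat

section StableLevi

variable {ι F α : Type*} [Fintype ι] [DecidableEq ι] [Field F]

lemma Commute.conj_units {R : Type*} [Monoid R] {a b : R} (h : Commute a b) (u : Rˣ) :
    Commute (u * a * ↑u⁻¹) (u * b * ↑u⁻¹) := by
  rw [commute_iff_eq]
  simp only [mul_assoc, Units.inv_mul_cancel_left]
  rw [← mul_assoc a, h.eq, mul_assoc]

/-- Every double coset has a representative for which the involution preserves the Levi subgroup
given by the common refinement of the two block structures, and lifts the elements of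
`uniSubgroup F d` to fixed points. The predicate `Q` is a normal form for `d` which can be achieved
by permutations preserving `b`. -/
lemma exists_stable_representative [Finite F] (h2 : (2 : F) ≠ 0) [LinearOrder α] [Fintype α]
    (b : ι → α) (s : α → α) (hs : ∀ i, s (s i) = i)
    (Q : (ι → α) → Prop)
    (hQ : ∀ h : ι → α, ∃ ρ : Equiv.Perm ι, (∀ x, b (ρ x) = b x) ∧ Q (h ∘ ρ))
    (ψ : Matrix ι ι F →+ Matrix ι ι F)
    (hψT : ∀ X, Tri b X ↔ Tri (s ∘ b) (ψ X)) (hψS : ∀ X, STri b X ↔ STri (s ∘ b) (ψ X))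
    (hψI : ∀ i, ψ (blockIdem F b i) = blockIdem F b i) (hψ1 : ψ 1 = 1)
    (σ : GL ι F →* GL ι F) (hσ : ∀ g, σ (σ g) = g) (B : GL ι F)
    (hcase : ((∀ X Y, ψ (X * Y) = ψ X * ψ Y) ∧
        ∀ g : GL ι F, (σ g : Matrix ι ι F) = B * ψ g * (↑B⁻¹ : Matrix ι ι F)) ∨
      ((∀ X Y, ψ (X * Y) = ψ Y * ψ X) ∧
        ∀ g : GL ι F, (σ g : Matrix ι ι F) =
          B * ψ (↑g⁻¹ : Matrix ι ι F) * (↑B⁻¹ : Matrix ι ι F)))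
    (g₀ : GL ι F) :
    ∃ p ∈ triSubgroup F b, ∃ d, Q d ∧ ∃ A, A = (p * g₀) * (σ (p * g₀))⁻¹ ∧
      (∀ g : GL ι F, (∀ x y, (b x, d x) ≠ (b y, d y) → g x y = 0) →
        ∀ x y, (b x, d x) ≠ (b y, d y) → (A * σ g * A⁻¹) x y = 0) ∧
      ∀ u ∈ uniSubgroup F d, u ∈ triSubgroup F b →
        ∃ y, A * σ y * A⁻¹ = y ∧ y * u⁻¹ ∈ uniSubgroup F b := by
  obtain ⟨p₁, hp₁, e₁, he₁⟩ := exists_tri_mul_support b (s ∘ b) (g₀ * (σ g₀)⁻¹ * B)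
  obtain ⟨ρ, hρb, hρQ⟩ := hQ ((s ∘ b) ∘ e₁)
  set e : Equiv.Perm ι := ρ.trans e₁ with he
  set d : ι → α := (s ∘ b) ∘ e with hd
  set p := permGL F ρ * p₁ with hp
  have hpb : p ∈ triSubgroup F b := by
    intro x y hxy
    rw [hp, Units.val_mul, permGL_mul, submatrix_apply]
    exact hp₁ _ _ (by rwa [hρb])
  set A := (p * g₀) * (σ (p * g₀))⁻¹ with hA
  have hC : ∀ x y, ¬ (s ∘ b) (e x) ≤ (s ∘ b) y → (A * B) x y = 0 := by
    have hψp : Tri (s ∘ b) (↑(B⁻¹ * (σ p)⁻¹ * B) : Matrix ι ι F) := by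
      rcases hcase with ⟨-, h⟩ | ⟨-, h⟩
      · have := h p⁻¹
        rw [map_inv] at this
        rw [Units.val_mul, Units.val_mul, this]
        simp only [mul_assoc, Units.inv_mul, mul_one, Units.inv_mul_cancel_left]
        exact (hψT _).1 (mem_triSubgroup.1 (inv_mem hpb))
      · have := h p⁻¹
        rw [map_inv, inv_inv] at this
        rw [Units.val_mul, Units.val_mul, this]
        simp only [mul_assoc, Units.inv_mul, mul_one, Units.inv_mul_cancel_left]
        exact (hψT _).1 hpb
    have hAB : A * B = permGL F ρ * ((p₁ * (g₀ * (σ g₀)⁻¹ * B)) * (B⁻¹ * (σ p)⁻¹ * B)) := by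
      rw [hA, map_mul, hp]
      group
    intro x y hxy
    rw [hAB, Units.val_mul, permGL_mul, submatrix_apply, Units.val_mul, mul_apply]
    refine Finset.sum_eq_zero fun z _ => ?_
    by_cases hz : (s ∘ b) (e x) ≤ (s ∘ b) z
    · change _ * (↑(B⁻¹ * (σ p)⁻¹ * B) : Matrix ι ι F) z y = 0
      rw [hψp z _ fun h => hxy (hz.trans h), mul_zero]
    · rw [he₁ _ _ hz, zero_mul]
  let Θ : Matrix ι ι F →+ Matrix ι ι F :=
    { toFun := fun X => (↑(A * B) : Matrix ι ι F) * ψ X * (↑(A * B)⁻¹ : Matrix ι ι F)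
      map_zero' := by simp
      map_add' := fun X Y => by rw [map_add, mul_add, add_mul] }
  have hΘdef : ∀ X, Θ X = (↑(A * B) : Matrix ι ι F) * ψ X * (↑(A * B)⁻¹ : Matrix ι ι F) :=
    fun _ => rfl
  have hΘ1 : Θ 1 = 1 := by rw [hΘdef, hψ1, mul_one, Units.mul_inv]
  let θ : GL ι F →* GL ι F := (MulAut.conj A).toMonoidHom.comp σ
  have hθdef : ∀ g, θ g = A * σ g * A⁻¹ := fun _ => rfl
  have hθθ : ∀ g, θ (θ g) = g := by
    intro g
    simp only [hθdef, map_mul, map_inv, hσ, hA]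
    group
  have hmul : (∀ X Y, Θ (X * Y) = Θ X * Θ Y) ∨ ∀ X Y, Θ (X * Y) = Θ Y * Θ X := by
    rcases hcase with ⟨h, -⟩ | ⟨h, -⟩
    · left; intro X Y
      simp only [hΘdef, h, mul_assoc, Units.inv_mul_cancel_left]
    · right; intro X Y
      simp only [hΘdef, h, mul_assoc, Units.inv_mul_cancel_left]
  have hΘθ : (∀ g : GL ι F, (θ g : Matrix ι ι F) = Θ g) ∨
      ∀ g : GL ι F, (θ g : Matrix ι ι F) = Θ (↑g⁻¹ : Matrix ι ι F) := by
    rcases hcase with ⟨-, h⟩ | ⟨-, h⟩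
    · left; intro g
      rw [hθdef, hΘdef, _root_.mul_inv_rev A B]
      simp only [Units.val_mul, h, mul_assoc]
    · right; intro g
      rw [hθdef, hΘdef, _root_.mul_inv_rev A B]
      simp only [Units.val_mul, h, mul_assoc]
  have hΘΘ : ∀ X, Θ (Θ X) = X := additive_involution_of_units h2 Θ fun g => by
    rcases hΘθ with h | h
    · rw [← h, ← h, hθθ]
    · have h1 := h g⁻¹
      rw [inv_inv] at h1
      rw [← h1, map_inv, ← h, hθθ]
  obtain ⟨n, hn, hfix⟩ := exists_fixed_blockIdem h2 b d s hs Θ hΘΘ hmul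
    (fun X => by rw [hψT, hΘdef]; exact tri_conj_iff hC _)
    (fun X => by rw [hψS, hΘdef]; exact stri_conj_iff hC _)
    (fun i => by
      have h3 : blockIdem F b i = blockIdem F (s ∘ b) (s i) := by
        rw [blockIdem, blockIdem]
        simp only [Function.comp_apply,
          (show Function.Involutive s from hs).injective.eq_iff]
      rw [hΘdef, hψI, h3]
      exact stri_conj_blockIdem_sub hC _)
  obtain ⟨hnb, hnd⟩ := tri_prod_iff.1 (mem_triSubgroup.1 (uniSubgroup_le_triSubgroup hn))
  let A' := n⁻¹ * A * σ n
  let θ' : GL ι F →* GL ι F := (MulAut.conj A').toMonoidHom.comp σ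
  have hθ'def : ∀ g, θ' g = A' * σ g * A'⁻¹ := fun _ => rfl
  have hθ' : ∀ g, θ' g = n⁻¹ * θ (n * g * n⁻¹) * n := by
    intro g
    simp only [hθ'def, A', hθdef, map_mul, map_inv]
    group
  refine ⟨n⁻¹ * p, mul_mem (inv_mem hnb) hpb, d, hρQ, A', ?_, ?_, ?_⟩
  · simp only [A', hA, map_mul, map_inv]
    group
  · intro g hg
    rw [← commute_blockIdem_iff (β := fun x => (b x, d x))] at hg ⊢
    have key : ∃ Z : Matrix ι ι F, (∀ k, Commute Z (blockIdem F (fun x => (b x, d x)) k)) ∧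
        (θ (n * g * n⁻¹) : Matrix ι ι F) = Θ (n * Z * (↑n⁻¹ : Matrix ι ι F)) := by
      rcases hΘθ with h | h
      · exact ⟨g, hg, by rw [h]; simp only [Units.val_mul]⟩
      · refine ⟨↑g⁻¹, fun k => (hg k).units_inv_left, ?_⟩
        rw [h]
        simp only [_root_.mul_inv_rev, inv_inv, Units.val_mul, mul_assoc]
    obtain ⟨Z, hZ, hZθ⟩ := key
    rintro ⟨i, j⟩
    have h1 := (hZ (s j, s i)).conj_units n
    have h3 : Commute (Θ (n * Z * (↑n⁻¹ : Matrix ι ι F)))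
        (n * blockIdem F (fun x => (b x, d x)) (i, j) * (↑n⁻¹ : Matrix ι ι F)) := by
      rw [← hfix]
      rcases hmul with hm | hm
      · rw [commute_iff_eq, ← hm, ← hm, h1.eq]
      · rw [commute_iff_eq, ← hm, ← hm, h1.eq]
    rw [← hZθ] at h3
    have h4 := h3.conj_units n⁻¹
    rw [inv_inv, inv_conj_conj] at h4
    rw [← hθ'def, hθ', Units.val_mul, Units.val_mul]
    exact h4
  · refine fun u hu hub => exists_fixed_mul_inv_mem_uniSubgroup h2 b d θ'
      (fun g => ?_) (fun u hu => ?_) hu hub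
    · simp only [hθ', map_mul, map_inv, hθθ]
      group
    · have hθU : ∀ v ∈ uniSubgroup F d, θ v ∈ uniSubgroup F b := by
        have hΘU : ∀ v ∈ uniSubgroup F d, STri b (Θ v - 1) := fun v hv => by
          have h3 := (hψS (Θ (v - 1))).trans ((stri_conj_iff hC _))
          rw [← hΘdef, hΘΘ, map_sub, hΘ1] at h3
          exact h3.2 hv
        intro v hv
        rw [mem_uniSubgroup]
        rcases hΘθ with h | h
        · rw [h]; exact hΘU v hv
        · rw [h]; exact hΘU _ (inv_mem hv)
      rw [hθ']
      have h3 := conj_mem_uniSubgroup (inv_mem (mem_triSubgroup.2 hnb))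
        (hθU _ (conj_mem_uniSubgroup (mem_triSubgroup.2 hnd) hu))
      rwa [inv_inv] at h3

end StableLevi

section Blocks

lemma blockDiag'_mul_of_tri {o F : Type*} {k : o → Type*} [Fintype o] [PartialOrder o]
    [∀ i, Fintype (k i)] [Field F] {X Y : Matrix ((i : o) × k i) ((i : o) × k i) F}
    (hX : Tri Sigma.fst X) (hY : Tri Sigma.fst Y) (i : o) :
    blockDiag' (X * Y) i = blockDiag' X i * blockDiag' Y i := by
  ext a b
  rw [blockDiag'_apply, mul_apply, mul_apply, Fintype.sum_sigma,
    Fintype.sum_eq_single i fun j hj => ?_]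
  · rfl
  · refine Finset.sum_eq_zero fun c _ => ?_
    by_cases h : i ≤ j
    · rw [hY ⟨j, c⟩ ⟨i, b⟩ fun h' => hj (le_antisymm h' h), mul_zero]
    · rw [hX ⟨i, a⟩ ⟨j, c⟩ h, zero_mul]

lemma exists_diagonal_blocks {o F : Type*} {k : o → Type*} [Fintype o] [DecidableEq o]
    [PartialOrder o] [∀ i, Fintype (k i)] [∀ i, DecidableEq (k i)] [Field F] [Finite F]
    {p : GL ((i : o) × k i) F} (hp : p ∈ triSubgroup F Sigma.fst) :
    ∃ l : (i : o) → GL (k i) F, ∀ i a b, l i a b = p ⟨i, a⟩ ⟨i, b⟩ := by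
  have hp' := mem_triSubgroup.1 (inv_mem hp)
  refine ⟨fun i => ⟨blockDiag' (p : Matrix _ _ F) i, blockDiag' (↑p⁻¹ : Matrix _ _ F) i,
    ?_, ?_⟩, fun i a b => rfl⟩
  · rw [← blockDiag'_mul_of_tri hp hp', Units.mul_inv, blockDiag'_one, Pi.one_apply]
  · rw [← blockDiag'_mul_of_tri hp' hp, Units.inv_mul, blockDiag'_one, Pi.one_apply]

lemma exists_surjective_fin_le_iff {κ α : Type*} [Fintype κ] [LinearOrder α] (h : κ → α) :
    ∃ (t : ℕ) (c : κ → Fin t), Function.Surjective c ∧ ∀ a b, c a ≤ c b ↔ h a ≤ h b := by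
  let S := Finset.univ.image h
  let φ := S.orderIsoOfFin rfl
  refine ⟨S.card, fun a => φ.symm ⟨h a, Finset.mem_image_of_mem h (Finset.mem_univ a)⟩,
    fun z => ?_, fun a b => ?_⟩
  · obtain ⟨a, -, ha⟩ := Finset.mem_image.1 (φ z).2
    refine ⟨a, ?_⟩
    rw [OrderIso.symm_apply_eq]
    exact Subtype.ext ha
  · rw [φ.symm.le_iff_le, Subtype.mk_le_mk]

lemma exists_perm_sigma_monotone {m : ℕ} {n : Fin m → ℕ} {α : Type*} [LinearOrder α]
    (h : (i : Fin m) × Fin (n i) → α) :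
    ∃ ρ : Equiv.Perm ((i : Fin m) × Fin (n i)), (∀ x, (ρ x).1 = x.1) ∧
      ∀ i, Monotone fun a => (h ∘ ρ) ⟨i, a⟩ :=
  ⟨Equiv.sigmaCongrRight fun i => Tuple.sort fun a => h ⟨i, a⟩, fun _ => rfl,
    fun i => Tuple.monotone_sort fun a => h ⟨i, a⟩⟩

lemma two_ne_zero_of_odd_card {F : Type*} [Field F] [Fintype F] (h : Odd (Fintype.card F)) :
    (2 : F) ≠ 0 := by
  intro h2
  have h3 : ringChar F = 2 := by
    have := ringChar.dvd (R := F) (x := 2) (by exact_mod_cast h2)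
    exact ((Nat.dvd_prime Nat.prime_two).1 this).resolve_left fun h1 =>
      one_ne_zero (α := F) (by exact_mod_cast h1 ▸ ringChar.Nat.cast_ringChar (R := F))
  have := FiniteField.even_card_of_char_two h3
  rw [Nat.odd_iff] at h
  omega

/-- Variant of `exists_stable_representative` for block compositions, in which the additive
anti-involution has been made explicit. -/
lemma exists_stable_representative_sigma {m : ℕ} {n : Fin m → ℕ} {F : Type*} [Field F] [Finite F]
    (h2 : (2 : F) ≠ 0) (τ : F ≃+* F) (σ : GL ((i : Fin m) × Fin (n i)) F →*
      GL ((i : Fin m) × Fin (n i)) F) (hσ : ∀ g, σ (σ g) = g)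
    (B : GL ((i : Fin m) × Fin (n i)) F)
    (hform : (∀ g, (σ g).val = B.val * g.val.map τ * B⁻¹.val) ∨
      ∀ g, (σ g).val = B.val * g⁻¹.valᵀ.map τ * B⁻¹.val)
    (g₀ : GL ((i : Fin m) × Fin (n i)) F) :
    ∃ p ∈ triSubgroup F (Sigma.fst : (i : Fin m) × Fin (n i) → Fin m),
      ∃ d : (i : Fin m) × Fin (n i) → Fin m, (∀ i, Monotone fun a => d ⟨i, a⟩) ∧
      ∃ A, A = (p * g₀) * (σ (p * g₀))⁻¹ ∧
      (∀ g : GL ((i : Fin m) × Fin (n i)) F,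
        (∀ x y, (x.1, d x) ≠ (y.1, d y) → g x y = 0) →
        ∀ x y, (x.1, d x) ≠ (y.1, d y) → (A * σ g * A⁻¹) x y = 0) ∧
      ∀ u ∈ uniSubgroup F d,
        u ∈ triSubgroup F (Sigma.fst : (i : Fin m) × Fin (n i) → Fin m) →
        ∃ y, A * σ y * A⁻¹ = y ∧
          y * u⁻¹ ∈ uniSubgroup F (Sigma.fst : (i : Fin m) × Fin (n i) → Fin m) := by
  have hidem : ∀ i, (blockIdem F (Sigma.fst : (i : Fin m) × Fin (n i) → Fin m) i).map τ =
      blockIdem F Sigma.fst i := fun i => by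
    rw [blockIdem, diagonal_map (map_zero τ)]
    refine congrArg diagonal (funext fun x => ?_)
    rw [apply_ite τ, map_one, map_zero]
  rcases hform with h | h
  · let ψ : Matrix ((i : Fin m) × Fin (n i)) ((i : Fin m) × Fin (n i)) F →+
        Matrix ((i : Fin m) × Fin (n i)) ((i : Fin m) × Fin (n i)) F :=
      { toFun := fun X => X.map τ
        map_zero' := Matrix.map_zero τ (map_zero τ)
        map_add' := fun X Y => Matrix.map_add τ (map_add τ) X Y }
    have hψ : ∀ X x y, ψ X x y = 0 ↔ X x y = 0 := fun X x y => map_eq_zero_iff τ τ.injective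
    refine exists_stable_representative h2 Sigma.fst id (fun _ => rfl) _
      exists_perm_sigma_monotone ψ (fun X => ?_) (fun X => ?_) hidem
      (Matrix.map_one τ (map_zero τ) (map_one τ)) σ hσ B
      (Or.inl ⟨fun X Y => Matrix.map_mul, h⟩) g₀
    · simp only [Tri, hψ, Function.comp_apply, id]
    · simp only [STri, hψ, Function.comp_apply, id]
  · let ψ : Matrix ((i : Fin m) × Fin (n i)) ((i : Fin m) × Fin (n i)) F →+
        Matrix ((i : Fin m) × Fin (n i)) ((i : Fin m) × Fin (n i)) F :=
      { toFun := fun X => Xᵀ.map τ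
        map_zero' := by rw [transpose_zero, Matrix.map_zero τ (map_zero τ)]
        map_add' := fun X Y => by rw [transpose_add, Matrix.map_add τ (map_add τ)] }
    have hψ : ∀ X x y, ψ X x y = 0 ↔ X y x = 0 := fun X x y => map_eq_zero_iff τ τ.injective
    refine exists_stable_representative h2 Sigma.fst Fin.rev Fin.rev_rev _
      exists_perm_sigma_monotone ψ (fun X => ?_) (fun X => ?_) (fun i => ?_)
      ?_ σ hσ B (Or.inr ⟨fun X Y => ?_, h⟩) g₀
    · simp only [Tri, hψ, Function.comp_apply, Fin.rev_le_rev]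
      exact forall_comm
    · simp only [STri, hψ, Function.comp_apply, Fin.rev_lt_rev]
      exact forall_comm
    · have ht : (blockIdem F (Sigma.fst : (i : Fin m) × Fin (n i) → Fin m) i)ᵀ =
          blockIdem F Sigma.fst i := diagonal_transpose _
      change (blockIdem F Sigma.fst i)ᵀ.map τ = _
      rw [ht, hidem]
    · change (1 : Matrix _ _ F)ᵀ.map τ = 1
      rw [transpose_one, Matrix.map_one τ (map_zero τ) (map_one τ)]
    · change (X * Y)ᵀ.map τ = Yᵀ.map τ * Xᵀ.map τ
      rw [transpose_mul, Matrix.map_mul]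

end Blocks

/-- Let `q` be an odd prime power, `F = 𝔽_q` or `𝔽_{q²}`, and `σ` an
involutive automorphism of `G = GL_N(F)` of the form `X ↦ B·τ(X)·B⁻¹` or
`X ↦ B·τ((X⁻¹)ᵀ)·B⁻¹` (with `τ` an involutive field automorphism applied entrywise),
with fixed points `H`.  Let `(n 0, …, n (m-1))` be a composition of `N`, `L` the
corresponding block diagonal Levi subgroup (`≅ Π i, GL_{n i}(F)`), and `π` a complex
representation of `L`.  If the parabolic induction of `π` to `G` (realized by its
standard function model of functions `f : G → V` with `f (p·g) = π(dblocks p) (f g)`,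
with `G` acting by right translation) has a nonzero `H`-fixed vector `f`, then there
exist a refinement of the composition (given by monotone surjections
`c i : Fin (n i) → Fin (t i)`, refining block `i` into blocks given by the fibres),
with associated Levi `L' ⊆ L` and group `U' = L ∩ U(refinement)`, and `A ∈ G` such
that `θ(X) = A·σ(X)·A⁻¹` is an involution preserving `L'`, and the Jacquet restriction
`π^{U'}` (the space of `U'`-fixed vectors) contains a nonzero vector fixed by every
element of `L'` fixed by `θ`. -/
theorem stmt10 (q : ℕ) (hq : Odd q) (hq' : IsPrimePow q)
    (F : Type) [Field F] [Fintype F]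
    (hF : Fintype.card F = q ∨ Fintype.card F = q ^ 2)
    (τ : F ≃+* F) (hτinvol : ∀ x, τ (τ x) = x)
    (m : ℕ) (n : Fin m → ℕ) (hn : ∀ i, 1 ≤ n i)
    (B : GL ((i : Fin m) × Fin (n i)) F)
    (σ : GL ((i : Fin m) × Fin (n i)) F → GL ((i : Fin m) × Fin (n i)) F)
    (hform :
      (∀ g : GL ((i : Fin m) × Fin (n i)) F,
        (σ g : Matrix ((i : Fin m) × Fin (n i)) ((i : Fin m) × Fin (n i)) F) =
          (B : Matrix ((i : Fin m) × Fin (n i)) ((i : Fin m) × Fin (n i)) F) *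
            ((g : Matrix ((i : Fin m) × Fin (n i)) ((i : Fin m) × Fin (n i)) F).map τ) *
            ((B⁻¹ : GL ((i : Fin m) × Fin (n i)) F) :
              Matrix ((i : Fin m) × Fin (n i)) ((i : Fin m) × Fin (n i)) F)) ∨
      (∀ g : GL ((i : Fin m) × Fin (n i)) F,
        (σ g : Matrix ((i : Fin m) × Fin (n i)) ((i : Fin m) × Fin (n i)) F) =
          (B : Matrix ((i : Fin m) × Fin (n i)) ((i : Fin m) × Fin (n i)) F) *
            ((((g⁻¹ : GL ((i : Fin m) × Fin (n i)) F) :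
              Matrix ((i : Fin m) × Fin (n i)) ((i : Fin m) × Fin (n i)) F)ᵀ).map τ) *
            ((B⁻¹ : GL ((i : Fin m) × Fin (n i)) F) :
              Matrix ((i : Fin m) × Fin (n i)) ((i : Fin m) × Fin (n i)) F)))
    (hmul : ∀ a b, σ (a * b) = σ a * σ b)
    (hinvol : ∀ g, σ (σ g) = g)
    (V : Type) [AddCommGroup V] [Module ℂ V] [FiniteDimensional ℂ V]
    (π : Representation ℂ ((i : Fin m) → GL (Fin (n i)) F) V)
    (f : GL ((i : Fin m) × Fin (n i)) F → V)
    (hf_mem : ∀ p : GL ((i : Fin m) × Fin (n i)) F,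
      IsParabC (p : Matrix ((i : Fin m) × Fin (n i)) ((i : Fin m) × Fin (n i)) F) →
      ∀ l : (i : Fin m) → GL (Fin (n i)) F,
        (∀ (i : Fin m) (a b : Fin (n i)), (l i : Matrix (Fin (n i)) (Fin (n i)) F) a b =
          (p : Matrix ((i : Fin m) × Fin (n i)) ((i : Fin m) × Fin (n i)) F) ⟨i, a⟩ ⟨i, b⟩) →
        ∀ g, f (p * g) = π l (f g))
    (hf_ne : f ≠ 0)
    (hf_fix : ∀ h, σ h = h → ∀ x, f (x * h) = f x) :
    ∃ (t : Fin m → ℕ) (c : (i : Fin m) → Fin (n i) → Fin (t i)),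
      (∀ i, Monotone (c i)) ∧ (∀ i, Function.Surjective (c i)) ∧
      ∃ A : GL ((i : Fin m) × Fin (n i)) F,
        (∀ g, A * σ (A * σ g * A⁻¹) * A⁻¹ = g) ∧
        (∀ g : GL ((i : Fin m) × Fin (n i)) F,
          (IsLeviC (g : Matrix ((i : Fin m) × Fin (n i)) ((i : Fin m) × Fin (n i)) F) ∧
            ∀ (i : Fin m) (a b : Fin (n i)), c i a ≠ c i b →
              (g : Matrix ((i : Fin m) × Fin (n i)) ((i : Fin m) × Fin (n i)) F) ⟨i, a⟩ ⟨i, b⟩ = 0) ↔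
          (IsLeviC ((A * σ g * A⁻¹ : GL ((i : Fin m) × Fin (n i)) F) :
              Matrix ((i : Fin m) × Fin (n i)) ((i : Fin m) × Fin (n i)) F) ∧
            ∀ (i : Fin m) (a b : Fin (n i)), c i a ≠ c i b →
              ((A * σ g * A⁻¹ : GL ((i : Fin m) × Fin (n i)) F) :
                Matrix ((i : Fin m) × Fin (n i)) ((i : Fin m) × Fin (n i)) F) ⟨i, a⟩ ⟨i, b⟩ = 0)) ∧
        ∃ v : V, v ≠ 0 ∧
          (∀ u : (i : Fin m) → GL (Fin (n i)) F,
            (∀ i, IsBlockUnitriWrt (c i) (u i : Matrix (Fin (n i)) (Fin (n i)) F)) →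
            π u v = v) ∧
          (∀ (l : (i : Fin m) → GL (Fin (n i)) F)
              (p : GL ((i : Fin m) × Fin (n i)) F),
            IsLeviC (p : Matrix ((i : Fin m) × Fin (n i)) ((i : Fin m) × Fin (n i)) F) →
            (∀ (i : Fin m) (a b : Fin (n i)), (l i : Matrix (Fin (n i)) (Fin (n i)) F) a b =
              (p : Matrix ((i : Fin m) × Fin (n i)) ((i : Fin m) × Fin (n i)) F) ⟨i, a⟩ ⟨i, b⟩) →
            (∀ i, IsBlockDiagWrt (c i) (l i : Matrix (Fin (n i)) (Fin (n i)) F)) →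
            A * σ p * A⁻¹ = p →
            π l v = v) := by
  have h2 : (2 : F) ≠ 0 := two_ne_zero_of_odd_card <| by
    rcases hF with h | h
    · rwa [h]
    · rw [h]; exact hq.pow
  let σ' : GL ((i : Fin m) × Fin (n i)) F →* GL ((i : Fin m) × Fin (n i)) F := MonoidHom.mk' σ hmul
  have hσ' : ∀ g, σ' g = σ g := fun _ => rfl
  obtain ⟨g₀, hg₀⟩ := Function.ne_iff.1 hf_ne
  obtain ⟨p, hp, d, hd, A, hA, hlevi, huni⟩ :=
    exists_stable_representative_sigma h2 τ σ' hinvol B hform g₀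
  have hθθ : ∀ g, A * σ (A * σ g * A⁻¹) * A⁻¹ = g := by
    intro g
    simp only [← hσ', hA, map_mul, map_inv]
    simp only [hσ', hinvol]
    group
  have hparab : ∀ g : GL ((i : Fin m) × Fin (n i)) F,
      g ∈ triSubgroup F (Sigma.fst : (i : Fin m) × Fin (n i) → Fin m) ↔ IsParabC g.val :=
    fun g => forall₂_congr fun x y => by rw [not_le]
  choose t c hc hcd using fun i => exists_surjective_fin_le_iff fun a => d ⟨i, a⟩
  have hcd' : ∀ i a b, c i a ≠ c i b ↔ d ⟨i, a⟩ ≠ d ⟨i, b⟩ := fun i a b => by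
    rw [Ne, Ne, le_antisymm_iff, hcd, hcd, ← le_antisymm_iff]
  have hpattern : ∀ g : GL ((i : Fin m) × Fin (n i)) F,
      (IsLeviC g.val ∧ ∀ i a b, c i a ≠ c i b → g.val ⟨i, a⟩ ⟨i, b⟩ = 0) ↔
        ∀ x y, (x.1, d x) ≠ (y.1, d y) → g.val x y = 0 := by
    intro g
    constructor
    · rintro ⟨h1, h3⟩ ⟨i, a⟩ ⟨j, b⟩ hxy
      by_cases hij : i = j
      · subst hij
        exact h3 i a b ((hcd' i a b).2 fun h => hxy (Prod.ext rfl h))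
      · exact h1 _ _ hij
    · refine fun h => ⟨fun x y hxy => h x y fun h' => hxy (Prod.ext_iff.1 h').1,
        fun i a b hab => h _ _ fun h' => (hcd' i a b).1 hab (Prod.ext_iff.1 h').2⟩
  have hfixed : ∀ y : GL ((i : Fin m) × Fin (n i)) F, A * σ y * A⁻¹ = y → IsParabC y.val →
      ∀ l : (i : Fin m) → GL (Fin (n i)) F,
        (∀ i a b, (l i).val a b = y.val ⟨i, a⟩ ⟨i, b⟩) → π l (f (p * g₀)) = f (p * g₀) := by
    intro y hy hyp l hl
    rw [← hf_mem y hyp l hl]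
    have h3 : σ ((p * g₀)⁻¹ * y * (p * g₀)) = (p * g₀)⁻¹ * y * (p * g₀) := by
      rw [← hσ'] at hy ⊢
      nth_rewrite 2 [← hy]
      rw [hA, map_mul, map_mul, map_inv]
      group
    rw [← hf_fix _ h3 (p * g₀)]
    congr 1
    group
  refine ⟨t, c, fun i a b hab => (hcd i a b).2 (hd i hab), hc, A, hθθ, fun g => ?_,
    f (p * g₀), fun h0 => hg₀ ?_, fun u hu => ?_, fun l y hy hl _ hyfix => ?_⟩
  · rw [hpattern, hpattern]
    refine ⟨hlevi g, fun h => ?_⟩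
    have h3 := hlevi _ h
    rwa [hσ', hθθ] at h3
  · obtain ⟨l, hl⟩ := exists_diagonal_blocks (inv_mem hp)
    have h3 := hf_mem p⁻¹ ((hparab _).1 (inv_mem hp)) l hl (p * g₀)
    rwa [h0, map_zero, inv_mul_cancel_left] at h3
  · let w : GL ((i : Fin m) × Fin (n i)) F :=
      Units.map (blockDiagonal'RingHom (fun i => Fin (n i)) F).toMonoidHom (MulEquiv.piUnits.symm u)
    have hw : w.val = blockDiagonal' fun i => (u i).val := rfl
    have hwp : w ∈ triSubgroup F (Sigma.fst : (i : Fin m) × Fin (n i) → Fin m) := by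
      rintro ⟨i, a⟩ ⟨j, b⟩ h
      rw [hw, blockDiagonal'_apply_ne _ _ _ fun h' => h h'.le]
    have hwu : w ∈ uniSubgroup F d := by
      rintro ⟨i, a⟩ ⟨j, b⟩ h
      rw [Matrix.sub_apply, hw]
      by_cases hij : i = j
      · subst hij
        rw [blockDiagonal'_apply_eq, hu i a b ((hcd i b a).2 (not_lt.1 h)), one_apply]
        simp
      · rw [blockDiagonal'_apply_ne _ _ _ hij, one_apply_ne fun h' => hij (Sigma.ext_iff.1 h').1,
          sub_zero]
    obtain ⟨y, hy, hyw⟩ := huni w hwu hwp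
    have hyp : y ∈ triSubgroup F (Sigma.fst : (i : Fin m) × Fin (n i) → Fin m) := by
      have := mul_mem (uniSubgroup_le_triSubgroup hyw) hwp
      rwa [inv_mul_cancel_right] at this
    refine hfixed y hy ((hparab y).1 hyp) u fun i a b => ?_
    have h3 : STri Sigma.fst (y.val - w.val) := by
      have := STri.mul_tri hyw (mem_triSubgroup.1 hwp)
      rwa [sub_mul, ← Units.val_mul, inv_mul_cancel_right, one_mul] at this
    have h4 := h3 ⟨i, a⟩ ⟨i, b⟩ (lt_irrefl _)
    rw [Matrix.sub_apply, sub_eq_zero, hw, blockDiagonal'_apply_eq] at h4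
    exact h4.symm
  · exact hfixed y hyfix (fun x z h => hy x z h.ne') l hl
end

section
/- Let q be a prime power, r, k ≥ 1, and ρ an irreducible cuspidal complex representation of GL_r(𝔽_q). Let ψ be a nondegenerate character of the upper unitriangular group U ⊆ GL_{rk}(𝔽_q). Then the space of ψ-Whittaker functionals on the parabolic induction of ρ^{⊗k} to GL_{rk}(𝔽_q) is exactly one-dimensional. Consequently, exactly one irreducible constituent of this parabolic induction admits a nonzero ψ-Whittaker functional. -/
open Matrix

/-- A representation is irreducible if the space is nonzero and the only invariant
subspaces are `⊥` and `⊤`. -/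
def IsIrred {G V : Type*} [Group G] [AddCommGroup V] [Module ℂ V]
    (ρ : Representation ℂ G V) : Prop :=
  (∃ v : V, v ≠ 0) ∧
    ∀ W : Submodule ℂ V, (∀ (g : G), ∀ v ∈ W, ρ g v ∈ W) → W = ⊥ ∨ W = ⊤

/-- `M` lies in the block upper unitriangular group associated to the composition
encoded by the monotone surjection `b : Fin n → Fin m`. -/
def IsBlockUnitri {n m : ℕ} {F : Type*} [Field F] (b : Fin n → Fin m)
    (M : Matrix (Fin n) (Fin n) F) : Prop :=
  ∀ i j : Fin n, b j ≤ b i → M i j = if i = j then 1 else 0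

/-- A representation `ρ` of `GL_n(F)` is cuspidal if for every composition of `n` with
at least two parts, the subspace of vectors fixed by the corresponding block
unitriangular group is zero. -/
def IsCuspidal {n : ℕ} {F : Type*} [Field F] [Fintype F] {V : Type*}
    [AddCommGroup V] [Module ℂ V] (ρ : Representation ℂ (GL (Fin n) F) V) : Prop :=
  ∀ m : ℕ, 2 ≤ m → ∀ b : Fin n → Fin m, Monotone b → Function.Surjective b →
    ∀ v : V,
      (∀ u : GL (Fin n) F, IsBlockUnitri b (u : Matrix (Fin n) (Fin n) F) → ρ u v = v) →
      v = 0

/-- `M` is upper unitriangular: 1's on the diagonal and 0's below it. -/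
def IsUniTri {n : ℕ} {F : Type*} [Field F] (M : Matrix (Fin n) (Fin n) F) : Prop :=
  ∀ i j : Fin n, j ≤ i → M i j = if i = j then 1 else 0

/-- The position of the `a`-th entry of the `i`-th block, for `k` blocks of size `r`. -/
def emb {k r : ℕ} (i : Fin k) (a : Fin r) : Fin (k * r) :=
  ⟨(i : ℕ) * r + (a : ℕ), by
    have hi : (i : ℕ) + 1 ≤ k := i.2
    have ha : (a : ℕ) < r := a.2
    calc (i : ℕ) * r + (a : ℕ) < ((i : ℕ) + 1) * r := by nlinarith
      _ ≤ k * r := Nat.mul_le_mul_right r hi⟩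

/-- `M` is block upper triangular for `k` diagonal blocks of size `r`. -/
def IsParab {k r : ℕ} {F : Type*} [Field F] (M : Matrix (Fin (k * r)) (Fin (k * r)) F) :
    Prop :=
  ∀ (i j : Fin k) (a b : Fin r), j < i → M (emb i a) (emb j b) = 0

/-- The standard function model of the parabolic induction of `ρ^{⊗k}` from the block
upper triangular parabolic (with `k` blocks of size `r`) to `GL_{rk}(F)`: functions
`f : GL_{rk}(F) → V^{⊗k}` satisfying `f (p·g) = (⊗ᵢ ρ(dᵢ)) (f g)` whenever `p` is block
upper triangular with diagonal blocks `dᵢ`.  The group acts by right translation. -/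
noncomputable def IndSpace (F : Type) [Field F] [Fintype F] (r k : ℕ)
    (V : Type) [AddCommGroup V] [Module ℂ V]
    (ρ : Representation ℂ (GL (Fin r) F) V) :
    Submodule ℂ ((GL (Fin (k * r)) F) → PiTensorProduct ℂ (fun _ : Fin k => V)) where
  carrier := {f | ∀ p : GL (Fin (k * r)) F,
    IsParab (p : Matrix (Fin (k * r)) (Fin (k * r)) F) →
    ∀ d : Fin k → GL (Fin r) F,
      (∀ (i : Fin k) (a b : Fin r), (d i : Matrix (Fin r) (Fin r) F) a b =
        (p : Matrix (Fin (k * r)) (Fin (k * r)) F) (emb i a) (emb i b)) →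
      ∀ g : GL (Fin (k * r)) F,
        f (p * g) = PiTensorProduct.map (fun i => ρ (d i)) (f g)}
  add_mem' := by
    intro a b ha hb p hp d hd g
    simp only [Pi.add_apply, ha p hp d hd g, hb p hp d hd g, map_add]
  zero_mem' := by
    intro p hp d hd g
    simp
  smul_mem' := by
    intro t a ha p hp d hd g
    simp only [Pi.smul_apply, ha p hp d hd g, LinearMap.map_smul]

/-- Right translation by `u` on the induced space. -/
noncomputable def rTrans {F : Type} [Field F] [Fintype F] {r k : ℕ}
    {V : Type} [AddCommGroup V] [Module ℂ V]
    {ρ : Representation ℂ (GL (Fin r) F) V}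
    (u : GL (Fin (k * r)) F) (f : IndSpace F r k V ρ) : IndSpace F r k V ρ :=
  ⟨fun x => (f : (GL (Fin (k * r)) F) → PiTensorProduct ℂ (fun _ : Fin k => V)) (x * u),
    by
      intro p hp d hd g
      have h := f.2 p hp d hd (g * u)
      simpa [mul_assoc] using h⟩

/-- The value of the nondegenerate character `ψ_c` (built from an additive character
`φ` and coefficients `c`) at an upper unitriangular element `u`:
`ψ_c(u) = φ (Σ_j c_j u_{j, j+1})`. -/
def psiC {F : Type} [Field F] {n : ℕ} (φ : AddChar F ℂ) (c : Fin n → F)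
    (M : Matrix (Fin n) (Fin n) F) : ℂ :=
  φ (∑ j : Fin n, if h : (j : ℕ) + 1 < n then c j * M j ⟨(j : ℕ) + 1, h⟩ else 0)

/-- `T` intertwines the restriction of `π` to the parabolic with the inflation of
`ρ^{⊗k}`; the existence of a nonzero such `T` says exactly (by Frobenius reciprocity)
that the irreducible `π` is a constituent of the parabolic induction of `ρ^{⊗k}`. -/
def IntertwinesParab {k r : ℕ} {F : Type*} [Field F] [Fintype F]
    {V Vπ : Type*} [AddCommGroup V] [Module ℂ V] [AddCommGroup Vπ] [Module ℂ Vπ]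
    (ρ : Representation ℂ (GL (Fin r) F) V)
    (π : Representation ℂ (GL (Fin (k * r)) F) Vπ)
    (T : Vπ →ₗ[ℂ] PiTensorProduct ℂ (fun _ : Fin k => V)) : Prop :=
  ∀ p : GL (Fin (k * r)) F, IsParab (p : Matrix (Fin (k * r)) (Fin (k * r)) F) →
    ∀ d : Fin k → GL (Fin r) F,
      (∀ (i : Fin k) (a b : Fin r), (d i : Matrix (Fin r) (Fin r) F) a b =
        (p : Matrix (Fin (k * r)) (Fin (k * r)) F) (emb i a) (emb i b)) →
      ∀ v : Vπ, T (π p v) = PiTensorProduct.map (fun i => ρ (d i)) (T v)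

section CharacterProjection

variable {G V : Type*} [Group G] [Finite G] [AddCommGroup V] [Module ℂ V]

/-- The idempotent `|U|⁻¹ ∑ χ(u)⁻¹ π(u)` attached to a linear character `χ` of a subgroup `U`. -/
noncomputable def charProj {U : Subgroup G} (χ : U →* ℂ) (π : Representation ℂ G V) :
    V →ₗ[ℂ] V :=
  letI := Fintype.ofFinite U
  (Fintype.card U : ℂ)⁻¹ • ∑ u : U, χ u⁻¹ • π (u : G)

variable {U : Subgroup G} (χ : U →* ℂ) (π : Representation ℂ G V)

omit [Finite G] in
lemma monoidHom_inv_mul_self (u : U) : χ u⁻¹ * χ u = 1 := by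
  rw [← map_mul, inv_mul_cancel, map_one]

lemma charProj_eq_sum [Fintype U] (v : V) :
    charProj χ π v = (Fintype.card U : ℂ)⁻¹ • ∑ u : U, χ u⁻¹ • π (u : G) v := by
  rw [Subsingleton.elim (inferInstanceAs (Fintype U)) (Fintype.ofFinite U)]
  simp only [charProj, LinearMap.smul_apply, LinearMap.sum_apply]

lemma charProj_apply_of_eigen {W : Type*} [AddCommGroup W] [Module ℂ W] (f : V →ₗ[ℂ] W) (v : V)
    (h : ∀ u : U, f (π (u : G) v) = χ u • f v) : f (charProj χ π v) = f v := by
  let := Fintype.ofFinite U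
  have hc : (Fintype.card U : ℂ) ≠ 0 := by
    exact_mod_cast Fintype.card_ne_zero
  rw [charProj_eq_sum]
  simp only [map_smul, map_sum, h, smul_smul, monoidHom_inv_mul_self, one_smul, Finset.sum_const,
    Finset.card_univ]
  rw [← Nat.cast_smul_eq_nsmul ℂ, smul_smul, inv_mul_cancel₀ hc, one_smul]

lemma apply_charProj (u : U) (v : V) : π (u : G) (charProj χ π v) = χ u • charProj χ π v := by
  let := Fintype.ofFinite U
  rw [charProj_eq_sum, map_smul, smul_comm (χ u), map_sum, Finset.smul_sum (r := χ u)]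
  refine congrArg _ ?_
  refine Fintype.sum_equiv (Equiv.mulLeft u) _ _ fun x => ?_
  simp only [map_smul, Equiv.coe_mulLeft, _root_.mul_inv_rev, map_mul, Subgroup.coe_mul,
    Module.End.mul_apply, smul_smul]
  rw [mul_comm (χ u), mul_assoc, monoidHom_inv_mul_self, mul_one]

lemma charProj_apply (u : U) (v : V) : charProj χ π (π (u : G) v) = χ u • charProj χ π v := by
  let := Fintype.ofFinite U
  rw [charProj_eq_sum, charProj_eq_sum, smul_comm (χ u), Finset.smul_sum (r := χ u)]
  refine congrArg _ ?_
  refine Fintype.sum_equiv (Equiv.mulRight u) _ _ fun x => ?_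
  simp only [Equiv.coe_mulRight, _root_.mul_inv_rev, map_mul, Subgroup.coe_mul,
    Module.End.mul_apply, smul_smul]
  rw [← mul_assoc, mul_comm (χ u), monoidHom_inv_mul_self, one_mul]

lemma charProj_charProj (v : V) : charProj χ π (charProj χ π v) = charProj χ π v :=
  charProj_apply_of_eigen χ π (charProj χ π) v fun u => charProj_apply χ π u v

/-- Gelfand's trick: if an anti-involution preserves `χ` and fixes every `e π(g) e`, then the
`χ`-isotypic part of an irreducible representation is at most one-dimensional. -/
theorem exists_forall_charProj_eq_smul [FiniteDimensional ℂ V] (hirr : IsIrred π) (τ : G → G)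
    (hmul : ∀ g h, τ (g * h) = τ h * τ g) (τU : U ≃ U) (hτU : ∀ u : U, (τU u : G) = τ u)
    (hχ : ∀ u : U, χ (τU u) = χ u)
    (hfix : ∀ g v, charProj χ π (π g (charProj χ π v)) =
      charProj χ π (π (τ g) (charProj χ π v))) :
    ∃ v₀, ∀ v, ∃ s : ℂ, charProj χ π v = s • v₀ := by
  let := Fintype.ofFinite U
  set e := charProj χ π with he
  have hee : ∀ v, e (e v) = e v := charProj_charProj χ π
  have key : ∀ (g h : G) (v : V), e (π g (e (π h (e v)))) =
      (Fintype.card U : ℂ)⁻¹ • ∑ u : U, χ u⁻¹ • e (π (g * u * h) (e v)) := by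
    intro g h v
    conv_lhs => rw [he, charProj_eq_sum χ π (π h (e v)), ← he]
    simp only [map_smul, map_sum, map_mul, Module.End.mul_apply]
  have hinv : ∀ u : U, χ (τU u)⁻¹ = χ u⁻¹ := by
    intro u
    have h1 := monoidHom_inv_mul_self χ (τU u)
    have h2 := monoidHom_inv_mul_self χ u
    rw [hχ] at h1
    have h3 : χ u ≠ 0 := fun h => by simp [h] at h2
    exact mul_right_cancel₀ h3 (h1.trans h2.symm)
  have comm : ∀ (g h : G) (v : V), e (π g (e (π h (e v)))) = e (π h (e (π g (e v)))) := by
    intro g h v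
    have h1 : e (π g (e (π h (e v)))) = e (π (τ h) (e (π (τ g) (e v)))) := by
      rw [key, key]
      congr 1
      refine Fintype.sum_equiv τU _ _ fun u => ?_
      rw [hfix, hmul, hmul, hinv, hτU, mul_assoc]
    rw [h1, hfix g v, ← hee (π (τ g) (e v)), ← hfix h, hee]
  by_cases h0 : ∀ v, e v = 0
  · exact ⟨0, fun v => ⟨0, by simp [h0]⟩⟩
  push Not at h0
  obtain ⟨w, hw⟩ := h0
  have span : ∀ x : V, e x ≠ 0 → ∀ W : Submodule ℂ V, (∀ h, e (π h (e x)) ∈ W) →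
      ∀ v, e v ∈ W := by
    intro x hx W hW v
    let S : Submodule ℂ V := Submodule.span ℂ (Set.range fun g => π g (e x))
    have hS : S = ⊤ := by
      refine (hirr.2 S ?_).resolve_left ?_
      · intro g v hv
        refine Submodule.span_induction (p := fun v _ => π g v ∈ S) ?_ ?_ ?_ ?_ hv
        · rintro _ ⟨h, rfl⟩
          exact Submodule.subset_span ⟨g * h, by simp⟩
        · simp
        · intro a b _ _ ha hb
          rw [map_add]; exact S.add_mem ha hb
        · intro t a _ ha
          rw [map_smul]; exact S.smul_mem t ha
      · intro hbot
        apply hx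
        have : e x ∈ S := Submodule.subset_span ⟨1, by simp⟩
        rwa [hbot, Submodule.mem_bot] at this
    have hv : v ∈ S := hS ▸ Submodule.mem_top
    have : S ≤ W.comap e := by
      rw [Submodule.span_le]
      rintro _ ⟨g, rfl⟩
      exact hW g
    exact this hv
  have scalar : ∀ g : G, ∃ μ : ℂ, ∀ v, e (π g (e v)) = μ • e v := by
    intro g
    let R := LinearMap.range e
    let A : R →ₗ[ℂ] R := (e ∘ₗ π g ∘ₗ R.subtype).codRestrict R fun x => ⟨_, rfl⟩
    have : Nontrivial R := ⟨⟨e w, w, rfl⟩, 0, fun h => hw (congrArg Subtype.val h)⟩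
    obtain ⟨μ, hμ⟩ := Module.End.exists_eigenvalue A
    obtain ⟨⟨_, x, rfl⟩, hx⟩ := hμ.exists_hasEigenvector
    have hx1 : e (π g (e x)) = μ • e x := congrArg Subtype.val hx.apply_eq_smul
    have hx0 : e x ≠ 0 := fun h => hx.2 (Subtype.ext h)
    refine ⟨μ, fun v => ?_⟩
    have := span x hx0 (LinearMap.ker (e ∘ₗ π g ∘ₗ e - μ • e)) (fun h => by
      simp only [LinearMap.mem_ker, LinearMap.sub_apply, LinearMap.comp_apply,
        LinearMap.smul_apply, hee]
      rw [comm, hx1, map_smul, map_smul, sub_self]) v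
    simp only [LinearMap.mem_ker, LinearMap.sub_apply, LinearMap.comp_apply,
        LinearMap.smul_apply, hee, sub_eq_zero] at this
    exact this
  refine ⟨e w, fun v => ?_⟩
  have := span w hw (Submodule.span ℂ {e w}) (fun h => by
    obtain ⟨μ, hμ⟩ := scalar h
    rw [hμ]
    exact Submodule.smul_mem _ _ (Submodule.mem_span_singleton_self _)) v
  obtain ⟨s, hs⟩ := Submodule.mem_span_singleton.1 this
  exact ⟨s, hs.symm⟩

end CharacterProjection

section Irreducible

variable {G : Type*} [Group G] [Finite G]

/-- A functional not vanishing on a finite-dimensional representation is nonzero on some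
irreducible subrepresentation. -/
theorem exists_irred_subrepresentation {V : Type*} [AddCommGroup V] [Module ℂ V]
    [FiniteDimensional ℂ V] (π : Representation ℂ G V) (ℓ : V →ₗ[ℂ] ℂ) (hℓ : ℓ ≠ 0) :
    ∃ S : Subrepresentation π, IsIrred S.toRepresentation ∧ ∃ v ∈ S.toSubmodule, ℓ v ≠ 0 := by
  have hex : ∃ d, ∃ S : Subrepresentation π, Module.finrank ℂ S.toSubmodule = d ∧
      ∃ v ∈ S.toSubmodule, ℓ v ≠ 0 := by
    obtain ⟨v, hv⟩ : ∃ v, ℓ v ≠ 0 := by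
      by_contra! h
      exact hℓ (LinearMap.ext h)
    exact ⟨_, ⊤, rfl, v, Submodule.mem_top, hv⟩
  classical
  obtain ⟨S, hSd, v, hvS, hv⟩ := Nat.find_spec hex
  have hmin : ∀ T : Subrepresentation π, T.toSubmodule ≤ S.toSubmodule →
      (∃ v ∈ T.toSubmodule, ℓ v ≠ 0) → T.toSubmodule = S.toSubmodule := by
    intro T hTS hT
    refine Submodule.eq_of_le_of_finrank_le hTS ?_
    rw [hSd]
    exact Nat.find_min' hex ⟨T, rfl, hT⟩
  refine ⟨S, ⟨⟨⟨v, hvS⟩, fun h => hv ?_⟩, ?_⟩, v, hvS, hv⟩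
  · have : v = 0 := congrArg Subtype.val h
    simp [this]
  intro W hW
  have : NeZero (Nat.card G : ℂ) := ⟨by exact_mod_cast Nat.card_pos.ne'⟩
  obtain ⟨C, hC⟩ := exists_isCompl (⟨W, fun g v hv => hW g v hv⟩ :
    Subrepresentation S.toRepresentation)
  have push : ∀ X : Subrepresentation S.toRepresentation, ∃ T : Subrepresentation π,
      T.toSubmodule = X.toSubmodule.map S.toSubmodule.subtype := by
    intro X
    refine ⟨⟨X.toSubmodule.map S.toSubmodule.subtype, ?_⟩, rfl⟩
    rintro g _ ⟨x, hx, rfl⟩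
    exact ⟨S.toRepresentation g x, X.apply_mem_toSubmodule g hx, rfl⟩
  have full : ∀ X : Subrepresentation S.toRepresentation,
      (∃ x ∈ X.toSubmodule, ℓ (x : V) ≠ 0) → X.toSubmodule = ⊤ := by
    rintro X ⟨x, hxX, hx⟩
    obtain ⟨T, hT⟩ := push X
    have h1 : T.toSubmodule = S.toSubmodule := by
      refine hmin T ?_ ⟨x, ?_, hx⟩
      · rw [hT]; exact Submodule.map_subtype_le _ _
      · rw [hT]; exact ⟨x, hxX, rfl⟩
    rw [hT] at h1
    apply Submodule.map_injective_of_injective S.toSubmodule.injective_subtype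
    rw [h1, Submodule.map_subtype_top]
  have hsup : W ⊔ C.toSubmodule = ⊤ := congrArg Subrepresentation.toSubmodule hC.sup_eq_top
  have hinf : W ⊓ C.toSubmodule = ⊥ := congrArg Subrepresentation.toSubmodule hC.inf_eq_bot
  by_cases h : ∃ x ∈ W, ℓ (x : V) ≠ 0
  · exact Or.inr (full ⟨W, fun g v hv => hW g v hv⟩ h)
  · left
    have : (⟨v, hvS⟩ : S.toSubmodule) ∈ W ⊔ C.toSubmodule := hsup ▸ Submodule.mem_top
    obtain ⟨a, ha, b, hb, hab⟩ := Submodule.mem_sup.1 this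
    have hl : ℓ (a : V) + ℓ (b : V) = ℓ v := by
      rw [← map_add]; exact congrArg (fun x => ℓ x.1) hab
    have hC : C.toSubmodule = ⊤ := full C ⟨b, hb, fun h0 => hv (by
      push Not at h
      rw [← hl, h a ha, h0, add_zero])⟩
    rwa [hC, inf_top_eq] at hinf

variable {V₁ V₂ : Type*} [AddCommGroup V₁] [Module ℂ V₁] [AddCommGroup V₂] [Module ℂ V₂]
  {I : Type*} [AddCommGroup I] [Module ℂ I]

omit [Finite G] in
lemma injective_of_intertwines {π : Representation ℂ G V₁} (h : IsIrred π)
    {πI : Representation ℂ G I} (f : V₁ →ₗ[ℂ] I) (hf : f ≠ 0)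
    (hcomm : ∀ g v, f (π g v) = πI g (f v)) : Function.Injective f := by
  rw [← LinearMap.ker_eq_bot]
  refine (h.2 (LinearMap.ker f) fun g v hv => ?_).resolve_right fun h => hf ?_
  · rw [LinearMap.mem_ker] at hv ⊢
    rw [hcomm, hv, map_zero]
  · exact LinearMap.ker_eq_top.1 h

/-- Two irreducible subrepresentations on which a multiplicity-one functional extends nontrivially
coincide, hence have equal characters. -/
theorem trace_eq_of_multiplicity_one {π₁ : Representation ℂ G V₁} {π₂ : Representation ℂ G V₂}
    (h₁ : IsIrred π₁) (h₂ : IsIrred π₂) {πI : Representation ℂ G I} {U : Subgroup G}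
    (χ : U →* ℂ) (ℓ₀ : I →ₗ[ℂ] ℂ)
    (hℓ₀ : ∀ ℓ : I →ₗ[ℂ] ℂ, (∀ (u : U) v, ℓ (πI u v) = χ u * ℓ v) → ∃ z : ℂ, ℓ = z • ℓ₀)
    (f₁ : V₁ →ₗ[ℂ] I) (f₂ : V₂ →ₗ[ℂ] I) (hf₁ : f₁ ≠ 0) (hf₂ : f₂ ≠ 0)
    (hcomm₁ : ∀ g v, f₁ (π₁ g v) = πI g (f₁ v)) (hcomm₂ : ∀ g v, f₂ (π₂ g v) = πI g (f₂ v))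
    (ℓ₁ : V₁ →ₗ[ℂ] ℂ) (ℓ₂ : V₂ →ₗ[ℂ] ℂ) (hℓ₁ : ℓ₁ ≠ 0) (hℓ₂ : ℓ₂ ≠ 0)
    (hw₁ : ∀ (u : U) v, ℓ₁ (π₁ u v) = χ u * ℓ₁ v) (hw₂ : ∀ (u : U) v, ℓ₂ (π₂ u v) = χ u * ℓ₂ v)
    (g : G) : LinearMap.trace ℂ V₁ (π₁ g) = LinearMap.trace ℂ V₂ (π₂ g) := by
  have i₁ := injective_of_intertwines h₁ f₁ hf₁ hcomm₁
  have i₂ := injective_of_intertwines h₂ f₂ hf₂ hcomm₂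
  have extend : ∀ m : I →ₗ[ℂ] ℂ, ∃ z : ℂ, m ∘ₗ charProj χ πI = z • ℓ₀ := fun m =>
    hℓ₀ _ fun u v => by
      rw [LinearMap.comp_apply, charProj_apply, map_smul, smul_eq_mul, LinearMap.comp_apply]
  have hle : LinearMap.range f₁ ≤ LinearMap.range f₂ := by
    let A := (LinearMap.range f₂).mkQ ∘ₗ f₁
    have hker : LinearMap.ker A = ⊥ ∨ LinearMap.ker A = ⊤ := by
      refine h₁.2 _ fun g v hv => ?_
      simp only [A, LinearMap.mem_ker, LinearMap.comp_apply, Submodule.mkQ_apply,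
        Submodule.Quotient.mk_eq_zero, hcomm₁] at hv ⊢
      obtain ⟨y, hy⟩ := hv
      exact ⟨π₂ g y, by rw [hcomm₂, hy]⟩
    rcases hker with hker | hker
    · exfalso
      obtain ⟨B, hB⟩ := LinearMap.exists_leftInverse_of_injective A hker
      obtain ⟨z, hz⟩ := extend (ℓ₁ ∘ₗ B ∘ₗ (LinearMap.range f₂).mkQ)
      have e₁ : ∀ v, z * ℓ₀ (f₁ v) = ℓ₁ v := by
        intro v
        have h3 : ∀ v, (ℓ₁ ∘ₗ B ∘ₗ (LinearMap.range f₂).mkQ) (f₁ v) = ℓ₁ v := fun v =>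
          congrArg ℓ₁ (LinearMap.congr_fun hB v)
        have := LinearMap.congr_fun hz (f₁ v)
        rw [LinearMap.comp_apply, charProj_apply_of_eigen, h3] at this
        · exact this.symm
        · intro u
          rw [← hcomm₁, h3, h3, hw₁, smul_eq_mul]
      have e₂ : ∀ v, z * ℓ₀ (f₂ v) = 0 := by
        intro v
        have h3 : ∀ v, (ℓ₁ ∘ₗ B ∘ₗ (LinearMap.range f₂).mkQ) (f₂ v) = 0 := fun v => by
          have : (LinearMap.range f₂).mkQ (f₂ v) = 0 := by simp
          rw [LinearMap.comp_apply, LinearMap.comp_apply, this, map_zero, map_zero]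
        have := LinearMap.congr_fun hz (f₂ v)
        rw [LinearMap.comp_apply, charProj_apply_of_eigen, h3] at this
        · exact this.symm
        · intro u
          rw [← hcomm₂, h3, h3, smul_zero]
      obtain ⟨B', hB'⟩ := LinearMap.exists_leftInverse_of_injective f₂ (LinearMap.ker_eq_bot.2 i₂)
      obtain ⟨z', hz'⟩ := extend (ℓ₂ ∘ₗ B')
      have e₃ : ∀ v, z' * ℓ₀ (f₂ v) = ℓ₂ v := by
        intro v
        have h3 : ∀ v, (ℓ₂ ∘ₗ B') (f₂ v) = ℓ₂ v := fun v =>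
          congrArg ℓ₂ (LinearMap.congr_fun hB' v)
        have := LinearMap.congr_fun hz' (f₂ v)
        rw [LinearMap.comp_apply, charProj_apply_of_eigen, h3] at this
        · exact this.symm
        · intro u
          rw [← hcomm₂, h3, h3, hw₂, smul_eq_mul]
      have hz0 : z ≠ 0 := fun h => hℓ₁ (LinearMap.ext fun v => by rw [← e₁, h]; simp)
      refine hℓ₂ (LinearMap.ext fun v => ?_)
      rw [← e₃, (mul_eq_zero.1 (e₂ v)).resolve_left hz0]
      simp
    · rintro _ ⟨v, rfl⟩
      have : v ∈ LinearMap.ker A := hker ▸ Submodule.mem_top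
      simpa [A] using this
  have hex : ∀ v, ∃ w, f₂ w = f₁ v := fun v => hle ⟨v, rfl⟩
  choose t ht using hex
  let T : V₁ →ₗ[ℂ] V₂ :=
    { toFun := t
      map_add' := fun a b => i₂ (by rw [map_add, ht, ht, ht, map_add])
      map_smul' := fun a b => i₂ (by rw [map_smul, ht, ht, map_smul]; rfl) }
  have hT : ∀ g v, T (π₁ g v) = π₂ g (T v) := fun g v => i₂ (by
    change f₂ (t _) = f₂ (π₂ g (t v))
    rw [hcomm₂, ht, ht, hcomm₁])
  have hT0 : T ≠ 0 := fun h => hf₁ (LinearMap.ext fun v => by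
    rw [← ht v]
    have : t v = 0 := LinearMap.congr_fun h v
    rw [this]; simp)
  have hinj := injective_of_intertwines h₁ T hT0 hT
  have hsurj : LinearMap.range T = ⊤ := by
    refine (h₂.2 _ ?_).resolve_left fun h => hT0 (LinearMap.range_eq_bot.1 h)
    rintro g _ ⟨v, rfl⟩
    exact ⟨π₁ g v, hT g v⟩
  let E := LinearEquiv.ofBijective T ⟨hinj, LinearMap.range_eq_top.1 hsurj⟩
  have : π₂ g = E.conj (π₁ g) := by
    ext v
    obtain ⟨w, rfl⟩ := E.surjective v
    rw [LinearEquiv.conj_apply_apply, LinearEquiv.symm_apply_apply]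
    exact (hT g w).symm
  rw [this, LinearMap.trace_conj']

end Irreducible

lemma inv_mem_of_finite_s14 {G : Type*} [Group G] [Finite G] (S : G → Prop) (h1 : S 1)
    (hmul : ∀ x y, S x → S y → S (x * y)) {x : G} (hx : S x) : S x⁻¹ := by
  have hpow : ∀ k : ℕ, S (x ^ k) := by
    intro k
    induction k with
    | zero => rwa [pow_zero]
    | succ k ih => rw [pow_succ]; exact hmul _ _ ih hx
  have : x⁻¹ = x ^ (Nat.card G - 1) := by
    rw [eq_comm, eq_inv_iff_mul_eq_one, ← pow_succ, Nat.sub_add_cancel Nat.card_pos,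
      pow_card_eq_one']
  rw [this]
  exact hpow _

section Unitriangular

variable {n : ℕ} {F : Type} [Field F]

lemma IsUniTri.one : IsUniTri (1 : Matrix (Fin n) (Fin n) F) := fun i j _ => by
  rw [Matrix.one_apply]

lemma IsUniTri.mul {M N : Matrix (Fin n) (Fin n) F} (hM : IsUniTri M) (hN : IsUniTri N) :
    IsUniTri (M * N) := by
  intro i j hij
  rw [Matrix.mul_apply, Finset.sum_eq_single i]
  · rw [hM i i le_rfl, hN i j hij]; simp
  · intro l _ hl
    rcases lt_or_gt_of_ne hl with h | h
    · rw [hM i l h.le, if_neg hl.symm, zero_mul]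
    · rw [hN l j (hij.trans h.le), if_neg (hij.trans_lt h).ne', mul_zero]
  · simp

lemma IsUniTri.det {M : Matrix (Fin n) (Fin n) F} (hM : IsUniTri M) : M.det = 1 := by
  rw [Matrix.det_of_isUpperTriangular]
  · exact Finset.prod_eq_one fun i _ => by rw [hM i i le_rfl, if_pos rfl]
  · intro i j hij
    have hij' : j < i := hij
    rw [hM i j hij'.le, if_neg hij'.ne']

variable [Fintype F]

/-- The group of upper unitriangular matrices. -/
def uniGL (n : ℕ) (F : Type) [Field F] [Fintype F] : Subgroup (GL (Fin n) F) where
  carrier := {u | IsUniTri (u : Matrix (Fin n) (Fin n) F)}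
  one_mem' := IsUniTri.one
  mul_mem' h h' := IsUniTri.mul h h'
  inv_mem' h := inv_mem_of_finite_s14 (fun u : GL (Fin n) F => IsUniTri u.val) IsUniTri.one
    (fun _ _ h h' => IsUniTri.mul h h') h

lemma IsUniTri.exists_mem_uniGL {M : Matrix (Fin n) (Fin n) F} (hM : IsUniTri M) :
    ∃ u ∈ uniGL n F, u.val = M :=
  ⟨Matrix.GeneralLinearGroup.mkOfDetNeZero M (by rw [hM.det]; exact one_ne_zero), hM, rfl⟩

omit [Fintype F] in
lemma IsUniTri.mul_apply_succ {M N : Matrix (Fin n) (Fin n) F} (hM : IsUniTri M)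
    (hN : IsUniTri N) (j : Fin n) (h : (j : ℕ) + 1 < n) :
    (M * N) j ⟨j + 1, h⟩ = M j ⟨j + 1, h⟩ + N j ⟨j + 1, h⟩ := by
  have hne : j ≠ ⟨j + 1, h⟩ := fun e => by simpa using congrArg Fin.val e
  rw [Matrix.mul_apply, Finset.sum_eq_add j ⟨j + 1, h⟩ hne]
  · rw [hM j j le_rfl, hN _ _ le_rfl]; simp [add_comm]
  · rintro l - ⟨hl₁, hl₂⟩
    rcases lt_or_ge l j with h' | h'
    · rw [hM j l h'.le, if_neg hl₁.symm, zero_mul]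
    · have : (⟨j + 1, h⟩ : Fin n) ≤ l := lt_of_le_of_ne h' hl₁.symm
      rw [hN l _ this, if_neg hl₂, mul_zero]
  · simp
  · simp

omit [Fintype F] in
lemma psiC_mul (φ : AddChar F ℂ) (c : Fin n → F) {M N : Matrix (Fin n) (Fin n) F}
    (hM : IsUniTri M) (hN : IsUniTri N) : psiC φ c (M * N) = psiC φ c M * psiC φ c N := by
  rw [psiC, psiC, psiC, ← AddChar.map_add_eq_mul, ← Finset.sum_add_distrib]
  congr 1
  refine Finset.sum_congr rfl fun j _ => ?_
  split_ifs with h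
  · rw [hM.mul_apply_succ hN, mul_add]
  · simp

omit [Fintype F] in
lemma psiC_eq_one (φ : AddChar F ℂ) (c : Fin n → F) {M : Matrix (Fin n) (Fin n) F}
    (hM : ∀ (j : Fin n) (h : (j : ℕ) + 1 < n), M j ⟨j + 1, h⟩ = 0) : psiC φ c M = 1 := by
  rw [psiC, Finset.sum_eq_zero, AddChar.map_zero_eq_one]
  intro j _
  split_ifs with h
  · rw [hM, mul_zero]
  · rfl

omit [Fintype F] in
lemma psiC_one (φ : AddChar F ℂ) (c : Fin n → F) :
    psiC φ c (1 : Matrix (Fin n) (Fin n) F) = 1 :=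
  psiC_eq_one φ c fun j h => Matrix.one_apply_ne fun e => by simpa using congrArg Fin.val e

/-- The nondegenerate character as a homomorphism on the unitriangular group. -/
def psiHom (φ : AddChar F ℂ) (c : Fin n → F) : uniGL n F →* ℂ where
  toFun u := psiC φ c (u : GL (Fin n) F).val
  map_one' := psiC_one φ c
  map_mul' u v := psiC_mul φ c u.2 v.2

lemma psiHom_apply (φ : AddChar F ℂ) (c : Fin n → F) (u : uniGL n F) :
    psiHom φ c u = psiC φ c (u : GL (Fin n) F).val := rfl

omit [Fintype F] in
lemma isUniTri_transvection {i j : Fin n} (hij : i < j) (s : F) :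
    IsUniTri (Matrix.transvection i j s) := by
  intro a b hab
  rw [Matrix.transvection, Matrix.add_apply, Matrix.one_apply, Matrix.single_apply_of_ne, add_zero]
  rintro ⟨rfl, rfl⟩
  exact absurd hij (not_lt.2 hab)

omit [Fintype F] in
lemma psiC_transvection_succ (φ : AddChar F ℂ) (c : Fin n → F) (j : Fin n) (h : (j : ℕ) + 1 < n)
    (s : F) : psiC φ c (Matrix.transvection j ⟨j + 1, h⟩ s) = φ (c j * s) := by
  rw [psiC, Finset.sum_eq_single j]
  · rw [dif_pos h, Matrix.transvection, Matrix.add_apply, Matrix.single_apply_same,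
      Matrix.one_apply_ne (fun e => by simpa using congrArg Fin.val e), zero_add]
  · intro l _ hl
    split_ifs with h'
    · rw [Matrix.transvection, Matrix.add_apply, Matrix.single_apply_of_ne _ _ _ _ _
        (fun e => hl e.1.symm), Matrix.one_apply_ne (fun e => by simpa using congrArg Fin.val e),
        add_zero, mul_zero]
    · rfl
  · simp

omit [Fintype F] in
lemma psiC_transvection_of_ne (φ : AddChar F ℂ) (c : Fin n → F) {i j : Fin n}
    (h : (i : ℕ) + 1 ≠ j) (s : F) : psiC φ c (Matrix.transvection i j s) = 1 := by
  refine psiC_eq_one φ c fun l hl => ?_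
  rw [Matrix.transvection, Matrix.add_apply, Matrix.single_apply_of_ne _ _ _ _ _,
    Matrix.one_apply_ne (fun e => by simpa using congrArg Fin.val e), add_zero]
  rintro ⟨rfl, rfl⟩
  exact h rfl

end Unitriangular

section Monomial

variable {n : ℕ} {F : Type} [Field F]

/-- The monomial matrix with entry `t i` at position `(i, p i)`. -/
def monoMat (p : Equiv.Perm (Fin n)) (t : Fin n → Fˣ) : Matrix (Fin n) (Fin n) F :=
  Matrix.of fun i j => if j = p i then (t i : F) else 0

lemma monoMat_apply (p : Equiv.Perm (Fin n)) (t : Fin n → Fˣ) (i j : Fin n) :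
    monoMat p t i j = if j = p i then (t i : F) else 0 := rfl

lemma monoMat_mul_apply (p : Equiv.Perm (Fin n)) (t : Fin n → Fˣ) (A : Matrix (Fin n) (Fin n) F)
    (i j : Fin n) : (monoMat p t * A) i j = t i * A (p i) j := by
  simp [Matrix.mul_apply, monoMat_apply]

lemma mul_monoMat_apply (p : Equiv.Perm (Fin n)) (t : Fin n → Fˣ) (A : Matrix (Fin n) (Fin n) F)
    (i j : Fin n) : (A * monoMat p t) i j = A i (p.symm j) * t (p.symm j) := by
  rw [Matrix.mul_apply, Finset.sum_eq_single (p.symm j)]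
  · simp [monoMat_apply]
  · intro b _ hb
    rw [monoMat_apply, if_neg, mul_zero]
    rintro rfl
    simp at hb
  · simp

/-- The monomial matrix as an invertible matrix. -/
def monoGL (p : Equiv.Perm (Fin n)) (t : Fin n → Fˣ) : GL (Fin n) F where
  val := monoMat p t
  inv := monoMat p.symm fun j => (t (p.symm j))⁻¹
  val_inv := by
    ext i j
    rw [monoMat_mul_apply, monoMat_apply, Matrix.one_apply]
    simp [eq_comm]
  inv_val := by
    ext i j
    rw [monoMat_mul_apply, monoMat_apply, Matrix.one_apply]
    simp [eq_comm]

@[simp]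
lemma coe_monoGL (p : Equiv.Perm (Fin n)) (t : Fin n → Fˣ) : (monoGL p t).val = monoMat p t := rfl

lemma monoMat_mul_transvection (p : Equiv.Perm (Fin n)) (t : Fin n → Fˣ) (i j : Fin n) (s : F) :
    monoMat p t * Matrix.transvection (p i) (p j) s =
      Matrix.transvection i j (t i * s * ((t j)⁻¹ : Fˣ)) * monoMat p t := by
  ext a b
  rw [monoMat_mul_apply, mul_monoMat_apply, Matrix.transvection, Matrix.transvection,
    Matrix.add_apply, Matrix.add_apply, Matrix.one_apply, Matrix.one_apply, Matrix.single_apply,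
    Matrix.single_apply]
  simp only [EmbeddingLike.apply_eq_iff_eq, Equiv.eq_symm_apply, mul_add, add_mul]
  congr 1
  · split_ifs with h
    · have : a = p.symm b := by rw [← h]; simp
      rw [this]; ring
    · simp
  · split_ifs with h
    · have : j = p.symm b := by rw [← h.2]; simp
      rw [← this, h.1, mul_assoc, mul_assoc]; simp
    · simp

end Monomial

section Bruhat

variable {n : ℕ} {F : Type} [Field F] [Fintype F]

/-- The Bruhat decomposition of the general linear group. -/
theorem exists_uniGL_mul_mul_eq_monoGL (A : GL (Fin n) F) :
    ∃ u₁ ∈ uniGL n F, ∃ u₂ ∈ uniGL n F, ∃ p t, u₁ * A * u₂ = monoGL p t := by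
  classical
  have step : ∀ m : ℕ, ∃ u₁ ∈ uniGL n F, ∃ u₂ ∈ uniGL n F, ∀ i : Fin n, n ≤ i + m →
      ∃ j, (u₁ * A * u₂).val i j ≠ 0 ∧ (∀ j', j' ≠ j → (u₁ * A * u₂).val i j' = 0) ∧
        ∀ i', i' ≠ i → (u₁ * A * u₂).val i' j = 0 := by
    intro m
    induction m with
    | zero => exact ⟨1, one_mem _, 1, one_mem _, fun i hi => absurd i.2 (by omega)⟩
    | succ m ih =>
      obtain ⟨u₁, h₁, u₂, h₂, H⟩ := ih
      by_cases hm : n ≤ m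
      · exact ⟨u₁, h₁, u₂, h₂, fun i _ => H i (by omega)⟩
      push Not at hm
      set B := u₁ * A * u₂ with hB
      let i₀ : Fin n := ⟨n - m - 1, by omega⟩
      have hrow : (Finset.univ.filter fun j => B.val i₀ j ≠ 0).Nonempty := by
        by_contra hne
        rw [Finset.not_nonempty_iff_eq_empty, Finset.filter_eq_empty_iff] at hne
        have h1 : (B.val * B⁻¹.val) i₀ i₀ = 1 := by
          rw [← Units.val_mul, mul_inv_cancel, Units.val_one, Matrix.one_apply_eq]
        rw [Matrix.mul_apply, Finset.sum_eq_zero] at h1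
        · exact zero_ne_one h1
        · intro j _
          have := hne (Finset.mem_univ j)
          rw [not_not] at this
          rw [this, zero_mul]
      obtain ⟨j₀, hj₀, hmin⟩ : ∃ j₀, B.val i₀ j₀ ≠ 0 ∧ ∀ j < j₀, B.val i₀ j = 0 := by
        refine ⟨_, (Finset.mem_filter.1 (Finset.min'_mem _ hrow)).2, fun j hj => ?_⟩
        by_contra hne
        exact absurd (Finset.min'_le _ j (Finset.mem_filter.2 ⟨Finset.mem_univ j, hne⟩))
          (not_le.2 hj)
      let R : Matrix (Fin n) (Fin n) F := 1 + Matrix.of fun a b =>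
        if a = j₀ then (if j₀ < b then -(B.val i₀ b / B.val i₀ j₀) else 0) else 0
      let L : Matrix (Fin n) (Fin n) F := 1 + Matrix.of fun a b =>
        if b = i₀ then (if a < i₀ then -(B.val a j₀ / B.val i₀ j₀) else 0) else 0
      have hR : IsUniTri R := by
        intro a b hab
        simp only [R, Matrix.add_apply, Matrix.one_apply, Matrix.of_apply]
        rw [add_eq_left, ite_eq_right_iff]
        rintro rfl
        exact if_neg (not_lt.2 hab)
      have hL : IsUniTri L := by
        intro a b hab
        simp only [L, Matrix.add_apply, Matrix.one_apply, Matrix.of_apply]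
        rw [add_eq_left, ite_eq_right_iff]
        rintro rfl
        exact if_neg (not_lt.2 hab)
      obtain ⟨r, hr, hrR⟩ := hR.exists_mem_uniGL
      obtain ⟨l, hl, hlL⟩ := hL.exists_mem_uniGL
      have eR : ∀ a b, (B.val * R) a b = B.val a b +
          if j₀ < b then B.val a j₀ * -(B.val i₀ b / B.val i₀ j₀) else 0 := by
        intro a b
        simp only [R, mul_add, mul_one, Matrix.add_apply]
        congr 1
        rw [Matrix.mul_apply]
        simp only [Matrix.of_apply, mul_ite, mul_zero, Finset.sum_ite_eq', Finset.mem_univ,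
          if_true]
      have eL : ∀ a b, (L * (B.val * R)) a b = (B.val * R) a b +
          if a < i₀ then -(B.val a j₀ / B.val i₀ j₀) * (B.val * R) i₀ b else 0 := by
        intro a b
        simp only [L, add_mul, one_mul, Matrix.add_apply]
        congr 1
        rw [Matrix.mul_apply]
        simp only [Matrix.of_apply, ite_mul, zero_mul, Finset.sum_ite_eq', Finset.mem_univ,
          if_true]
      refine ⟨l * u₁, mul_mem hl h₁, u₂ * r, mul_mem h₂ hr, ?_⟩
      have hval : (l * u₁ * A * (u₂ * r)).val = L * (B.val * R) := by
        have : l * u₁ * A * (u₂ * r) = l * (B * r) := by rw [hB]; group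
        rw [this, Units.val_mul, Units.val_mul, hrR, hlL]
      rw [hval]
      have below : ∀ i : Fin n, i₀ < i → ∃ j, B.val i j ≠ 0 ∧ (∀ j', j' ≠ j → B.val i j' = 0) ∧
          (∀ i', i' ≠ i → B.val i' j = 0) ∧ j ≠ j₀ := by
        intro i hi
        obtain ⟨j, hj1, hj2, hj3⟩ := H i (by
          have : n - m - 1 < (i : ℕ) := hi
          omega)
        refine ⟨j, hj1, hj2, hj3, ?_⟩
        rintro rfl
        exact hj₀ (hj3 i₀ hi.ne)
      have hcol : ∀ i : Fin n, i₀ < i → B.val i j₀ = 0 := by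
        intro i hi
        obtain ⟨j, -, hj2, -, hj⟩ := below i hi
        exact hj2 j₀ hj.symm
      have hR₀ : ∀ a, (B.val * R) a j₀ = B.val a j₀ := by
        intro a
        rw [eR, if_neg (lt_irrefl _), add_zero]
      intro i hi
      rcases lt_or_eq_of_le (show i₀ ≤ i from by
        change n - m - 1 ≤ (i : ℕ); omega) with h | rfl
      · obtain ⟨j, hj1, hj2, hj3, hj⟩ := below i h
        have e1 : ∀ b, (L * (B.val * R)) i b = B.val i b := by
          intro b
          rw [eL, if_neg (not_lt.2 h.le), add_zero, eR, hcol i h]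
          simp
        refine ⟨j, by rwa [e1], fun j' hj' => by rw [e1, hj2 j' hj'], fun i' hi' => ?_⟩
        have e2 : ∀ a, a ≠ i → (B.val * R) a j = 0 := by
          intro a ha
          rw [eR, hj3 a ha, hj3 i₀ h.ne]
          simp
        rw [eL, e2 i' hi', e2 i₀ h.ne]
        simp
      · refine ⟨j₀, ?_, ?_, ?_⟩
        · rwa [eL, if_neg (lt_irrefl _), add_zero, hR₀]
        · intro b hb
          rw [eL, if_neg (lt_irrefl _), add_zero, eR]
          rcases lt_or_gt_of_ne hb with h | h
          · rw [hmin b h, if_neg (not_lt.2 h.le), add_zero]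
          · rw [if_pos h]
            field_simp
            ring
        · intro a ha
          rw [eL, hR₀, hR₀]
          rcases lt_or_gt_of_ne ha with h | h
          · rw [if_pos h]
            field_simp
            ring
          · rw [hcol a h, if_neg (not_lt.2 h.le), add_zero]
  obtain ⟨u₁, h₁, u₂, h₂, H⟩ := step n
  choose p hp1 hp2 hp3 using fun i : Fin n => H i (by omega)
  have hinj : Function.Injective p := by
    intro a b hab
    by_contra hne
    exact hp1 a (by rw [hab]; exact hp3 b a hne)
  refine ⟨u₁, h₁, u₂, h₂, Equiv.ofBijective p (Finite.injective_iff_bijective.1 hinj),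
    fun i => Units.mk0 _ (hp1 i), ?_⟩
  ext i j
  rw [coe_monoGL, monoMat_apply]
  split_ifs with h
  · rw [h]; rfl
  · exact hp2 i j h

end Bruhat

section Combinatorics

/-- If `j + σ j` is monotone in `j`, then it is constant on the orbits of `σ`. -/
lemma perm_apply_add_apply_of_monotone {n : ℕ} (σ : Equiv.Perm (Fin n))
    (h : Monotone fun j : Fin n => (j : ℕ) + σ j) (j : Fin n) :
    (σ j : ℕ) + σ (σ j) = j + σ j := by
  let f : Fin n → ℕ := fun j => (j : ℕ) + σ j
  let g : Fin n → ℕ := fun j => j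
  have hg : Monotone g := fun a b hab => hab
  have hsum : ∑ i, f i * g (σ i) = ∑ i, f i * g i := by
    simp only [f, g, add_mul, Finset.sum_add_distrib]
    rw [Equiv.sum_comp σ fun i : Fin n => (i : ℕ) * i, add_comm]
    simp only [mul_comm]
  have hmono := ((h.monovary hg).sum_mul_comp_perm_eq_sum_mul_iff (σ := σ)).1 hsum
  have hf : Monotone (f ∘ σ.symm) := by
    intro a b hab
    rcases eq_or_lt_of_le hab with rfl | hlt
    · exact le_rfl
    · exact hmono (by simpa [g] using hlt)
  have heq : f ∘ σ.symm = f ∘ (1 : Equiv.Perm (Fin n)) := Tuple.unique_monotone hf h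
  have := congrFun heq (σ j)
  simp only [f, Function.comp_apply, Equiv.symm_apply_apply, Equiv.Perm.coe_one, id_eq] at this
  exact this.symm

end Combinatorics

section AntiInvolution

variable {n : ℕ} {F : Type} [Field F]

/-- Transposition along the anti-diagonal. -/
def antiTranspose (M : Matrix (Fin n) (Fin n) F) : Matrix (Fin n) (Fin n) F :=
  Mᵀ.submatrix Fin.rev Fin.rev

omit [Field F] in
lemma antiTranspose_apply (M : Matrix (Fin n) (Fin n) F) (i j : Fin n) :
    antiTranspose M i j = M j.rev i.rev := rfl

lemma antiTranspose_one : antiTranspose (1 : Matrix (Fin n) (Fin n) F) = 1 := by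
  ext i j
  simp [antiTranspose_apply, Matrix.one_apply, eq_comm]

lemma antiTranspose_mul (M N : Matrix (Fin n) (Fin n) F) :
    antiTranspose (M * N) = antiTranspose N * antiTranspose M := by
  ext i j
  rw [antiTranspose_apply, Matrix.mul_apply, Matrix.mul_apply]
  refine Fintype.sum_equiv Fin.revPerm _ _ fun l => ?_
  simp [antiTranspose_apply, mul_comm]

/-- Transposition along the anti-diagonal of invertible matrices. -/
def antiTransposeGL (g : GL (Fin n) F) : GL (Fin n) F where
  val := antiTranspose g.val
  inv := antiTranspose g⁻¹.val
  val_inv := by rw [← antiTranspose_mul, ← Units.val_mul, inv_mul_cancel, Units.val_one,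
    antiTranspose_one]
  inv_val := by rw [← antiTranspose_mul, ← Units.val_mul, mul_inv_cancel, Units.val_one,
    antiTranspose_one]

lemma antiTransposeGL_mul (g h : GL (Fin n) F) :
    antiTransposeGL (g * h) = antiTransposeGL h * antiTransposeGL g :=
  Units.ext (antiTranspose_mul _ _)

lemma antiTransposeGL_antiTransposeGL (g : GL (Fin n) F) :
    antiTransposeGL (antiTransposeGL g) = g := by
  ext i j
  change g.val i.rev.rev j.rev.rev = _
  rw [Fin.rev_rev, Fin.rev_rev]

lemma IsUniTri.antiTranspose {M : Matrix (Fin n) (Fin n) F} (hM : IsUniTri M) :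
    IsUniTri (antiTranspose M) := by
  intro i j hij
  rw [antiTranspose_apply, hM _ _ (Fin.rev_le_rev.2 hij)]
  simp [eq_comm]

lemma psiC_succ {m : ℕ} (φ : AddChar F ℂ) (c : Fin (m + 1) → F)
    (M : Matrix (Fin (m + 1)) (Fin (m + 1)) F) :
    psiC φ c M = φ (∑ j : Fin m, c j.castSucc * M j.castSucc j.succ) := by
  rw [psiC, Fin.sum_univ_castSucc, dif_neg (by simp), add_zero]
  congr 1
  refine Finset.sum_congr rfl fun j _ => ?_
  rw [dif_pos (by simp)]
  rfl

lemma psiC_antiTranspose (φ : AddChar F ℂ) (M : Matrix (Fin n) (Fin n) F) :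
    psiC φ 1 (antiTranspose M) = psiC φ 1 M := by
  cases n with
  | zero => simp [psiC]
  | succ m =>
    rw [psiC_succ, psiC_succ]
    congr 1
    refine Fintype.sum_equiv Fin.revPerm _ _ fun j => ?_
    simp [antiTranspose_apply, Fin.rev_succ, Fin.rev_castSucc]

lemma AddChar.eq_of_forall_apply_mul_eq [Fintype F] {φ : AddChar F ℂ} (hφ : φ ≠ 1) {a b : F}
    (h : ∀ s, φ (a * s) = φ (b * s)) : a = b := by
  by_contra hne
  apply AddChar.IsPrimitive.of_ne_one hφ (sub_ne_zero.2 hne)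
  ext s
  rw [AddChar.mulShift_apply, sub_mul, AddChar.map_sub_eq_div, h, AddChar.one_apply,
    div_self]
  intro h0
  have := φ.map_add_eq_mul (b * s) (-(b * s))
  simp [h0] at this

end AntiInvolution

section GelfandGraev

lemma charProj_apply_charProj_eq_zero {G V : Type*} [Group G] [Finite G] [AddCommGroup V]
    [Module ℂ V] {U : Subgroup G} (χ : U →* ℂ) (π : Representation ℂ G V) {g : G} {u u' : U}
    (h : g * u = u' * g) (hχ : χ u ≠ χ u') (v : V) : charProj χ π (π g (charProj χ π v)) = 0 := by
  have h1 : χ u • charProj χ π (π g (charProj χ π v)) =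
      χ u' • charProj χ π (π g (charProj χ π v)) := by
    rw [← charProj_apply χ π u', ← map_smul, ← map_smul, ← apply_charProj χ π u,
      ← Module.End.mul_apply (π g), ← map_mul, h, map_mul, Module.End.mul_apply]
  by_contra hne
  exact hχ (smul_left_injective ℂ hne h1)

variable {n : ℕ} {F : Type} [Field F] [Fintype F]

/-- A monomial matrix supporting the Gelfand–Graev character is symmetric about the
anti-diagonal. -/
lemma antiTransposeGL_monoGL_of_ne_zero {V : Type*} [AddCommGroup V] [Module ℂ V]
    (π : Representation ℂ (GL (Fin n) F) V) {φ : AddChar F ℂ} (hφ : φ ≠ 1)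
    (p : Equiv.Perm (Fin n)) (t : Fin n → Fˣ) {v : V}
    (hv : charProj (psiHom φ 1) π (π (monoGL p t) (charProj (psiHom φ 1) π v)) ≠ 0) :
    antiTransposeGL (monoGL p t) = monoGL p t := by
  have adj : ∀ j l : Fin n, (j : ℕ) + 1 = l → p.symm j < p.symm l →
      (p.symm j : ℕ) + 1 = p.symm l ∧ t (p.symm j) = t (p.symm l) := by
    intro j l hjl hlt
    have hjl' : j < l := Fin.lt_def.2 (by omega)
    have hjn : (j : ℕ) + 1 < n := hjl ▸ l.2
    have hl : l = ⟨j + 1, hjn⟩ := Fin.ext hjl.symm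
    set i := p.symm j with hi
    set i' := p.symm l with hi'
    have key : ∀ s : F, φ s = psiC φ 1 (Matrix.transvection i i' (t i * s * ((t i')⁻¹ : Fˣ))) := by
      intro s
      obtain ⟨u, hu, hu'⟩ := (isUniTri_transvection hjl' s).exists_mem_uniGL
      obtain ⟨x, hx, hx'⟩ := (isUniTri_transvection hlt
        (t i * s * ((t i')⁻¹ : Fˣ))).exists_mem_uniGL
      have hmul : monoGL p t * u = x * monoGL p t := by
        apply Units.ext
        rw [Units.val_mul, Units.val_mul, hu', hx', coe_monoGL, ← monoMat_mul_transvection, hi, hi',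
          Equiv.apply_symm_apply, Equiv.apply_symm_apply]
      by_contra hne
      refine hv (charProj_apply_charProj_eq_zero _ π (u := ⟨u, hu⟩) (u' := ⟨x, hx⟩) hmul ?_ v)
      rw [psiHom_apply, psiHom_apply]
      simp only
      rw [hu', hx', hl, psiC_transvection_succ]
      simpa using hne
    by_cases hii : (i : ℕ) + 1 = i'
    · refine ⟨hii, ?_⟩
      obtain ⟨h, e⟩ : ∃ h : (i : ℕ) + 1 < n, i' = ⟨i + 1, h⟩ :=
        ⟨hii ▸ i'.2, Fin.ext hii.symm⟩
      have : (1 : F) = t i * ((t i')⁻¹ : Fˣ) := by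
        refine AddChar.eq_of_forall_apply_mul_eq hφ fun s => ?_
        rw [one_mul, key s, e, psiC_transvection_succ, ← e, Pi.one_apply, one_mul]
        congr 1
        ring
      rw [← Units.val_mul, ← Units.val_one, Units.val_inj] at this
      exact (mul_inv_eq_one.1 this.symm)
    · exfalso
      apply hφ
      ext s
      rw [key s, psiC_transvection_of_ne φ 1 hii, AddChar.one_apply]
  have hs : ∀ (d : ℕ) (j l : Fin n), (j : ℕ) + d = l →
      (j : ℕ) + (p.symm j).rev ≤ l + (p.symm l).rev ∧
      ((j : ℕ) + (p.symm j).rev = l + (p.symm l).rev → t (p.symm j) = t (p.symm l)) := by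
    intro d
    induction d with
    | zero =>
      intro j l h
      obtain rfl : j = l := Fin.ext h
      exact ⟨le_rfl, fun _ => rfl⟩
    | succ d ih =>
      intro j l h
      obtain ⟨h1, h2⟩ := ih j ⟨j + d, by omega⟩ rfl
      set m : Fin n := ⟨j + d, by omega⟩ with hm
      have hm' : (m : ℕ) + 1 = l := by rw [← h, hm, add_assoc]
      have hne : p.symm m ≠ p.symm l := fun e => by
        have := p.symm.injective e
        rw [this] at hm'; omega
      have ha := (p.symm m).2
      have hb := (p.symm l).2
      rcases lt_or_gt_of_ne hne with hlt | hlt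
      · obtain ⟨h3, h4⟩ := adj m l hm' hlt
        rw [← h4]
        have : (m : ℕ) + (p.symm m).rev = l + (p.symm l).rev := by
          rw [Fin.val_rev, Fin.val_rev]; omega
        rw [← this]
        exact ⟨h1, h2⟩
      · have : (m : ℕ) + (p.symm m).rev < l + (p.symm l).rev := by
          have := Fin.lt_def.1 hlt
          rw [Fin.val_rev, Fin.val_rev]; omega
        exact ⟨h1.trans this.le, fun e => absurd e (by omega)⟩
  let σ : Equiv.Perm (Fin n) := p.symm.trans Fin.revPerm
  have hσ : ∀ j, σ j = (p.symm j).rev := fun j => rfl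
  have hmono : Monotone fun j : Fin n => (j : ℕ) + σ j := fun j l hjl =>
    (hs (l - j) j l (by have := Fin.le_def.1 hjl; omega)).1
  have hadd := perm_apply_add_apply_of_monotone σ hmono
  have hinv : ∀ j, σ (σ j) = j := fun j => Fin.ext (by have := hadd j; omega)
  have ht : ∀ j l : Fin n, (j : ℕ) + σ j = l + σ l → t (p.symm j) = t (p.symm l) := by
    intro j l h
    rcases le_total j l with hjl | hjl
    · exact (hs (l - j) j l (by have := Fin.le_def.1 hjl; omega)).2 h
    · exact ((hs (j - l) l j (by have := Fin.le_def.1 hjl; omega)).2 h.symm).symm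
  apply Units.ext
  ext i j
  change antiTranspose (monoMat p t) i j = monoMat p t i j
  rw [antiTranspose_apply, monoMat_apply, monoMat_apply]
  have hiff : i.rev = p j.rev ↔ j = p i := by
    rw [← Equiv.symm_apply_eq, ← Equiv.symm_apply_eq, ← Fin.rev_inj (i := p.symm i.rev),
      Fin.rev_rev, ← hσ, ← Fin.rev_inj (i := p.symm j), ← hσ]
    exact ⟨fun h => by rw [← h, hinv], fun h => by rw [← h, hinv]⟩
  by_cases h : j = p i
  · rw [if_pos (hiff.2 h), if_pos h]
    have hi : p.symm j = i := by rw [h, Equiv.symm_apply_apply]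
    have := ht j (σ j) (hadd j).symm
    rw [hi, hσ, hi, hiff.2 h, Equiv.symm_apply_apply] at this
    rw [this]
  · rw [if_neg (mt hiff.1 h), if_neg h]

/-- Multiplicity one for the character of trivial coefficients. -/
theorem exists_forall_charProj_psiHom_one {V : Type*} [AddCommGroup V] [Module ℂ V]
    [FiniteDimensional ℂ V] (π : Representation ℂ (GL (Fin n) F) V) (hπ : IsIrred π)
    {φ : AddChar F ℂ} (hφ : φ ≠ 1) :
    ∃ v₀, ∀ v, ∃ s : ℂ, charProj (psiHom φ 1) π v = s • v₀ := by
  have hτ : ∀ u ∈ uniGL n F, antiTransposeGL u ∈ uniGL n F := fun u hu =>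
    IsUniTri.antiTranspose hu
  let τU : uniGL n F ≃ uniGL n F :=
    { toFun := fun u => ⟨antiTransposeGL u, hτ u u.2⟩
      invFun := fun u => ⟨antiTransposeGL u, hτ u u.2⟩
      left_inv := fun u => Subtype.ext (antiTransposeGL_antiTransposeGL _)
      right_inv := fun u => Subtype.ext (antiTransposeGL_antiTransposeGL _) }
  have hχ : ∀ u, psiHom φ 1 (τU u) = psiHom φ 1 u := fun u => psiC_antiTranspose φ _
  refine exists_forall_charProj_eq_smul (psiHom φ 1) π hπ antiTransposeGL antiTransposeGL_mul τU
    (fun _ => rfl) hχ fun g v => ?_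
  set e := charProj (psiHom φ 1) π with he
  have hbi : ∀ (u₁ u₂ : uniGL n F) (g : GL (Fin n) F),
      e (π (u₁ * g * u₂) (e v)) = (psiHom φ 1 u₁ * psiHom φ 1 u₂) • e (π g (e v)) := by
    intro u₁ u₂ g
    rw [map_mul, map_mul, Module.End.mul_apply, Module.End.mul_apply, he,
      apply_charProj, map_smul, map_smul, map_smul, charProj_apply, smul_smul, mul_comm]
  have hmono : ∀ p t, e (π (monoGL p t) (e v)) = e (π (antiTransposeGL (monoGL p t)) (e v)) := by
    intro p t
    by_cases h : antiTransposeGL (monoGL p t) = monoGL (F := F) p t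
    · rw [h]
    have h1 : e (π (monoGL p t) (e v)) = 0 := by
      by_contra hne
      exact h (antiTransposeGL_monoGL_of_ne_zero π hφ p t hne)
    rw [h1]
    by_contra hne
    obtain ⟨p', t', e'⟩ : ∃ p' t', antiTransposeGL (monoGL p t) = monoGL (F := F) p' t' := by
      refine ⟨(Fin.revPerm.trans p.symm).trans Fin.revPerm, fun i => t (p.symm i.rev), ?_⟩
      apply Units.ext
      ext i j
      change antiTranspose (monoMat p t) i j = monoMat _ _ i j
      rw [antiTranspose_apply, monoMat_apply, monoMat_apply]
      have : i.rev = p j.rev ↔ j = ((Fin.revPerm.trans p.symm).trans Fin.revPerm) i := by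
        simp only [Equiv.trans_apply, Fin.revPerm_apply]
        rw [← Equiv.symm_apply_eq, ← Fin.rev_inj, Fin.rev_rev, eq_comm]
      by_cases h : i.rev = p j.rev
      · rw [if_pos h, if_pos (this.1 h), h, Equiv.symm_apply_apply]
      · rw [if_neg h, if_neg (mt this.2 h)]
    rw [e'] at hne
    have := antiTransposeGL_monoGL_of_ne_zero π hφ p' t' fun h0 => hne h0.symm
    rw [← e', antiTransposeGL_antiTransposeGL] at this
    exact h this.symm
  obtain ⟨u₁, h₁, u₂, h₂, p, t, hpt⟩ := exists_uniGL_mul_mul_eq_monoGL g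
  have hg : g = u₁⁻¹ * monoGL p t * u₂⁻¹ := by rw [← hpt]; group
  have e1 := hbi (⟨u₁, h₁⟩⁻¹) (⟨u₂, h₂⟩⁻¹) (monoGL p t)
  have e2 := hbi (τU ⟨u₂, h₂⟩⁻¹) (τU ⟨u₁, h₁⟩⁻¹) (antiTransposeGL (monoGL p t))
  rw [hχ, hχ, mul_comm, ← hmono, ← e1] at e2
  have hg' : antiTransposeGL g = (τU ⟨u₂, h₂⟩⁻¹ : uniGL n F) *
      antiTransposeGL (monoGL p t) * (τU ⟨u₁, h₁⟩⁻¹ : uniGL n F) := by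
    rw [hg, antiTransposeGL_mul, antiTransposeGL_mul, mul_assoc]
    rfl
  rw [hg', e2, hg]
  rfl

/-- Uniqueness of Whittaker functionals on irreducible representations. -/
theorem exists_eq_smul_of_whittaker {V : Type*} [AddCommGroup V] [Module ℂ V]
    [FiniteDimensional ℂ V] (π : Representation ℂ (GL (Fin n) F) V) (hπ : IsIrred π)
    {φ : AddChar F ℂ} (hφ : φ ≠ 1) {c : Fin n → F} (hc : ∀ j : Fin n, (j : ℕ) + 1 < n → c j ≠ 0)
    {ℓ₁ ℓ₂ : V →ₗ[ℂ] ℂ} (h₀ : ℓ₁ ≠ 0)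
    (h₁ : ∀ u ∈ uniGL n F, ∀ v, ℓ₁ (π u v) = psiC φ c u.val * ℓ₁ v)
    (h₂ : ∀ u ∈ uniGL n F, ∀ v, ℓ₂ (π u v) = psiC φ c u.val * ℓ₂ v) : ∃ z : ℂ, ℓ₂ = z • ℓ₁ := by
  classical
  let c' : Fin n → Fˣ := fun i => if h : c i = 0 then 1 else Units.mk0 (c i) h
  let t : Fin n → Fˣ := fun j => ∏ i ∈ Finset.Iio j, c' i
  have ht : ∀ (j : Fin n) (h : (j : ℕ) + 1 < n), (t ⟨j + 1, h⟩ : F) = c j * t j := by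
    intro j h
    have : Finset.Iio (⟨j + 1, h⟩ : Fin n) = insert j (Finset.Iio j) := by
      ext i
      simp only [Finset.mem_Iio, Finset.mem_insert, Fin.lt_def, Fin.ext_iff]
      omega
    simp only [t]
    rw [this, Finset.prod_insert (by simp), Units.val_mul]
    congr 1
    simp only [c']
    rw [dif_neg (hc j h), Units.val_mk0]
  set T : GL (Fin n) F := monoGL 1 t with hT
  have hconj : ∀ u : GL (Fin n) F, ∀ i j, (T * u * T⁻¹).val i j = t i * u.val i j * (t j)⁻¹ := by
    intro u i j
    have hTi : (T⁻¹ : GL (Fin n) F).val = monoMat (1 : Equiv.Perm (Fin n)).symm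
      fun j => (t j)⁻¹ := rfl
    rw [Units.val_mul, Units.val_mul, hTi, mul_monoMat_apply, hT, coe_monoGL, monoMat_mul_apply]
    simp
  have hmem : ∀ u ∈ uniGL n F, T * u * T⁻¹ ∈ uniGL n F := by
    intro u hu i j hij
    rw [hconj, hu i j hij]
    split_ifs with h
    · subst h; simp
    · simp
  have hpsi : ∀ u : GL (Fin n) F, psiC φ c (T * u * T⁻¹).val = psiC φ 1 u.val := by
    intro u
    rw [psiC, psiC]
    congr 1
    refine Finset.sum_congr rfl fun j _ => ?_
    split_ifs with h
    · rw [hconj, Units.val_inv_eq_inv_val, ht j h, Pi.one_apply]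
      have := hc j h
      have := (t j).ne_zero
      field_simp
    · rfl
  obtain ⟨v₀, hv₀⟩ := exists_forall_charProj_psiHom_one π hπ hφ
  have hproj : ∀ ℓ : V →ₗ[ℂ] ℂ, (∀ u ∈ uniGL n F, ∀ v, ℓ (π u v) = psiC φ c u.val * ℓ v) →
      ∀ v, (ℓ ∘ₗ π T) (charProj (psiHom φ 1) π v) = ℓ (π T v) := by
    intro ℓ hℓ v
    refine charProj_apply_of_eigen (psiHom φ 1) π (ℓ ∘ₗ π T) v fun u => ?_
    rw [LinearMap.comp_apply, LinearMap.comp_apply, ← Module.End.mul_apply, ← map_mul]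
    have : T * u = T * u * T⁻¹ * T := by group
    rw [this, map_mul, Module.End.mul_apply, hℓ _ (hmem _ u.2), hpsi]
    rfl
  have hv : ∀ w, π T (π T⁻¹ w) = w := by
    intro w
    rw [← Module.End.mul_apply, ← map_mul, mul_inv_cancel, map_one, Module.End.one_apply]
  have hne : ℓ₁ (π T v₀) ≠ 0 := by
    intro h
    apply h₀
    ext w
    obtain ⟨s, hs⟩ := hv₀ (π T⁻¹ w)
    have := hproj ℓ₁ h₁ (π T⁻¹ w)
    rw [hs, hv, LinearMap.comp_apply, map_smul, map_smul, h, smul_zero] at this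
    rw [← this, LinearMap.zero_apply]
  refine ⟨ℓ₂ (π T v₀) / ℓ₁ (π T v₀), ?_⟩
  ext w
  obtain ⟨s, hs⟩ := hv₀ (π T⁻¹ w)
  have e1 := hproj ℓ₁ h₁ (π T⁻¹ w)
  have e2 := hproj ℓ₂ h₂ (π T⁻¹ w)
  rw [hs, hv, LinearMap.comp_apply, map_smul, map_smul] at e1 e2
  rw [← e2, LinearMap.smul_apply, ← e1]
  simp only [smul_eq_mul]
  field_simp

end GelfandGraev

section Columns

variable {n : ℕ} {F : Type} [Field F]

/-- The first `m` columns of `M` agree with those of the identity matrix. -/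
def HasTrivialColumns (m : ℕ) (M : Matrix (Fin n) (Fin n) F) : Prop :=
  ∀ i j : Fin n, (j : ℕ) < m → M i j = if i = j then 1 else 0

/-- The unitriangular matrix whose only nontrivial column is column `m`, given by `x`. -/
def columnMat (m : Fin n) (x : Fin n → F) : Matrix (Fin n) (Fin n) F :=
  1 + Matrix.of fun i j => if j = m then (if i < m then x i else 0) else 0

lemma columnMat_apply (m : Fin n) (x : Fin n → F) (i j : Fin n) :
    columnMat m x i j = (if i = j then 1 else 0) + if j = m then (if i < m then x i else 0) else 0 := by
  rw [columnMat, Matrix.add_apply, Matrix.one_apply, Matrix.of_apply]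

lemma columnMat_mul_apply (m : Fin n) (x : Fin n → F) (M : Matrix (Fin n) (Fin n) F)
    (i j : Fin n) : (columnMat m x * M) i j = M i j + if i < m then x i * M m j else 0 := by
  rw [columnMat, add_mul, one_mul, Matrix.add_apply]
  congr 1
  rw [Matrix.mul_apply]
  simp only [Matrix.of_apply, ite_mul, zero_mul, Finset.sum_ite_eq', Finset.mem_univ, if_true]

lemma mul_columnMat_apply (m : Fin n) (x : Fin n → F) (M : Matrix (Fin n) (Fin n) F)
    (i j : Fin n) : (M * columnMat m x) i j =
      M i j + if j = m then ∑ l, M i l * (if l < m then x l else 0) else 0 := by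
  rw [columnMat, mul_add, mul_one, Matrix.add_apply]
  congr 1
  rw [Matrix.mul_apply]
  split_ifs with h
  · simp [h]
  · simp [h]

lemma columnMat_zero (m : Fin n) : columnMat m (0 : Fin n → F) = 1 := by
  ext i j
  rw [columnMat_apply, Matrix.one_apply]
  simp

lemma columnMat_mul (m : Fin n) (x y : Fin n → F) :
    columnMat m x * columnMat m y = columnMat m (x + y) := by
  ext i j
  rw [columnMat_mul_apply, columnMat_apply, columnMat_apply, columnMat_apply]
  by_cases hi : i < m
  · by_cases hj : j = m
    · simp [hi, hj, add_assoc, add_comm]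
    · simp [hi, hj, Ne.symm hj]
  · simp [hi]

lemma isUniTri_columnMat (m : Fin n) (x : Fin n → F) : IsUniTri (columnMat m x) := by
  intro i j hij
  rw [columnMat_apply, add_eq_left, ite_eq_right_iff]
  rintro rfl
  exact if_neg (not_lt.2 hij)

/-- `columnMat` as an invertible matrix. -/
def columnGL (m : Fin n) (x : Fin n → F) : GL (Fin n) F where
  val := columnMat m x
  inv := columnMat m (-x)
  val_inv := by rw [columnMat_mul, add_neg_cancel, columnMat_zero]
  inv_val := by rw [columnMat_mul, neg_add_cancel, columnMat_zero]

@[simp]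
lemma coe_columnGL (m : Fin n) (x : Fin n → F) : (columnGL m x).val = columnMat m x := rfl

lemma columnGL_mul (m : Fin n) (x y : Fin n → F) :
    columnGL m x * columnGL m y = columnGL m (x + y) := Units.ext (columnMat_mul m x y)

lemma columnGL_zero (m : Fin n) : columnGL m (0 : Fin n → F) = 1 := Units.ext (columnMat_zero m)

lemma columnGL_congr (m : Fin n) {x y : Fin n → F} (h : ∀ i < m, x i = y i) :
    columnGL m x = columnGL m y := by
  apply Units.ext
  ext i j
  rw [coe_columnGL, coe_columnGL, columnMat_apply, columnMat_apply]
  congr 2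
  split_ifs with hi
  · exact h i hi
  · rfl

lemma psiC_columnMat (φ : AddChar F ℂ) (c : Fin n → F) (m l : Fin n) (hl : (l : ℕ) + 1 = m)
    (x : Fin n → F) : psiC φ c (columnMat m x) = φ (c l * x l) := by
  have hlm : l < m := Fin.lt_def.2 (by omega)
  have hl' : (l : ℕ) + 1 < n := hl ▸ m.2
  have hm : (⟨l + 1, hl'⟩ : Fin n) = m := Fin.ext hl
  rw [psiC, Finset.sum_eq_single l]
  · rw [dif_pos hl', columnMat_apply, hm, if_neg hlm.ne, if_pos rfl, if_pos hlm, zero_add]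
  · intro j _ hj
    split_ifs with h
    · rw [columnMat_apply, if_neg (fun e => by simpa using congrArg Fin.val e), if_neg, add_zero,
        mul_zero]
      rw [← hm]
      exact fun e => hj (Fin.ext (by simpa using congrArg Fin.val e))
    · rfl
  · simp

/-- A unitriangular matrix with `m` trivial columns factors through its next column. -/
lemma exists_eq_columnGL_mul {u : GL (Fin n) F} (hu : IsUniTri u.val) (m : Fin n)
    (hm : HasTrivialColumns m u.val) :
    ∃ u' : GL (Fin n) F, IsUniTri u'.val ∧ HasTrivialColumns (m + 1) u'.val ∧
      u = columnGL m (fun i => u.val i m) * u' := by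
  refine ⟨columnGL m (-fun i => u.val i m) * u, ?_, ?_, ?_⟩
  · exact (isUniTri_columnMat m _).mul hu
  · intro i j hj
    rw [Units.val_mul, coe_columnGL, columnMat_mul_apply]
    rcases Nat.lt_succ_iff_lt_or_eq.1 hj with h | h
    · have hmj : m ≠ j := fun e => by simp [e] at h
      rw [hm i j h, hm m j h, if_neg hmj, mul_zero, ite_self, add_zero]
    · obtain rfl : j = m := Fin.ext h
      rw [hu j j le_rfl, if_pos rfl]
      split_ifs with h1 h2 h2
      · exact absurd h1 (h2 ▸ lt_irrefl _)
      · simp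
      · rw [h2, hu j j le_rfl]; simp
      · rw [hu i j (not_lt.1 h1), if_neg h2, add_zero]
  · rw [← mul_assoc, columnGL_mul, add_neg_cancel, columnGL_zero, one_mul]

/-- Conjugation by a matrix with identity rows from `m` on and identity columns after `m`
preserves the unitriangular matrices with trivial columns up to `m`. -/
lemma conj_hasTrivialColumns (m : Fin n) {h u : GL (Fin n) F}
    (hrow : ∀ i j, m ≤ i → h.val i j = if i = j then 1 else 0)
    (hcol : ∀ i j, m < j → h.val i j = if i = j then 1 else 0)
    (hu : IsUniTri u.val) (hm : HasTrivialColumns (m + 1) u.val) :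
    IsUniTri (h⁻¹ * u * h).val ∧ HasTrivialColumns (m + 1) (h⁻¹ * u * h).val ∧
      ∀ (φ : AddChar F ℂ) (c : Fin n → F),
        psiC φ c (h⁻¹ * u * h).val = psiC φ c u.val := by
  have hcols : HasTrivialColumns (m + 1) (h⁻¹ * u * h).val := by
    intro i j hj
    have huh : ∀ i, (u * h).val i j = h.val i j := by
      intro i
      rw [Units.val_mul, Matrix.mul_apply, Finset.sum_eq_single i]
      · by_cases him : (i : ℕ) < m + 1
        · rw [hm i i him, if_pos rfl, one_mul]
        · rw [hu i i le_rfl, if_pos rfl, one_mul]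
      · intro l _ hl
        by_cases hlm : (l : ℕ) < m + 1
        · rw [hm i l hlm, if_neg hl.symm, zero_mul]
        · rw [hrow l j (Fin.le_def.2 (by omega)), if_neg (fun e : l = j => hlm (e ▸ hj)), mul_zero]
      · simp
    rw [mul_assoc, Units.val_mul, Matrix.mul_apply]
    simp only [huh]
    rw [← Matrix.mul_apply, ← Units.val_mul, inv_mul_cancel, Units.val_one, Matrix.one_apply]
  have hlow : ∀ i j, m ≤ i → m < j → (h⁻¹ * u * h).val i j = u.val i j := by
    intro i j hi hj
    have hinv : ∀ l, (h⁻¹).val i l = if i = l then 1 else 0 := by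
      intro l
      rw [← Matrix.one_apply (α := F), ← Units.val_one, ← mul_inv_cancel h, Units.val_mul,
        Matrix.mul_apply]
      simp [hrow i _ hi]
    rw [mul_assoc, Units.val_mul, Matrix.mul_apply]
    simp only [hinv, ite_mul, one_mul, zero_mul, Finset.sum_ite_eq, Finset.mem_univ, if_true]
    rw [Units.val_mul, Matrix.mul_apply]
    simp [hcol _ j hj]
  refine ⟨?_, hcols, ?_⟩
  · intro i j hij
    by_cases hj : (j : ℕ) < m + 1
    · exact hcols i j hj
    · have hj' : m < j := Fin.lt_def.2 (by omega)
      rw [hlow i j (hj'.le.trans hij) hj', hu i j hij]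
  · intro φ c
    rw [psiC, psiC]
    congr 1
    refine Finset.sum_congr rfl fun j _ => ?_
    split_ifs with h'
    · by_cases hj : (j : ℕ) < m
      · rw [hcols _ _ (by simpa using hj), hm _ _ (by simpa using hj)]
      · rw [hlow _ _ (Fin.le_def.2 (by omega)) (Fin.lt_def.2 (by simp; omega))]
    · rfl

end Columns

section Cuspidal

variable {n : ℕ} {F : Type} [Field F] [Fintype F]

lemma AddChar.sum_dotProduct_eq_zero {φ : AddChar F ℂ} (hφ : φ ≠ 1) {x : Fin n → F} (hx : x ≠ 0) :
    ∑ a : Fin n → F, φ (-(a ⬝ᵥ x)) = 0 := by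
  let f : (Fin n → F) →+ F :=
    { toFun := fun a => -(a ⬝ᵥ x)
      map_zero' := by simp
      map_add' := fun a b => by rw [add_dotProduct, neg_add] }
  refine AddChar.sum_eq_zero_of_ne_one (ψ := φ.compAddMonoidHom f) fun h => ?_
  obtain ⟨i, hi⟩ := Function.ne_iff.1 hx
  apply hφ
  ext s
  have := DFunLike.congr_fun h (Pi.single i (-(s / x i)))
  rw [AddChar.one_apply] at this ⊢
  rw [← this]
  have hi' : x i ≠ 0 := hi
  simp only [AddChar.compAddMonoidHom_apply]
  congr 1
  change s = -(Pi.single i (-(s / x i)) ⬝ᵥ x)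
  rw [single_dotProduct]
  field_simp

/-- Lowering by one the number of trivial columns in the equivariance of a vector in a cuspidal
representation. -/
lemma exists_whittaker_vector_step {V : Type*} [AddCommGroup V] [Module ℂ V]
    {ρ : Representation ℂ (GL (Fin n) F) V} (hρ : IsCuspidal ρ) {φ : AddChar F ℂ} (hφ : φ ≠ 1)
    {c : Fin n → F} (hc : ∀ j : Fin n, (j : ℕ) + 1 < n → c j ≠ 0) (m m₁ : Fin n)
    (hm₁ : (m₁ : ℕ) + 1 = m) {v : V} (hv : v ≠ 0)
    (hvψ : ∀ u : GL (Fin n) F, IsUniTri u.val → HasTrivialColumns (m + 1) u.val →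
      ρ u v = psiC φ c u.val • v) :
    ∃ w, w ≠ 0 ∧ ∀ u : GL (Fin n) F, IsUniTri u.val → HasTrivialColumns m u.val →
      ρ u w = psiC φ c u.val • w := by
  have hlt : m₁ < m := Fin.lt_def.2 (by omega)
  have hcm : c m₁ ≠ 0 := hc m₁ (hm₁ ▸ m.2)
  have hCrow : ∀ (x : Fin n → F) (i j : Fin n), m ≤ i →
      (columnGL m x).val i j = if i = j then 1 else 0 := by
    intro x i j hi
    rw [coe_columnGL, columnMat_apply, if_neg (not_lt.2 hi), ite_self, add_zero]
  have hCcol : ∀ (x : Fin n → F) (i j : Fin n), m < j →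
      (columnGL m x).val i j = if i = j then 1 else 0 := by
    intro x i j hj
    rw [coe_columnGL, columnMat_apply, if_neg hj.ne', add_zero]
  let E : (Fin n → F) → V := fun a => ∑ x : Fin n → F, φ (-(a ⬝ᵥ x)) • ρ (columnGL m x) v
  have hE : ∀ a y, ρ (columnGL m y) (E a) = φ (a ⬝ᵥ y) • E a := by
    intro a y
    simp only [E, map_sum, map_smul, Finset.smul_sum]
    refine Fintype.sum_equiv (Equiv.addLeft y) _ _ fun x => ?_
    rw [← Module.End.mul_apply, ← map_mul, columnGL_mul, Equiv.coe_addLeft, smul_smul,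
      ← AddChar.map_add_eq_mul, dotProduct_add]
    congr 2
    ring
  have hEψ : ∀ a (u : GL (Fin n) F), IsUniTri u.val → HasTrivialColumns (m + 1) u.val →
      ρ u (E a) = psiC φ c u.val • E a := by
    intro a u hu hum
    simp only [E, map_sum, map_smul, Finset.smul_sum]
    refine Finset.sum_congr rfl fun x _ => ?_
    obtain ⟨h1, h2, h3⟩ := conj_hasTrivialColumns m (hCrow x) (hCcol x) hu hum
    have : u * columnGL m x = columnGL m x * ((columnGL m x)⁻¹ * u * columnGL m x) := by group
    rw [← Module.End.mul_apply, ← map_mul, this, map_mul, Module.End.mul_apply, hvψ _ h1 h2, h3,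
      map_smul, smul_comm]
  have hsum : ∑ a, E a = ((Fintype.card (Fin n → F) : ℕ) : ℂ) • v := by
    simp only [E]
    rw [Finset.sum_comm, Finset.sum_eq_single 0]
    · simp [columnGL_zero, ← Nat.cast_smul_eq_nsmul ℂ]
    · intro x _ hx
      rw [← Finset.sum_smul, AddChar.sum_dotProduct_eq_zero hφ hx, zero_smul]
    · simp
  obtain ⟨a, ha⟩ : ∃ a, E a ≠ 0 := by
    by_contra! h0
    rw [Finset.sum_eq_zero fun a _ => h0 a] at hsum
    exact (smul_ne_zero (by exact_mod_cast Fintype.card_ne_zero) hv) hsum.symm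
  obtain ⟨b, hb, hbE⟩ : ∃ b : Fin n → F, (∀ i, m ≤ i → b i = 0) ∧
      ∀ y, ρ (columnGL m y) (E a) = φ (b ⬝ᵥ y) • E a := by
    refine ⟨fun i => if i < m then a i else 0, fun i hi => if_neg (not_lt.2 hi), fun y => ?_⟩
    have : columnGL m y = columnGL m fun i => if i < m then y i else 0 :=
      columnGL_congr m fun i hi => (if_pos hi).symm
    rw [this, hE]
    congr 2
    simp [dotProduct]
  obtain ⟨i₀, hi₀⟩ : ∃ i₀, b i₀ ≠ 0 := by
    by_contra! h0
    obtain rfl : b = 0 := funext h0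
    apply ha
    let β : Fin n → Fin 2 := fun i => if i < m then 0 else 1
    have hβ : ∀ i j, (i < m → j < m) → β j ≤ β i := by
      intro i j h
      simp only [β]
      split_ifs with h1 h2
      · exact le_rfl
      · exact Fin.zero_le _
      · exact absurd (h (by assumption)) h1
      · exact le_rfl
    refine hρ 2 le_rfl β (fun i j hij => hβ j i fun h => hij.trans_lt h) ?_ _ fun u hu => ?_
    · intro j
      fin_cases j
      · exact ⟨m₁, if_pos hlt⟩
      · exact ⟨m, if_neg (lt_irrefl m)⟩
    · have hu₁ : IsUniTri u.val := fun i j hij => hu i j (hβ _ _ fun h => hij.trans_lt h)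
      have hu₂ : HasTrivialColumns m u.val := fun i j hj => hu i j (hβ _ _ fun _ => hj)
      obtain ⟨u', h1, h2, h3⟩ := exists_eq_columnGL_mul hu₁ m hu₂
      have hψ : psiC φ c u'.val = 1 := by
        refine psiC_eq_one φ c fun j hj => ?_
        have h4 := congrArg (fun g : GL (Fin n) F => g.val j ⟨j + 1, hj⟩) h3
        simp only [Units.val_mul] at h4
        rw [coe_columnGL, (isUniTri_columnMat m _).mul_apply_succ h1, columnMat_apply,
          if_neg (fun e => by simpa using congrArg Fin.val e), zero_add] at h4
        by_cases hjm : (⟨j + 1, hj⟩ : Fin n) = m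
        · rw [if_pos hjm, if_pos (by rw [← hjm]; exact Fin.lt_def.2 (by simp)), hjm] at h4
          rw [hjm]
          exact left_eq_add.1 h4
        · rw [if_neg hjm, zero_add] at h4
          have : ¬ ((j : ℕ) + 1 = m) := fun e => hjm (Fin.ext e)
          rw [← h4, hu _ _ (hβ _ _ fun h => Fin.lt_def.2 (by
            have := Fin.lt_def.1 h; simp only; omega)),
            if_neg (fun e => by simpa using congrArg Fin.val e)]
      rw [h3, map_mul, Module.End.mul_apply, hEψ a _ h1 h2, hψ, one_smul, hbE, zero_dotProduct,
        AddChar.map_zero_eq_one, one_smul]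
  have hi₀m : i₀ < m := by
    by_contra h
    exact hi₀ (hb i₀ (not_lt.1 h))
  let hM : Matrix (Fin n) (Fin n) F := Matrix.of fun i j =>
    if i = m₁ then b j / c m₁ else if j = Equiv.swap i₀ m₁ i then 1 else 0
  have hmv : ∀ z, (hM *ᵥ z) m₁ = b ⬝ᵥ z / c m₁ := by
    intro z
    simp only [hM, Matrix.mulVec, dotProduct, Matrix.of_apply, if_true, Finset.sum_div]
    exact Finset.sum_congr rfl fun _ _ => by ring
  have hmv' : ∀ z i, i ≠ m₁ → (hM *ᵥ z) i = z (Equiv.swap i₀ m₁ i) := by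
    intro z i hi
    simp [hM, Matrix.mulVec, dotProduct, hi]
  have hunit : IsUnit hM := by
    rw [← Matrix.mulVec_injective_iff_isUnit]
    rw [← Matrix.coe_mulVecLin, ← LinearMap.ker_eq_bot, LinearMap.ker_eq_bot']
    intro z hz
    have hz' : ∀ i, (hM *ᵥ z) i = 0 := fun i => congrFun hz i
    have h1 : ∀ l, l ≠ i₀ → z l = 0 := by
      intro l hl
      have hne : Equiv.swap i₀ m₁ l ≠ m₁ := by
        intro e
        rw [Equiv.swap_apply_eq_iff, Equiv.swap_apply_right] at e
        exact hl e
      have := hmv' z _ hne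
      rwa [hz', Equiv.swap_apply_self, eq_comm] at this
    have h2 := hmv z
    rw [hz', eq_comm, div_eq_zero_iff, or_iff_left hcm, dotProduct, Finset.sum_eq_single i₀] at h2
    · ext l
      by_cases hl : l = i₀
      · rw [hl]; exact (mul_eq_zero.1 h2).resolve_left hi₀
      · exact h1 l hl
    · intro l _ hl
      rw [h1 l hl, mul_zero]
    · simp
  obtain ⟨h, hh⟩ := hunit
  have hrow : ∀ i j, m ≤ i → h.val i j = if i = j then 1 else 0 := by
    intro i j hi
    have h1 : i ≠ i₀ := (hi₀m.trans_le hi).ne'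
    have h2 : i ≠ m₁ := (hlt.trans_le hi).ne'
    rw [hh]
    simp only [hM, Matrix.of_apply]
    rw [if_neg h2, Equiv.swap_apply_of_ne_of_ne h1 h2]
    simp only [eq_comm]
  have hcol : ∀ i j, m ≤ j → h.val i j = if i = j then 1 else 0 := by
    intro i j hj
    have h1 : j ≠ i₀ := (hi₀m.trans_le hj).ne'
    have h2 : j ≠ m₁ := (hlt.trans_le hj).ne'
    rw [hh]
    simp only [hM, Matrix.of_apply]
    by_cases hi : i = m₁
    · rw [if_pos hi, hb j hj, zero_div, if_neg (by rw [hi]; exact h2.symm)]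
    · rw [if_neg hi]
      refine if_congr ?_ rfl rfl
      rw [eq_comm, Equiv.swap_apply_eq_iff, Equiv.swap_apply_of_ne_of_ne h1 h2]
  have hcomm : ∀ y, h * columnGL m y = columnGL m (hM *ᵥ y) * h := by
    intro y
    apply Units.ext
    ext i j
    rw [Units.val_mul, Units.val_mul, coe_columnGL, coe_columnGL, mul_columnMat_apply,
      columnMat_mul_apply]
    congr 1
    by_cases hj : j = m
    · rw [if_pos hj, hj, hrow m m le_rfl, if_pos rfl, mul_one, ← hh, Matrix.mulVec, dotProduct]
      split_ifs with hi
      · refine Finset.sum_congr rfl fun l _ => ?_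
        split_ifs with hl
        · rfl
        · rw [hcol i l (not_lt.1 hl), if_neg (fun e : i = l => hl (e ▸ hi)), zero_mul, zero_mul]
      · refine Finset.sum_eq_zero fun l _ => ?_
        split_ifs with hl
        · rw [hrow i l (not_lt.1 hi), if_neg (fun e : i = l => hi (e ▸ hl)), zero_mul]
        · rw [mul_zero]
    · rw [if_neg hj, hrow m j le_rfl, if_neg (Ne.symm hj), mul_zero, ite_self]
  have hinv : ∀ w, ρ h⁻¹ (ρ h w) = w := by
    intro w
    rw [← Module.End.mul_apply, ← map_mul, inv_mul_cancel, map_one, Module.End.one_apply]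
  refine ⟨ρ h (E a), fun h0 => ha ?_, fun u hu hum => ?_⟩
  · rw [← hinv (E a), h0, map_zero]
  · obtain ⟨u', h1, h2, h3⟩ := exists_eq_columnGL_mul hu m hum
    set x : Fin n → F := fun i => u.val i m
    obtain ⟨h4, h5, h6⟩ := conj_hasTrivialColumns m hrow (fun i j hj => hcol i j hj.le) h1 h2
    have e1 : ρ u' (ρ h (E a)) = psiC φ c u'.val • ρ h (E a) := by
      have : u' * h = h * (h⁻¹ * u' * h) := by group
      rw [← Module.End.mul_apply, ← map_mul, this, map_mul, Module.End.mul_apply,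
        hEψ a _ h4 h5, h6, map_smul]
    have e2 : ρ (columnGL m x) (ρ h (E a)) = φ (c m₁ * x m₁) • ρ h (E a) := by
      have hx : hM *ᵥ ((h⁻¹).val *ᵥ x) = x := by
        rw [← hh, Matrix.mulVec_mulVec, ← Units.val_mul, mul_inv_cancel, Units.val_one,
          Matrix.one_mulVec]
      have h7 := hmv ((h⁻¹).val *ᵥ x)
      rw [hx] at h7
      rw [← Module.End.mul_apply, ← map_mul, ← hx, ← hcomm, map_mul, Module.End.mul_apply, hbE,
        map_smul, hx, h7]
      congr 2
      field_simp
    rw [h3, map_mul, Module.End.mul_apply, e1, map_smul, e2, Units.val_mul,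
      coe_columnGL, psiC_mul φ c (isUniTri_columnMat m x) h1, psiC_columnMat φ c m m₁ hm₁,
      smul_smul, mul_comm]

/-- Cuspidal representations have nonzero Whittaker functionals. -/
theorem exists_whittaker_of_isCuspidal {V : Type*} [AddCommGroup V] [Module ℂ V]
    {ρ : Representation ℂ (GL (Fin n) F) V} (hρ : IsCuspidal ρ) {v₀ : V} (hv₀ : v₀ ≠ 0)
    {φ : AddChar F ℂ} (hφ : φ ≠ 1) {c : Fin n → F}
    (hc : ∀ j : Fin n, (j : ℕ) + 1 < n → c j ≠ 0) :
    ∃ ℓ : V →ₗ[ℂ] ℂ, ℓ ≠ 0 ∧ ∀ u ∈ uniGL n F, ∀ v, ℓ (ρ u v) = psiC φ c u.val * ℓ v := by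
  have hE : ∀ d m : ℕ, m + d = n → ∃ v : V, v ≠ 0 ∧ ∀ u : GL (Fin n) F, IsUniTri u.val →
      HasTrivialColumns m u.val → ρ u v = psiC φ c u.val • v := by
    intro d
    induction d with
    | zero =>
      rintro m hm
      refine ⟨v₀, hv₀, fun u _ hu => ?_⟩
      obtain rfl : u = 1 := by
        ext i j
        rw [hu i j (by have := j.2; omega), Units.val_one, Matrix.one_apply]
      rw [map_one, Units.val_one, psiC_one, one_smul, Module.End.one_apply]
    | succ d ih =>
      intro m hm
      obtain ⟨v, hv, hvψ⟩ := ih (m + 1) (by omega)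
      rcases Nat.eq_zero_or_pos m with rfl | hpos
      · refine ⟨v, hv, fun u hu _ => hvψ u hu fun i j hj => hu i j (Fin.le_def.2 (by omega))⟩
      · exact exists_whittaker_vector_step hρ hφ hc ⟨m, by omega⟩ ⟨m - 1, by omega⟩
          (Nat.sub_add_cancel hpos) hv hvψ
  obtain ⟨v, hv, hvψ⟩ := hE n 0 (zero_add n)
  obtain ⟨f, hf⟩ : ∃ f : Module.Dual ℂ V, f v ≠ 0 := by
    by_contra! h
    exact hv ((Module.forall_dual_apply_eq_zero_iff ℂ v).1 h)
  have hev : charProj (psiHom φ c) ρ v = v := by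
    have := charProj_apply_of_eigen (psiHom φ c) ρ LinearMap.id v fun u =>
      hvψ u u.2 fun i j hj => absurd hj (Nat.not_lt_zero _)
    exact this
  refine ⟨f ∘ₗ charProj (psiHom φ c) ρ, fun h => hf ?_, fun u hu w => ?_⟩
  · have := LinearMap.congr_fun h v
    rwa [LinearMap.comp_apply, hev] at this
  · have := charProj_apply (psiHom φ c) ρ ⟨u, hu⟩ w
    rw [LinearMap.comp_apply, this, map_smul]
    rfl

end Cuspidal

section Induction

variable {G W : Type*} [Group G] [AddCommGroup W] [Module ℂ W] {P : Subgroup G}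

/-- The function model of the representation induced from `σ`. -/
def inducedSpace (σ : Representation ℂ P W) : Submodule ℂ (G → W) where
  carrier := {f | ∀ (p : P) (g : G), f (p * g) = σ p (f g)}
  add_mem' h h' p g := by rw [Pi.add_apply, Pi.add_apply, h, h', map_add]
  zero_mem' p g := by simp
  smul_mem' t f h p g := by rw [Pi.smul_apply, Pi.smul_apply, h, map_smul]

/-- The action by right translation on the induced space. -/
def inducedRep (σ : Representation ℂ P W) : Representation ℂ G (inducedSpace σ) where
  toFun u :=
    { toFun := fun f => ⟨fun x => f.1 (x * u), fun p g => by
          change f.1 (p * g * u) = σ p (f.1 (g * u))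
          rw [mul_assoc, f.2]⟩
      map_add' := fun _ _ => rfl
      map_smul' := fun _ _ => rfl }
  map_one' := LinearMap.ext fun f => Subtype.ext (funext fun x => congrArg f.1 (mul_one x))
  map_mul' u v := LinearMap.ext fun f =>
    Subtype.ext (funext fun x => congrArg f.1 (mul_assoc x u v).symm)

variable (σ : Representation ℂ P W)

lemma inducedRep_apply (u : G) (f : inducedSpace σ) (x : G) :
    (inducedRep σ u f).1 x = f.1 (x * u) := rfl

/-- The function supported on the coset `P g` with value `v` at `g`. -/
noncomputable def cosetDelta (g : G) : W →ₗ[ℂ] inducedSpace σ := by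
  classical
  exact
  { toFun := fun v => ⟨fun x => if h : x * g⁻¹ ∈ P then σ ⟨x * g⁻¹, h⟩ v else 0, fun p x => by
      by_cases h : x * g⁻¹ ∈ P
      · have h' : p * x * g⁻¹ ∈ P := by rw [mul_assoc]; exact P.mul_mem p.2 h
        beta_reduce
        rw [dif_pos h, dif_pos h', ← Module.End.mul_apply, ← map_mul]
        congr 2
        exact Subtype.ext (mul_assoc _ _ _)
      · have h' : p * x * g⁻¹ ∉ P := by
          rwa [mul_assoc, P.mul_mem_cancel_left p.2]
        beta_reduce
        rw [dif_neg h, dif_neg h', map_zero]⟩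
    map_add' := fun v w => by
      refine Subtype.ext (funext fun x => ?_)
      simp only [Submodule.coe_add, Pi.add_apply]
      split_ifs <;> simp
    map_smul' := fun t v => by
      refine Subtype.ext (funext fun x => ?_)
      simp only [Submodule.coe_smul, Pi.smul_apply, RingHom.id_apply]
      split_ifs <;> simp }

lemma cosetDelta_apply_of_mul_eq {g x : G} {p : P} (h : x = p * g) (v : W) :
    (cosetDelta σ g v).1 x = σ p v := by
  have hx : x * g⁻¹ = p := by rw [h, mul_inv_cancel_right]
  have hp : x * g⁻¹ ∈ P := hx ▸ p.2
  refine (dif_pos hp).trans ?_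
  congr 2
  exact Subtype.ext hx

lemma cosetDelta_apply_of_notMem {g x : G} (h : x * g⁻¹ ∉ P) (v : W) :
    (cosetDelta σ g v).1 x = 0 := dif_neg h

lemma cosetDelta_mul (p : P) (g : G) (v : W) : cosetDelta σ (p * g) (σ p v) = cosetDelta σ g v := by
  refine Subtype.ext (funext fun x => ?_)
  by_cases h : x * g⁻¹ ∈ P
  · rw [cosetDelta_apply_of_mul_eq σ (p := ⟨x * g⁻¹, h⟩ * p⁻¹) (by simp [mul_assoc]),
      cosetDelta_apply_of_mul_eq σ (p := ⟨x * g⁻¹, h⟩) (by simp),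
      ← Module.End.mul_apply, ← map_mul, inv_mul_cancel_right]
  · rw [cosetDelta_apply_of_notMem σ h, cosetDelta_apply_of_notMem σ]
    rwa [_root_.mul_inv_rev, ← mul_assoc, P.mul_mem_cancel_right (P.inv_mem p.2)]

lemma inducedRep_cosetDelta (u g : G) (v : W) :
    inducedRep σ u (cosetDelta σ (g * u) v) = cosetDelta σ g v := by
  refine Subtype.ext (funext fun x => ?_)
  rw [inducedRep_apply]
  by_cases h : x * g⁻¹ ∈ P
  · rw [cosetDelta_apply_of_mul_eq σ (p := ⟨x * g⁻¹, h⟩) (by simp),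
      cosetDelta_apply_of_mul_eq σ (p := ⟨x * g⁻¹, h⟩) (by simp [mul_assoc])]
  · rw [cosetDelta_apply_of_notMem σ h, cosetDelta_apply_of_notMem σ]
    rwa [_root_.mul_inv_rev, ← mul_assoc, mul_inv_cancel_right]

lemma sum_cosetDelta [Fintype G] [Fintype P] (f : inducedSpace σ) :
    ∑ g, cosetDelta σ g (f.1 g) = (Fintype.card P : ℂ) • f := by
  classical
  refine Subtype.ext (funext fun x => ?_)
  rw [Submodule.coe_sum, Finset.sum_apply, Submodule.coe_smul, Pi.smul_apply]
  rw [← Equiv.sum_comp ((Equiv.inv G).trans (Equiv.mulRight x))]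
  have : ∀ g : G, (cosetDelta σ (g⁻¹ * x) (f.1 (g⁻¹ * x))).1 x = if g ∈ P then f.1 x else 0 := by
    intro g
    split_ifs with h
    · rw [cosetDelta_apply_of_mul_eq σ (p := ⟨g, h⟩) (by simp), ← f.2]
      simp
    · exact cosetDelta_apply_of_notMem σ (by simpa using h) _
  simp only [Equiv.trans_apply, Equiv.inv_apply, Equiv.coe_mulRight, this]
  rw [← Finset.sum_filter, Finset.sum_const, ← Nat.cast_smul_eq_nsmul ℂ, Fintype.card_subtype]

variable {U : Subgroup G} (χ : U →* ℂ)

lemma equivariant_apply_cosetDelta {ℓ : inducedSpace σ →ₗ[ℂ] ℂ}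
    (hℓ : ∀ (u : U) f, ℓ (inducedRep σ u f) = χ u * ℓ f) {p : P} {u : U} {g : G}
    (h : p * g = g * u) (v : W) :
    ℓ (cosetDelta σ g (σ p v)) = χ u * ℓ (cosetDelta σ g v) := by
  rw [← cosetDelta_mul σ p g v, h, ← hℓ, inducedRep_cosetDelta]

/-- An equivariant functional on an induced representation vanishes if it vanishes on the only
relevant double coset. -/
lemma equivariant_eq_zero [Finite G] (w : G)
    (hw : ∀ g, (∃ (p : P) (u : U), g = p * w * u) ∨
      ∃ (p : P) (u : U), p * g = g * u ∧ σ p = 1 ∧ χ u ≠ 1)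
    {ℓ : inducedSpace σ →ₗ[ℂ] ℂ} (hℓ : ∀ (u : U) f, ℓ (inducedRep σ u f) = χ u * ℓ f)
    (h0 : ∀ v, ℓ (cosetDelta σ w v) = 0) : ℓ = 0 := by
  let := Fintype.ofFinite G
  let := Fintype.ofFinite P
  have key : ∀ g v, ℓ (cosetDelta σ g v) = 0 := by
    intro g v
    rcases hw g with ⟨p, u, rfl⟩ | ⟨p, u, h, hσ, hχ⟩
    · have h1 : ℓ (cosetDelta σ (p * w) v) = 0 := by
        have := cosetDelta_mul σ p w (σ p⁻¹ v)
        rw [← Module.End.mul_apply, ← map_mul, mul_inv_cancel, map_one,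
          Module.End.one_apply] at this
        rw [this, h0]
      have h2 := hℓ u (cosetDelta σ (p * w * u) v)
      rw [inducedRep_cosetDelta, h1, eq_comm, mul_eq_zero] at h2
      refine h2.resolve_left fun h3 => ?_
      simpa [h3] using monoidHom_inv_mul_self χ u
    · have := equivariant_apply_cosetDelta σ χ hℓ h v
      rw [hσ, Module.End.one_apply] at this
      by_contra hne
      exact hχ (mul_eq_right₀ hne |>.1 this.symm)
  ext f
  have h1 := congrArg ℓ (sum_cosetDelta σ f)
  rw [map_sum, Finset.sum_eq_zero fun g _ => key g _, map_smul, eq_comm, smul_eq_zero] at h1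
  exact h1.resolve_left (by exact_mod_cast Fintype.card_ne_zero)

/-- Mackey theory for equivariant functionals when a single double coset contributes. -/
theorem exists_equivariant_unique [Finite G] (w : G)
    (hw : ∀ g, (∃ (p : P) (u : U), g = p * w * u) ∨
      ∃ (p : P) (u : U), p * g = g * u ∧ σ p = 1 ∧ χ u ≠ 1)
    (L : W →ₗ[ℂ] ℂ) (hL0 : L ≠ 0)
    (hL : ∀ (p : P) (u : U), (p : G) * w = w * u → ∀ v, L (σ p v) = χ u * L v)
    (huniq : ∀ M : W →ₗ[ℂ] ℂ,
      (∀ (p : P) (u : U), (p : G) * w = w * u → ∀ v, M (σ p v) = χ u * M v) → ∃ z : ℂ, M = z • L) :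
    ∃ ℓ₀ : inducedSpace σ →ₗ[ℂ] ℂ, ℓ₀ ≠ 0 ∧
      (∀ (u : U) f, ℓ₀ (inducedRep σ u f) = χ u * ℓ₀ f) ∧
      ∀ ℓ : inducedSpace σ →ₗ[ℂ] ℂ, (∀ (u : U) f, ℓ (inducedRep σ u f) = χ u * ℓ f) →
        ∃ z : ℂ, ℓ = z • ℓ₀ := by
  classical
  let := Fintype.ofFinite U
  obtain ⟨v₁, hv₁⟩ : ∃ v, L v ≠ 0 := by
    by_contra! h
    exact hL0 (LinearMap.ext h)
  let ev : inducedSpace σ →ₗ[ℂ] ℂ := L ∘ₗ LinearMap.proj w ∘ₗ (inducedSpace σ).subtype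
  have hev : ∀ f, ev f = L (f.1 w) := fun f => rfl
  let ℓ₀ : inducedSpace σ →ₗ[ℂ] ℂ := ev ∘ₗ charProj χ (inducedRep σ)
  have hℓ₀ : ∀ (u : U) f, ℓ₀ (inducedRep σ u f) = χ u * ℓ₀ f := by
    intro u f
    simp only [ℓ₀, LinearMap.comp_apply, charProj_apply, map_smul, smul_eq_mul]
  have hval : ∃ N : ℕ, N ≠ 0 ∧ ℓ₀ (cosetDelta σ w v₁) = (Fintype.card U : ℂ)⁻¹ * (N * L v₁) := by
    refine ⟨(Finset.univ.filter fun u : U => w * u * w⁻¹ ∈ P).card, ?_, ?_⟩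
    · rw [Finset.card_ne_zero]
      exact ⟨1, by simp⟩
    · simp only [ℓ₀, LinearMap.comp_apply]
      rw [charProj_eq_sum, map_smul, map_sum, smul_eq_mul, ← nsmul_eq_mul, ← Finset.sum_const,
        Finset.sum_filter]
      congr 1
      refine Finset.sum_congr rfl fun u _ => ?_
      rw [map_smul, hev, inducedRep_apply]
      split_ifs with h
      · rw [cosetDelta_apply_of_mul_eq σ (p := ⟨_, h⟩) (by simp), hL ⟨_, h⟩ u (by simp),
          smul_eq_mul, ← mul_assoc, monoidHom_inv_mul_self, one_mul]
      · rw [cosetDelta_apply_of_notMem σ h, map_zero, smul_zero]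
  have hne : ℓ₀ (cosetDelta σ w v₁) ≠ 0 := by
    obtain ⟨N, hN, h⟩ := hval
    rw [h]
    exact mul_ne_zero (inv_ne_zero (by exact_mod_cast Fintype.card_ne_zero))
      (mul_ne_zero (by exact_mod_cast hN) hv₁)
  have hrestr : ∀ ℓ : inducedSpace σ →ₗ[ℂ] ℂ, (∀ (u : U) f, ℓ (inducedRep σ u f) = χ u * ℓ f) →
      ∃ z : ℂ, ∀ v, ℓ (cosetDelta σ w v) = z * L v := by
    intro ℓ hℓ
    obtain ⟨z, hz⟩ := huniq (ℓ ∘ₗ cosetDelta σ w) fun p u h v =>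
      equivariant_apply_cosetDelta σ χ hℓ h v
    exact ⟨z, fun v => LinearMap.congr_fun hz v⟩
  refine ⟨ℓ₀, fun h => hne (by rw [h, LinearMap.zero_apply]), hℓ₀, fun ℓ hℓ => ?_⟩
  obtain ⟨z₀, hz₀⟩ := hrestr ℓ₀ hℓ₀
  obtain ⟨z, hz⟩ := hrestr ℓ hℓ
  have hz₀' : z₀ ≠ 0 := by
    rintro rfl
    exact hne (by rw [hz₀, zero_mul])
  refine ⟨z / z₀, sub_eq_zero.1 (equivariant_eq_zero σ χ w hw (fun u f => ?_) fun v => ?_)⟩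
  · simp only [LinearMap.sub_apply, LinearMap.smul_apply, hℓ, hℓ₀, smul_eq_mul]
    ring
  · simp only [LinearMap.sub_apply, LinearMap.smul_apply, hz, hz₀, smul_eq_mul]
    field_simp
    ring

end Induction

section BlockIndices

variable {k r : ℕ}

lemma emb_eq_finProdFinEquiv (i : Fin k) (a : Fin r) : emb i a = finProdFinEquiv (i, a) :=
  Fin.ext (by simp [emb, add_comm, mul_comm])

lemma emb_inj {i j : Fin k} {a b : Fin r} : emb i a = emb j b ↔ i = j ∧ a = b := by
  rw [emb_eq_finProdFinEquiv, emb_eq_finProdFinEquiv, finProdFinEquiv.apply_eq_iff_eq,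
    Prod.mk.injEq]

/-- The block containing an index. -/
def blockOf (x : Fin (k * r)) : Fin k := (finProdFinEquiv.symm x).1

lemma blockOf_emb (i : Fin k) (a : Fin r) : blockOf (emb i a) = i := by
  rw [blockOf, emb_eq_finProdFinEquiv, Equiv.symm_apply_apply]

lemma exists_emb_eq (x : Fin (k * r)) : ∃ a, emb (blockOf x) a = x :=
  ⟨(finProdFinEquiv.symm x).2, by
    rw [emb_eq_finProdFinEquiv]
    exact finProdFinEquiv.apply_symm_apply x⟩

lemma sum_emb {M : Type*} [AddCommMonoid M] (f : Fin (k * r) → M) :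
    ∑ x, f x = ∑ i, ∑ a, f (emb i a) := by
  rw [← finProdFinEquiv.sum_comp, Fintype.sum_prod_type]
  simp only [emb_eq_finProdFinEquiv]

lemma emb_lt_emb {i j : Fin k} (h : i < j) (a b : Fin r) : emb i a < emb j b := by
  rw [Fin.lt_def]
  have ha := a.2
  have : (i : ℕ) + 1 ≤ j := h
  calc (i : ℕ) * r + a < (i + 1) * r := by nlinarith
    _ ≤ j * r := Nat.mul_le_mul_right r this
    _ ≤ j * r + b := Nat.le_add_right _ _

lemma emb_le_emb_iff (i : Fin k) {a b : Fin r} : emb i a ≤ emb i b ↔ a ≤ b := by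
  rw [Fin.le_def, Fin.le_def]
  exact Nat.add_le_add_iff_left

lemma monotone_blockOf : Monotone (blockOf : Fin (k * r) → Fin k) := by
  intro x y hxy
  obtain ⟨a, ha⟩ := exists_emb_eq x
  obtain ⟨b, hb⟩ := exists_emb_eq y
  by_contra! h
  have := emb_lt_emb h b a
  rw [ha, hb] at this
  exact absurd hxy (not_le.2 this)

/-- The permutation reversing the order of the blocks. -/
def blockRev (k r : ℕ) : Equiv.Perm (Fin (k * r)) :=
  (finProdFinEquiv.symm.trans (Equiv.prodCongr Fin.revPerm (Equiv.refl _))).trans finProdFinEquiv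

lemma blockRev_emb (i : Fin k) (a : Fin r) : blockRev k r (emb i a) = emb i.rev a := by
  simp [blockRev, emb_eq_finProdFinEquiv]

lemma blockOf_blockRev (x : Fin (k * r)) : blockOf (blockRev k r x) = (blockOf x).rev := by
  obtain ⟨a, ha⟩ := exists_emb_eq x
  rw [← ha, blockRev_emb, blockOf_emb, blockOf_emb]

lemma blockRev_blockRev (x : Fin (k * r)) : blockRev k r (blockRev k r x) = x := by
  obtain ⟨a, ha⟩ := exists_emb_eq x
  rw [← ha, blockRev_emb, blockRev_emb, Fin.rev_rev]

lemma blockRev_symm : (blockRev k r).symm = blockRev k r :=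
  Equiv.ext fun x => (Equiv.symm_apply_eq _).2 (blockRev_blockRev x).symm

end BlockIndices

section Parabolic

variable {k r : ℕ} {F : Type} [Field F]

lemma IsParab.one : IsParab (1 : Matrix (Fin (k * r)) (Fin (k * r)) F) := fun _ _ _ _ h =>
  Matrix.one_apply_ne fun e => h.ne' (emb_inj.1 e).1

lemma IsParab.mul {M N : Matrix (Fin (k * r)) (Fin (k * r)) F} (hM : IsParab M)
    (hN : IsParab N) : IsParab (M * N) := by
  intro i j a b h
  rw [Matrix.mul_apply, sum_emb]
  refine Finset.sum_eq_zero fun l _ => Finset.sum_eq_zero fun e _ => ?_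
  rcases lt_or_ge l i with hl | hl
  · rw [hM _ _ _ _ hl, zero_mul]
  · rw [hN _ _ _ _ (h.trans_le hl), mul_zero]

lemma IsParab.submatrix_mul {M N : Matrix (Fin (k * r)) (Fin (k * r)) F} (hM : IsParab M)
    (hN : IsParab N) (i : Fin k) :
    (M * N).submatrix (emb i) (emb i) =
      M.submatrix (emb i) (emb i) * N.submatrix (emb i) (emb i) := by
  ext a b
  rw [Matrix.submatrix_apply, Matrix.mul_apply, Matrix.mul_apply, sum_emb,
    Finset.sum_eq_single i]
  · rfl
  · intro l _ hl
    refine Finset.sum_eq_zero fun e _ => ?_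
    rcases lt_or_gt_of_ne hl with h | h
    · rw [hM _ _ _ _ h, zero_mul]
    · rw [hN _ _ _ _ h, mul_zero]
  · exact fun h => absurd (Finset.mem_univ _) h

lemma submatrix_one_emb (i : Fin k) :
    (1 : Matrix (Fin (k * r)) (Fin (k * r)) F).submatrix (emb i) (emb i) = 1 :=
  Matrix.submatrix_one _ fun _ _ h => (emb_inj.1 h).2

lemma IsUniTri.isParab {M : Matrix (Fin (k * r)) (Fin (k * r)) F} (hM : IsUniTri M) :
    IsParab M := fun i j a b h => by
  have := emb_lt_emb h b a
  rw [hM _ _ this.le, if_neg this.ne']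

lemma isParab_transvection {x y : Fin (k * r)} (h : blockOf x < blockOf y) (s : F) :
    IsParab (Matrix.transvection x y s) := by
  intro i j a b hij
  rw [Matrix.transvection, Matrix.add_apply, Matrix.one_apply_ne (fun e => hij.ne' (emb_inj.1 e).1),
    Matrix.single_apply_of_ne, add_zero]
  rintro ⟨rfl, rfl⟩
  rw [blockOf_emb, blockOf_emb] at h
  exact h.not_gt hij

lemma submatrix_transvection {x y : Fin (k * r)} (h : blockOf x ≠ blockOf y) (s : F)
    (i : Fin k) : (Matrix.transvection x y s).submatrix (emb i) (emb i) = 1 := by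
  ext a b
  rw [← submatrix_one_emb (F := F) i, Matrix.submatrix_apply, Matrix.submatrix_apply,
    Matrix.transvection, Matrix.add_apply, Matrix.single_apply_of_ne, add_zero]
  rintro ⟨rfl, rfl⟩
  rw [blockOf_emb, blockOf_emb] at h
  exact h rfl

variable [Fintype F]

variable (F k r) in
/-- The block upper triangular parabolic subgroup. -/
def parabGL : Subgroup (GL (Fin (k * r)) F) where
  carrier := {u | IsParab u.val}
  one_mem' := IsParab.one
  mul_mem' h h' := IsParab.mul h h'
  inv_mem' h := inv_mem_of_finite_s14 (fun u : GL (Fin (k * r)) F => IsParab u.val) IsParab.one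
    (fun _ _ h h' => IsParab.mul h h') h

/-- The projection of the parabolic onto the `i`-th block of its Levi factor. -/
def levi (i : Fin k) : parabGL k r F →* GL (Fin r) F where
  toFun p :=
    { val := (p : GL (Fin (k * r)) F).val.submatrix (emb i) (emb i)
      inv := (p⁻¹ : GL (Fin (k * r)) F).val.submatrix (emb i) (emb i)
      val_inv := by
        refine (IsParab.submatrix_mul p.2 (p⁻¹).2 i).symm.trans ?_
        rw [← submatrix_one_emb (F := F) i]
        exact congrArg (fun M => M.submatrix (emb i) (emb i)) p.1.mul_inv
      inv_val := by
        refine (IsParab.submatrix_mul (p⁻¹).2 p.2 i).symm.trans ?_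
        rw [← submatrix_one_emb (F := F) i]
        exact congrArg (fun M => M.submatrix (emb i) (emb i)) p.1.inv_mul }
  map_one' := Units.ext (submatrix_one_emb i)
  map_mul' p q := Units.ext (IsParab.submatrix_mul p.2 q.2 i)

lemma levi_apply (i : Fin k) (p : parabGL k r F) (a b : Fin r) :
    (levi i p).val a b = (p : GL (Fin (k * r)) F).val (emb i a) (emb i b) := rfl

variable {V : Type} [AddCommGroup V] [Module ℂ V]

/-- The inflation to the parabolic of the `k`-th outer tensor power of `ρ`. -/
noncomputable def inflation (k : ℕ) (ρ : Representation ℂ (GL (Fin r) F) V) :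
    Representation ℂ (parabGL k r F) (PiTensorProduct ℂ (fun _ : Fin k => V)) :=
  PiTensorProduct.mapMonoidHom.comp (MonoidHom.pi fun i => ρ.comp (levi i))

lemma inflation_apply (ρ : Representation ℂ (GL (Fin r) F) V) (p : parabGL k r F) :
    inflation k ρ p = PiTensorProduct.map fun i => ρ (levi i p) := rfl

lemma inflation_eq_one (ρ : Representation ℂ (GL (Fin r) F) V) {p : parabGL k r F}
    (h : ∀ i, levi i p = 1) : inflation k ρ p = 1 := by
  rw [inflation_apply]
  simp only [h, map_one, PiTensorProduct.map_one]

lemma indSpace_eq_inducedSpace (ρ : Representation ℂ (GL (Fin r) F) V) :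
    IndSpace F r k V ρ = inducedSpace (inflation k ρ) := by
  ext f
  constructor
  · exact fun h p g => h p p.2 (fun i => levi i p) (fun i a b => rfl) g
  · intro h p hp d hd g
    have : d = fun i => levi i ⟨p, hp⟩ := funext fun i => Units.ext (Matrix.ext (hd i))
    rw [this]
    exact h ⟨p, hp⟩ g

end Parabolic

section TensorFunctionals

variable {ι V : Type*} [Fintype ι] [AddCommGroup V] [Module ℂ V]

/-- The product of linear functionals as a functional on the tensor power. -/
noncomputable def tensorFunctional (L : ι → V →ₗ[ℂ] ℂ) :
    PiTensorProduct ℂ (fun _ : ι => V) →ₗ[ℂ] ℂ :=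
  PiTensorProduct.lift ((MultilinearMap.mkPiAlgebra ℂ ι ℂ).compLinearMap L)

lemma tensorFunctional_tprod (L : ι → V →ₗ[ℂ] ℂ) (v : ι → V) :
    tensorFunctional L (PiTensorProduct.tprod ℂ v) = ∏ i, L i (v i) := by
  rw [tensorFunctional, PiTensorProduct.lift.tprod]
  rfl

lemma eq_smul_tensorFunctional [DecidableEq ι] (L : ι → V →ₗ[ℂ] ℂ) (y : ι → V)
    (M : PiTensorProduct ℂ (fun _ : ι => V) →ₗ[ℂ] ℂ)
    (hM : ∀ v i, M (PiTensorProduct.tprod ℂ v) =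
      L i (v i) * M (PiTensorProduct.tprod ℂ (Function.update v i (y i)))) :
    M = M (PiTensorProduct.tprod ℂ y) • tensorFunctional L := by
  have key : ∀ (v : ι → V) (s : Finset ι), M (PiTensorProduct.tprod ℂ v) =
      (∏ i ∈ s, L i (v i)) * M (PiTensorProduct.tprod ℂ (s.piecewise y v)) := by
    intro v s
    induction s using Finset.induction_on with
    | empty => simp
    | insert j s hj ih =>
      rw [ih, hM (s.piecewise y v) j, Finset.piecewise_eq_of_notMem _ _ _ hj,
        Finset.prod_insert hj, Finset.piecewise_insert]
      ring
  refine PiTensorProduct.ext (MultilinearMap.ext fun v => ?_)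
  rw [LinearMap.compMultilinearMap_apply, LinearMap.compMultilinearMap_apply, key v Finset.univ,
    Finset.piecewise_univ, LinearMap.smul_apply, tensorFunctional_tprod, smul_eq_mul, mul_comm]

end TensorFunctionals

lemma AddChar.apply_sum {A M ι : Type*} [AddCommMonoid A] [CommMonoid M] (φ : AddChar A M)
    (s : Finset ι) (f : ι → A) : φ (∑ i ∈ s, f i) = ∏ i ∈ s, φ (f i) :=
  map_prod φ.toMonoidHom (fun i => Multiplicative.ofAdd (f i)) s

section RelevantCoset

variable {k r : ℕ} {F : Type} [Field F] [Fintype F]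

/-- The block antidiagonal permutation matrix. -/
def blockAntidiag (k r : ℕ) (F : Type) [Field F] : GL (Fin (k * r)) F := monoGL (blockRev k r) 1

omit [Fintype F] in
lemma mul_blockAntidiag_eq_iff {p u : GL (Fin (k * r)) F} :
    p * blockAntidiag k r F = blockAntidiag k r F * u ↔
      ∀ x y, p.val x y = u.val (blockRev k r x) (blockRev k r y) := by
  rw [Units.ext_iff, ← Matrix.ext_iff]
  simp only [blockAntidiag, Units.val_mul, coe_monoGL, monoMat_mul_apply, mul_monoMat_apply,
    blockRev_symm, Pi.one_apply, Units.val_one, mul_one, one_mul]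
  constructor
  · intro h x y
    have := h x (blockRev k r y)
    rwa [blockRev_blockRev] at this
  · intro h x y
    rw [h, blockRev_blockRev]

lemma levi_mem_uniGL {p : parabGL k r F} {u : GL (Fin (k * r)) F} (hu : IsUniTri u.val)
    (h : ∀ x y, p.1.val x y = u.val (blockRev k r x) (blockRev k r y)) (i : Fin k) :
    levi i p ∈ uniGL r F := by
  intro a b hab
  rw [levi_apply, h, blockRev_emb, blockRev_emb, hu _ _ ((emb_le_emb_iff _).2 hab)]
  simp only [emb_inj, true_and]

lemma exists_emb_eq_succ (i : Fin k) (a : Fin r) (ha : ¬ (a : ℕ) + 1 < r)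
    (h : (emb i a : ℕ) + 1 < k * r) : ∃ l b, i < l ∧ (⟨emb i a + 1, h⟩ : Fin (k * r)) = emb l b := by
  obtain ⟨b, hb⟩ := exists_emb_eq (⟨emb i a + 1, h⟩ : Fin (k * r))
  have hle : blockOf (emb i a) ≤ blockOf (⟨emb i a + 1, h⟩ : Fin (k * r)) :=
    monotone_blockOf (Nat.le_succ _)
  rw [blockOf_emb] at hle
  refine ⟨_, b, lt_of_le_of_ne hle fun e => ?_, hb.symm⟩
  rw [← e] at hb
  have hb' : (i : ℕ) * r + b = i * r + a + 1 := congrArg Fin.val hb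
  have := b.2
  omega

lemma psiC_eq_prod_levi (φ : AddChar F ℂ) (c : Fin (k * r) → F) {p : parabGL k r F}
    {u : GL (Fin (k * r)) F}
    (h : ∀ x y, p.1.val x y = u.val (blockRev k r x) (blockRev k r y)) :
    psiC φ c u.val = ∏ i, psiC φ (fun a => c (emb i.rev a)) (levi i p).val := by
  simp only [psiC]
  rw [← AddChar.apply_sum, sum_emb,
    ← Equiv.sum_comp (Fin.revPerm : Equiv.Perm (Fin k))]
  congr 1
  refine Finset.sum_congr rfl fun i _ => Finset.sum_congr rfl fun a _ => ?_
  rw [Fin.revPerm_apply]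
  by_cases ha : (a : ℕ) + 1 < r
  · rw [dif_pos ha, dif_pos (show (emb i.rev a : ℕ) + 1 < k * r from
      (emb i.rev (⟨a + 1, ha⟩ : Fin r)).2), levi_apply, h, blockRev_emb, blockRev_emb]
    rfl
  · rw [dif_neg ha]
    split_ifs with h'
    · obtain ⟨l, b, hl, hb⟩ := exists_emb_eq_succ i.rev a ha h'
      have h0 := h (emb i a) (emb l.rev b)
      rw [blockRev_emb, blockRev_emb, Fin.rev_rev,
        p.2 _ _ _ _ (Fin.rev_lt_iff.1 hl)] at h0
      rw [hb, ← h0, mul_zero]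
    · rfl

/-- The block diagonal matrix with given diagonal blocks. -/
def blockDiagMat (d : Fin k → GL (Fin r) F) : Matrix (Fin (k * r)) (Fin (k * r)) F :=
  (Matrix.blockDiagonal fun i => (d i).val).submatrix
    (fun x => ((finProdFinEquiv.symm x).2, (finProdFinEquiv.symm x).1))
    (fun x => ((finProdFinEquiv.symm x).2, (finProdFinEquiv.symm x).1))

omit [Fintype F] in
lemma blockDiagMat_emb (d : Fin k → GL (Fin r) F) (i j : Fin k) (a b : Fin r) :
    blockDiagMat d (emb i a) (emb j b) = if i = j then (d i).val a b else 0 := by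
  simp only [blockDiagMat, Matrix.submatrix_apply, Matrix.blockDiagonal_apply,
    emb_eq_finProdFinEquiv, Equiv.symm_apply_apply]

lemma isUniTri_blockDiagMat {d : Fin k → GL (Fin r) F} (hd : ∀ i, d i ∈ uniGL r F) :
    IsUniTri (blockDiagMat d) := by
  intro x y hxy
  obtain ⟨a, ha⟩ := exists_emb_eq x
  obtain ⟨b, hb⟩ := exists_emb_eq y
  have hle := monotone_blockOf hxy
  rw [← ha, ← hb] at hxy ⊢
  generalize blockOf x = i at *
  generalize blockOf y = j at *
  rw [blockDiagMat_emb]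
  by_cases hij : i = j
  · subst hij
    rw [if_pos rfl, hd i a b ((emb_le_emb_iff _).1 hxy)]
    simp only [emb_inj, true_and]
  · rw [if_neg hij, if_neg fun e => hij (emb_inj.1 e).1]

lemma exists_levi_eq {d : Fin k → GL (Fin r) F} (hd : ∀ i, d i ∈ uniGL r F) :
    ∃ (p : parabGL k r F) (u : uniGL (k * r) F),
      (∀ x y, p.1.val x y = u.1.val (blockRev k r x) (blockRev k r y)) ∧ ∀ i, levi i p = d i := by
  obtain ⟨p, hp, hpv⟩ := (isUniTri_blockDiagMat hd).exists_mem_uniGL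
  obtain ⟨u, hu, huv⟩ := (isUniTri_blockDiagMat fun i => hd (Fin.rev i)).exists_mem_uniGL
  refine ⟨⟨p, IsUniTri.isParab hp⟩, ⟨u, hu⟩, fun x y => ?_, fun i => Units.ext ?_⟩
  · obtain ⟨a, ha⟩ := exists_emb_eq x
    obtain ⟨b, hb⟩ := exists_emb_eq y
    rw [← ha, ← hb]
    simp only [hpv, huv, blockRev_emb, blockDiagMat_emb, Fin.rev_inj, Fin.rev_rev]
  · ext a b
    rw [levi_apply]
    simp only [hpv, blockDiagMat_emb, if_true]

/-- Every double coset other than the one of the block antidiagonal matrix is irrelevant for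
Whittaker functionals. -/
theorem mem_relevant_coset_or {V : Type} [AddCommGroup V] [Module ℂ V]
    (ρ : Representation ℂ (GL (Fin r) F) V) {φ : AddChar F ℂ} (hφ : φ ≠ 1) {c : Fin (k * r) → F}
    (hc : ∀ j : Fin (k * r), (j : ℕ) + 1 < k * r → c j ≠ 0) (g : GL (Fin (k * r)) F) :
    (∃ (p : parabGL k r F) (u : uniGL (k * r) F), g = p * blockAntidiag k r F * u) ∨
      ∃ (p : parabGL k r F) (u : uniGL (k * r) F),
        p * g = g * u ∧ inflation k ρ p = 1 ∧ psiHom φ c u ≠ 1 := by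
  obtain ⟨u₁, hu₁, u₂, hu₂, p, t, hg⟩ := exists_uniGL_mul_mul_eq_monoGL g
  by_cases hdesc : ∀ (j : Fin (k * r)) (h : (j : ℕ) + 1 < k * r),
      blockOf (p.symm ⟨j + 1, h⟩) ≤ blockOf (p.symm j)
  · left
    have hanti : Antitone (blockOf ∘ p.symm : Fin (k * r) → Fin k) := by
      have : ∀ (d : ℕ) (x y : Fin (k * r)), (x : ℕ) + d = y →
          blockOf (p.symm y) ≤ blockOf (p.symm x) := by
        intro d
        induction d with
        | zero =>
          intro x y h
          rw [Fin.ext h]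
        | succ d ih =>
          intro x y h
          have hx : (x : ℕ) + 1 < k * r := by have := y.2; omega
          exact (ih ⟨x + 1, hx⟩ y (by simp only; omega)).trans (hdesc x hx)
      intro x y hxy
      exact this (y - x) x y (by have : (x : ℕ) ≤ y := hxy; omega)
    have hrev : Antitone (blockOf ∘ blockRev k r : Fin (k * r) → Fin k) := by
      intro x y hxy
      simp only [Function.comp_apply, blockOf_blockRev]
      exact Fin.rev_le_rev.2 (monotone_blockOf hxy)
    have heq := Tuple.unique_antitone hanti hrev
    have hN : monoGL p t * blockAntidiag k r F ∈ parabGL k r F := by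
      intro i j a b hji
      rw [Units.val_mul, blockAntidiag, coe_monoGL, coe_monoGL, mul_monoMat_apply, monoMat_apply,
        if_neg, zero_mul]
      intro e
      rw [blockRev_symm, ← Equiv.symm_apply_eq] at e
      have h1 := congrFun heq (blockRev k r (emb j b))
      simp only [Function.comp_apply, blockRev_blockRev, e, blockOf_emb] at h1
      exact hji.ne' h1
    have hinvol : blockAntidiag k r F * blockAntidiag k r F = 1 := by
      refine Units.ext (Matrix.ext fun x y => ?_)
      rw [Units.val_mul, blockAntidiag, coe_monoGL, monoMat_mul_apply, monoMat_apply,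
        blockRev_blockRev, Units.val_one, Matrix.one_apply]
      simp [eq_comm]
    refine ⟨⟨_, (parabGL k r F).mul_mem ((parabGL k r F).inv_mem (IsUniTri.isParab hu₁)) hN⟩,
      ⟨u₂⁻¹, (uniGL (k * r) F).inv_mem hu₂⟩, ?_⟩
    simp only [mul_assoc]
    rw [← mul_assoc (blockAntidiag k r F), hinvol, one_mul, ← hg]
    simp [mul_assoc]
  · right
    push Not at hdesc
    obtain ⟨j, h, hlt⟩ := hdesc
    obtain ⟨s, hs⟩ : ∃ s, φ (c j * s) ≠ 1 := by
      by_contra! hcon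
      refine hφ (DFunLike.ext _ _ fun s => ?_)
      have := hcon ((c j)⁻¹ * s)
      rwa [mul_inv_cancel_left₀ (hc j h)] at this
    have hjl : j < (⟨j + 1, h⟩ : Fin (k * r)) := Nat.lt_succ_self _
    obtain ⟨x, hx, hxv⟩ := (isUniTri_transvection hjl s).exists_mem_uniGL
    have hmul := monoMat_mul_transvection p t (p.symm j) (p.symm ⟨j + 1, h⟩) s
    rw [Equiv.apply_symm_apply, Equiv.apply_symm_apply] at hmul
    set s' : F := t (p.symm j) * s * ((t (p.symm ⟨j + 1, h⟩))⁻¹ : Fˣ)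
    let y : GL (Fin (k * r)) F := monoGL p t * x * (monoGL p t)⁻¹
    have hy : y.val = Matrix.transvection (p.symm j) (p.symm ⟨j + 1, h⟩) s' := by
      have h1 : y.val * monoMat p t = monoMat p t * x.val :=
        congrArg Units.val (inv_mul_cancel_right (monoGL p t * x) (monoGL p t))
      rw [hxv, hmul] at h1
      exact (monoGL p t).isUnit.mul_right_cancel h1
    have hyP : y ∈ parabGL k r F := by
      change IsParab y.val
      rw [hy]
      exact isParab_transvection hlt _
    let v : parabGL k r F := ⟨u₁, IsUniTri.isParab hu₁⟩
    let w : uniGL (k * r) F := ⟨u₂, hu₂⟩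
    refine ⟨v⁻¹ * ⟨y, hyP⟩ * v, w * ⟨x, hx⟩ * w⁻¹, ?_, ?_, ?_⟩
    · have hg' : g = u₁⁻¹ * monoGL p t * u₂⁻¹ := by
        rw [← hg]
        simp [mul_assoc]
      change u₁⁻¹ * y * u₁ * g = g * (u₂ * x * u₂⁻¹)
      simp only [hg', y]
      simp [mul_assoc]
    · rw [map_mul, map_mul, inflation_eq_one ρ (p := ⟨y, hyP⟩), mul_one, ← map_mul, inv_mul_cancel,
        map_one]
      intro i
      refine Units.ext (Eq.trans ?_ (submatrix_transvection hlt.ne s' i))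
      exact congrArg (fun M => M.submatrix (emb i) (emb i)) hy
    · rw [map_mul, map_mul, mul_right_comm, ← map_mul, mul_inv_cancel, map_one, one_mul,
        psiHom_apply]
      simp only [hxv]
      rwa [psiC_transvection_succ]

end RelevantCoset

section Whittaker

variable {k r : ℕ} {F : Type} [Field F] [Fintype F] {V : Type} [AddCommGroup V] [Module ℂ V]
  [FiniteDimensional ℂ V] {ρ : Representation ℂ (GL (Fin r) F) V}

/-- The functionals on the inducing representation that are compatible with the Whittaker
character along the relevant double coset form a line. -/
theorem exists_tensor_whittaker (hρ : IsIrred ρ) (hcusp : IsCuspidal ρ) {φ : AddChar F ℂ}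
    (hφ : φ ≠ 1) {c : Fin (k * r) → F} (hc : ∀ j : Fin (k * r), (j : ℕ) + 1 < k * r → c j ≠ 0) :
    ∃ L : PiTensorProduct ℂ (fun _ : Fin k => V) →ₗ[ℂ] ℂ, L ≠ 0 ∧
      (∀ (p : parabGL k r F) (u : uniGL (k * r) F),
        (p : GL (Fin (k * r)) F) * blockAntidiag k r F = blockAntidiag k r F * u →
          ∀ v, L (inflation k ρ p v) = psiHom φ c u * L v) ∧
      ∀ M : PiTensorProduct ℂ (fun _ : Fin k => V) →ₗ[ℂ] ℂ,
        (∀ (p : parabGL k r F) (u : uniGL (k * r) F),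
          (p : GL (Fin (k * r)) F) * blockAntidiag k r F = blockAntidiag k r F * u →
            ∀ v, M (inflation k ρ p v) = psiHom φ c u * M v) → ∃ z : ℂ, M = z • L := by
  obtain ⟨v₀, hv₀⟩ := hρ.1
  have hci : ∀ (i : Fin k) (a : Fin r), (a : ℕ) + 1 < r → c (emb i.rev a) ≠ 0 := fun i a h =>
    hc _ (emb i.rev (⟨a + 1, h⟩ : Fin r)).2
  choose L hL0 hL using fun i => exists_whittaker_of_isCuspidal hcusp hv₀ hφ (hci i)
  have hy : ∀ i, ∃ y, L i y = 1 := fun i => by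
    obtain ⟨x, hx⟩ : ∃ x, L i x ≠ 0 := by
      by_contra! h
      exact hL0 i (LinearMap.ext h)
    exact ⟨(L i x)⁻¹ • x, by rw [map_smul, smul_eq_mul, inv_mul_cancel₀ hx]⟩
  choose y hy using hy
  refine ⟨tensorFunctional L, fun h => ?_, fun p u hpu v => ?_, fun M hM => ?_⟩
  · have := tensorFunctional_tprod L y
    rw [h, LinearMap.zero_apply, Finset.prod_eq_one fun i _ => hy i] at this
    exact zero_ne_one this
  · rw [mul_blockAntidiag_eq_iff] at hpu
    suffices h : tensorFunctional L ∘ₗ inflation k ρ p = psiHom φ c u • tensorFunctional L from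
      LinearMap.congr_fun h v
    refine PiTensorProduct.ext (MultilinearMap.ext fun v => ?_)
    simp only [LinearMap.compMultilinearMap_apply, LinearMap.comp_apply, LinearMap.smul_apply]
    rw [inflation_apply, PiTensorProduct.map_tprod, tensorFunctional_tprod, tensorFunctional_tprod,
      psiHom_apply, psiC_eq_prod_levi φ c hpu, smul_eq_mul, ← Finset.prod_mul_distrib]
    exact Finset.prod_congr rfl fun i _ => hL i _ (levi_mem_uniGL u.2 hpu i) _
  · refine ⟨_, eq_smul_tensorFunctional L y M fun v i => ?_⟩
    let Mi : V →ₗ[ℂ] ℂ := M ∘ₗ (PiTensorProduct.tprod ℂ).toLinearMap v i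
    have hMi : ∀ x, Mi x = M (PiTensorProduct.tprod ℂ (Function.update v i x)) := fun x => rfl
    have hWhit : ∀ u ∈ uniGL r F, ∀ x,
        Mi (ρ u x) = psiC φ (fun a => c (emb i.rev a)) u.val * Mi x := by
      intro u hu x
      have hd : ∀ j, Function.update (1 : Fin k → GL (Fin r) F) i u j ∈ uniGL r F := by
        intro j
        rcases eq_or_ne j i with rfl | hj
        · rwa [Function.update_self]
        · rw [Function.update_of_ne hj]
          exact one_mem _
      obtain ⟨p, w, hpw, hlevi⟩ := exists_levi_eq hd
      have h := hM p w (mul_blockAntidiag_eq_iff.2 hpw)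
        (PiTensorProduct.tprod ℂ (Function.update v i x))
      rw [inflation_apply, PiTensorProduct.map_tprod, psiHom_apply, psiC_eq_prod_levi φ c hpw] at h
      simp only [hlevi] at h
      rw [Finset.prod_eq_single i, Function.update_self] at h
      · rw [hMi, hMi, ← h]
        congr 2
        funext j
        rcases eq_or_ne j i with rfl | hj
        · simp only [Function.update_self]
        · simp only [Function.update_of_ne hj, Pi.one_apply, map_one, Module.End.one_apply]
      · intro j _ hj
        rw [Function.update_of_ne hj]
        exact psiC_one _ _
      · exact fun h => absurd (Finset.mem_univ _) h
    obtain ⟨z, hz⟩ := exists_eq_smul_of_whittaker ρ hρ hφ (hci i) (hL0 i) (hL i) hWhit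
    have hval : ∀ x, Mi x = z * L i x := fun x => LinearMap.congr_fun hz x
    rw [← hMi, hval, hy, mul_one, mul_comm, ← hval, hMi, Function.update_eq_self]

/-- Whittaker functionals on the parabolic induction of a tensor power of an irreducible cuspidal
representation form a line. -/
theorem exists_whittaker_inducedRep (hρ : IsIrred ρ) (hcusp : IsCuspidal ρ) {φ : AddChar F ℂ}
    (hφ : φ ≠ 1) {c : Fin (k * r) → F} (hc : ∀ j : Fin (k * r), (j : ℕ) + 1 < k * r → c j ≠ 0) :
    ∃ ℓ₀ : inducedSpace (inflation k ρ) →ₗ[ℂ] ℂ, ℓ₀ ≠ 0 ∧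
      (∀ (u : uniGL (k * r) F) f, ℓ₀ (inducedRep (inflation k ρ) u f) = psiHom φ c u * ℓ₀ f) ∧
      ∀ ℓ : inducedSpace (inflation k ρ) →ₗ[ℂ] ℂ,
        (∀ (u : uniGL (k * r) F) f, ℓ (inducedRep (inflation k ρ) u f) = psiHom φ c u * ℓ f) →
          ∃ z : ℂ, ℓ = z • ℓ₀ := by
  obtain ⟨L, hL0, hL, huniq⟩ := exists_tensor_whittaker (k := k) hρ hcusp hφ hc
  exact exists_equivariant_unique (inflation k ρ) (psiHom φ c) (blockAntidiag k r F)
    (mem_relevant_coset_or ρ hφ hc) L hL0 hL huniq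

end Whittaker

section Frobenius

variable {G W V : Type*} [Group G] [AddCommGroup W] [Module ℂ W] [AddCommGroup V] [Module ℂ V]
  {P : Subgroup G} {σ : Representation ℂ P W} {π : Representation ℂ G V}

/-- Frobenius reciprocity: the map into the induced representation attached to a
`P`-intertwiner. -/
def frobeniusMap (T : V →ₗ[ℂ] W) (hT : ∀ (p : P) v, T (π p v) = σ p (T v)) :
    V →ₗ[ℂ] inducedSpace σ where
  toFun v := ⟨fun g => T (π g v), fun p g => by
    change T (π (p * g) v) = σ p (T (π g v))
    rw [map_mul, Module.End.mul_apply, hT]⟩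
  map_add' v w := Subtype.ext (funext fun g => by
    change T (π g (v + w)) = T (π g v) + T (π g w)
    rw [map_add, map_add])
  map_smul' t v := Subtype.ext (funext fun g => by
    change T (π g (t • v)) = t • T (π g v)
    rw [map_smul, map_smul])

variable {T : V →ₗ[ℂ] W} (hT : ∀ (p : P) v, T (π p v) = σ p (T v))

lemma frobeniusMap_apply (v : V) (g : G) : (frobeniusMap T hT v).1 g = T (π g v) := rfl

lemma frobeniusMap_ne_zero (h : T ≠ 0) : frobeniusMap T hT ≠ 0 := fun h0 => h <| by
  ext v
  have := congrFun (congrArg Subtype.val (LinearMap.congr_fun h0 v)) 1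
  rwa [frobeniusMap_apply, map_one, Module.End.one_apply] at this

lemma frobeniusMap_comm (g : G) (v : V) :
    frobeniusMap T hT (π g v) = inducedRep σ g (frobeniusMap T hT v) :=
  Subtype.ext (funext fun x => by
    rw [inducedRep_apply, frobeniusMap_apply, frobeniusMap_apply, map_mul, Module.End.mul_apply])

end Frobenius

section

variable {k r : ℕ} {F : Type} [Field F] [Fintype F] {V Vπ : Type} [AddCommGroup V] [Module ℂ V]
  [AddCommGroup Vπ] [Module ℂ Vπ] {ρ : Representation ℂ (GL (Fin r) F) V}
  {π : Representation ℂ (GL (Fin (k * r)) F) Vπ}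

lemma intertwinesParab_iff (T : Vπ →ₗ[ℂ] PiTensorProduct ℂ (fun _ : Fin k => V)) :
    IntertwinesParab ρ π T ↔ ∀ (p : parabGL k r F) v, T (π p v) = inflation k ρ p (T v) := by
  constructor
  · exact fun h p v => h p p.2 (fun i => levi i p) (fun i a b => rfl) v
  · intro h p hp d hd v
    have : d = fun i => levi i ⟨p, hp⟩ := funext fun i => Units.ext (Matrix.ext (hd i))
    rw [this]
    exact h ⟨p, hp⟩ v

end

/-- Let `ρ` be an irreducible cuspidal representation of `GL_r(𝔽_q)` and
`ψ = ψ_c` a nondegenerate character of the upper unitriangular subgroup of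
`GL_{rk}(𝔽_q)`.  Then (1) the space of `ψ`-Whittaker functionals on the parabolic
induction of `ρ^{⊗k}` to `GL_{rk}(𝔽_q)` is exactly one-dimensional, and (2) exactly
one irreducible constituent of this parabolic induction (counted up to isomorphism,
i.e. by its character) admits a nonzero `ψ`-Whittaker functional. -/
theorem stmt14 (q : ℕ) (hq : IsPrimePow q)
    (F : Type) [Field F] [Fintype F] (hF : Fintype.card F = q)
    (r k : ℕ) (hr : 1 ≤ r) (hk : 1 ≤ k)
    (V : Type) [AddCommGroup V] [Module ℂ V] [FiniteDimensional ℂ V]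
    (ρ : Representation ℂ (GL (Fin r) F) V)
    (hρirr : IsIrred ρ) (hρcusp : IsCuspidal ρ)
    (φ : AddChar F ℂ) (hφ : φ ≠ 1)
    (c : Fin (k * r) → F) (hc : ∀ j : Fin (k * r), (j : ℕ) + 1 < k * r → c j ≠ 0) :
    (∃ ℓ₀ : (IndSpace F r k V ρ) →ₗ[ℂ] ℂ, ℓ₀ ≠ 0 ∧
      (∀ u : GL (Fin (k * r)) F,
        IsUniTri (u : Matrix (Fin (k * r)) (Fin (k * r)) F) →
        ∀ f : IndSpace F r k V ρ, ℓ₀ (rTrans u f) =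
          psiC φ c (u : Matrix (Fin (k * r)) (Fin (k * r)) F) * ℓ₀ f) ∧
      ∀ ℓ : (IndSpace F r k V ρ) →ₗ[ℂ] ℂ,
        (∀ u : GL (Fin (k * r)) F,
          IsUniTri (u : Matrix (Fin (k * r)) (Fin (k * r)) F) →
          ∀ f : IndSpace F r k V ρ, ℓ (rTrans u f) =
            psiC φ c (u : Matrix (Fin (k * r)) (Fin (k * r)) F) * ℓ f) →
        ∃ z : ℂ, ℓ = z • ℓ₀) ∧
    (∃! χ : GL (Fin (k * r)) F → ℂ,
      ∃ (Vπ : Type) (_ : AddCommGroup Vπ) (_ : Module ℂ Vπ) (_ : FiniteDimensional ℂ Vπ)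
        (π : Representation ℂ (GL (Fin (k * r)) F) Vπ),
        IsIrred π ∧
        (∃ T : Vπ →ₗ[ℂ] PiTensorProduct ℂ (fun _ : Fin k => V),
          T ≠ 0 ∧ IntertwinesParab ρ π T) ∧
        (∃ ℓ : Vπ →ₗ[ℂ] ℂ, ℓ ≠ 0 ∧
          ∀ u : GL (Fin (k * r)) F,
            IsUniTri (u : Matrix (Fin (k * r)) (Fin (k * r)) F) →
            ∀ v : Vπ, ℓ (π u v) =
              psiC φ c (u : Matrix (Fin (k * r)) (Fin (k * r)) F) * ℓ v) ∧
        χ = fun g => LinearMap.trace ℂ Vπ (π g)) := by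
  have hI : IndSpace F r k V ρ = inducedSpace (inflation k ρ) := indSpace_eq_inducedSpace ρ
  let e : IndSpace F r k V ρ ≃ₗ[ℂ] inducedSpace (inflation k ρ) := LinearEquiv.ofEq _ _ hI
  have he : ∀ u f, e (rTrans u f) = inducedRep (inflation k ρ) u (e f) := fun u f => rfl
  have he' : ∀ u f, e.symm (inducedRep (inflation k ρ) u f) = rTrans u (e.symm f) :=
    fun u f => rfl
  obtain ⟨ℓ₀, hℓ₀, hequiv, huniq⟩ := exists_whittaker_inducedRep (k := k) hρirr hρcusp hφ hc
  refine ⟨⟨ℓ₀ ∘ₗ e.toLinearMap, ?_, fun u hu f => ?_, fun ℓ hℓ => ?_⟩, ?_⟩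
  · intro h
    refine hℓ₀ (LinearMap.ext fun f => ?_)
    simpa using LinearMap.congr_fun h (e.symm f)
  · exact (congrArg ℓ₀ (he u f)).trans (hequiv ⟨u, hu⟩ (e f))
  · obtain ⟨z, hz⟩ := huniq (ℓ ∘ₗ e.symm.toLinearMap) fun u f =>
      (congrArg ℓ (he' u f)).trans (hℓ u u.2 _)
    refine ⟨z, LinearMap.ext fun f => ?_⟩
    simpa using LinearMap.congr_fun hz (e f)
  · obtain ⟨S, hS, v, hvS, hv⟩ := exists_irred_subrepresentation (inducedRep (inflation k ρ)) ℓ₀ hℓ₀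
    let T : S.toSubmodule →ₗ[ℂ] PiTensorProduct ℂ (fun _ : Fin k => V) :=
      LinearMap.proj 1 ∘ₗ (inducedSpace (inflation k ρ)).subtype ∘ₗ S.toSubmodule.subtype
    have hTapply : ∀ f, T f = f.1.1 1 := fun f => rfl
    have hT0 : T ≠ 0 := by
      intro h
      refine hv ?_
      have : v = 0 := Subtype.ext (funext fun g => by
        have := LinearMap.congr_fun h (S.toRepresentation g ⟨v, hvS⟩)
        rw [hTapply] at this
        change v.1 (1 * g) = 0 at this
        rwa [one_mul] at this)
      rw [this, map_zero]
    have hT : ∀ (p : parabGL k r F) f,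
        T (S.toRepresentation p f) = inflation k ρ p (T f) := by
      intro p f
      have := f.1.2 p 1
      rw [mul_one, ← one_mul (p : GL (Fin (k * r)) F)] at this
      exact this
    have hℓS : ℓ₀ ∘ₗ S.toSubmodule.subtype ≠ 0 := fun h =>
      hv (LinearMap.congr_fun h ⟨v, hvS⟩)
    refine ⟨_, ⟨S.toSubmodule, inferInstance, inferInstance, inferInstance, S.toRepresentation, hS,
      ⟨T, hT0, (intertwinesParab_iff _).2 hT⟩, ⟨_, hℓS, fun u hu f => hequiv ⟨u, hu⟩ f.1⟩, rfl⟩, ?_⟩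
    rintro χ ⟨Vπ, _, _, _, π, hπ, ⟨T', hT'0, hT'⟩, ⟨ℓ, hℓ, hℓw⟩, rfl⟩
    rw [intertwinesParab_iff] at hT'
    funext g
    have h₁ := frobeniusMap_comm hT'
    have h₂ := frobeniusMap_comm (V := S.toSubmodule) (π := S.toRepresentation) (T := T) hT
    refine trace_eq_of_multiplicity_one hπ hS (psiHom φ c) ℓ₀ huniq _ _
      (frobeniusMap_ne_zero hT' hT'0) (frobeniusMap_ne_zero (V := S.toSubmodule) hT hT0) h₁ h₂
      ℓ _ hℓ hℓS (fun u v => hℓw u u.2 v)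
      (fun u f => hequiv u f.1) g
end
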